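/- arXiv:math/0611473 — 9 statements merged into one kernel-verified Lean document; each statement's English description precedes it below -/
import Mathlib

section
/- Fix λ > 0 and γ ≥ 0, and let p be a probability density with respect to Q that has γ-exponent at level λ with respect to Q. Then for any constant L_Q > 0 there exists a constant C > 0 such that for all measurable sets G₁, G₂ ⊆ 𝒳 satisfying Q(G₁ Δ G₂) ≤ L_Q, one has d_Δ(G₁, G₂) ≤ Q(G₁ Δ G₂ ∩ {x : p(x) = λ}) + C (d_H(G₁, G₂))^{γ/(1+γ)}. -/
open MeasureTheory ENNReal

/-- If `m ≤ c₀ * ε ^ γ + h / ε` for all small `ε`, optimizing over `ε` bounds `m` by a multiple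
of `h ^ (γ / (1 + γ))`, uniformly over bounded `m`. -/
lemma exists_le_mul_rpow_of_forall_le_add_div {γ c₀ ε₀ L : ℝ} (hγ : 0 < γ) (hc₀ : 0 < c₀)
    (hε₀ : 0 < ε₀) :
    ∃ C : ℝ, 0 < C ∧ ∀ m h : ℝ, 0 < m → m ≤ L → 0 ≤ h →
      (∀ ε : ℝ, 0 < ε → ε ≤ ε₀ → m ≤ c₀ * ε ^ γ + h / ε) → m ≤ C * h ^ (γ / (1 + γ)) := by
  set c : ℝ := max c₀ (L / (2 * ε₀ ^ γ)) with hc_def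
  have hc : 0 < c := lt_max_of_lt_left hc₀
  have hcL : L ≤ 2 * c * ε₀ ^ γ := by
    have h1 : L / (2 * ε₀ ^ γ) ≤ c := le_max_right _ _
    rw [div_le_iff₀ (by positivity)] at h1
    linarith
  refine ⟨(2 * (2 * c) ^ (1 / γ)) ^ (γ / (1 + γ)), by positivity, fun m h hm hmL hh hmh => ?_⟩
  have hq : 0 < m / (2 * c) := by positivity
  have hε : 0 < (m / (2 * c)) ^ (1 / γ) := by positivity
  have hεγ : ((m / (2 * c)) ^ (1 / γ)) ^ γ = m / (2 * c) := by
    rw [← Real.rpow_mul hq.le, one_div_mul_cancel hγ.ne', Real.rpow_one]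
  have hεε₀ : (m / (2 * c)) ^ (1 / γ) ≤ ε₀ := by
    rw [← Real.rpow_le_rpow_iff hε.le hε₀.le hγ, hεγ, div_le_iff₀ (by positivity)]
    linarith
  have key := hmh _ hε hεε₀
  have hhalf : c₀ * (m / (2 * c)) ≤ m / 2 := by
    calc c₀ * (m / (2 * c)) ≤ c * (m / (2 * c)) := by
          gcongr
          exact le_max_left _ _
      _ = m / 2 := by field_simp
  rw [hεγ] at key
  have hmε : m / 2 ≤ h / (m / (2 * c)) ^ (1 / γ) := by linarith
  rw [le_div_iff₀ hε, Real.div_rpow hm.le (by positivity), mul_div_assoc',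
    div_le_iff₀ (by positivity)] at hmε
  have hpow : m ^ ((1 + γ) / γ) ≤ 2 * (2 * c) ^ (1 / γ) * h := by
    have he : (1 + γ) / γ = 1 + 1 / γ := by field_simp; ring
    rw [he, Real.rpow_add hm, Real.rpow_one]
    linarith
  calc m = (m ^ ((1 + γ) / γ)) ^ (γ / (1 + γ)) := by
        rw [← Real.rpow_mul hm.le, div_mul_div_cancel₀ hγ.ne', div_self (by positivity),
          Real.rpow_one]
    _ ≤ (2 * (2 * c) ^ (1 / γ) * h) ^ (γ / (1 + γ)) := by gcongr
    _ = _ := Real.mul_rpow (by positivity) hh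

/-- Markov's inequality away from the small positive values of `f`. -/
lemma measure_inter_pos_le_add_lintegral_div {α : Type*} [MeasurableSpace α] (μ : Measure α)
    {f : α → ℝ} (hf : Measurable f) (D : Set α) {ε : ℝ} (hε : 0 < ε) :
    μ (D ∩ {x | 0 < f x}) ≤ μ {x | 0 < f x ∧ f x ≤ ε} +
      (∫⁻ x in D, ENNReal.ofReal (f x) ∂μ) / ENNReal.ofReal ε := by
  have hmeas : MeasurableSet {x | ENNReal.ofReal ε ≤ ENNReal.ofReal (f x)} :=
    measurableSet_le measurable_const hf.ennreal_ofReal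
  calc μ (D ∩ {x | 0 < f x})
      ≤ μ ({x | 0 < f x ∧ f x ≤ ε} ∪ ({x | ENNReal.ofReal ε ≤ ENNReal.ofReal (f x)} ∩ D)) := by
        refine measure_mono fun x ⟨hxD, hx⟩ => ?_
        rcases le_total (f x) ε with h | h
        · exact Or.inl ⟨hx, h⟩
        · exact Or.inr ⟨ENNReal.ofReal_le_ofReal h, hxD⟩
    _ ≤ _ := measure_union_le _ _
    _ ≤ _ := by
        gcongr
        rw [← Measure.restrict_apply hmeas]
        exact meas_ge_le_lintegral_div hf.ennreal_ofReal.aemeasurable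
          (ENNReal.ofReal_pos.2 hε).ne' ENNReal.ofReal_ne_top

/-- **Proposition 2.1.** Fix `λ > 0`, `γ ≥ 0`, and let `p` be a probability density with
respect to a positive σ-finite measure `Q` on `𝒳 ⊆ ℝ^d` that has `γ`-exponent at level `λ`
with respect to `Q`.  Then for any constant `L_Q > 0` there exists a constant `C > 0` such
that for all measurable sets `G₁, G₂` with `Q(G₁ Δ G₂) ≤ L_Q`, one has
`d_Δ(G₁, G₂) ≤ Q(G₁ Δ G₂ ∩ {p = λ}) + C * (d_H(G₁, G₂))^(γ/(1+γ))`,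
where `d_Δ(G₁,G₂) = Q(G₁ Δ G₂)` and `d_H(G₁,G₂) = ∫_{G₁ Δ G₂} |p - λ| dQ`. -/
theorem dDelta_le_dH_pow (d : ℕ) (Q : Measure (EuclideanSpace ℝ (Fin d))) [SigmaFinite Q]
    (lam γ : ℝ) (hlam : 0 < lam) (hγ : 0 ≤ γ)
    (p : EuclideanSpace ℝ (Fin d) → ℝ) (hpmeas : Measurable p) (hpnn : ∀ x, 0 ≤ p x)
    (hpdens : ∫⁻ x, ENNReal.ofReal (p x) ∂Q = 1)
    -- `p` has `γ`-exponent at level `lam` with respect to `Q`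
    (hexp : ∃ c₀ > (0 : ℝ), ∃ ε₀ > (0 : ℝ), ∀ ε : ℝ, 0 < ε → ε ≤ ε₀ →
      Q {x | 0 < |p x - lam| ∧ |p x - lam| ≤ ε} ≤ ENNReal.ofReal (c₀ * ε ^ γ)) :
    ∀ L_Q : ℝ, 0 < L_Q → ∃ C : ℝ, 0 < C ∧
      ∀ G₁ G₂ : Set (EuclideanSpace ℝ (Fin d)), MeasurableSet G₁ → MeasurableSet G₂ →
        Q (symmDiff G₁ G₂) ≤ ENNReal.ofReal L_Q →
        Q (symmDiff G₁ G₂) ≤ Q (symmDiff G₁ G₂ ∩ {x | p x = lam}) +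
          ENNReal.ofReal C *
            (∫⁻ x in symmDiff G₁ G₂, ENNReal.ofReal |p x - lam| ∂Q) ^ (γ / (1 + γ)) := by
  intro L_Q hL
  obtain ⟨c₀, hc₀, ε₀, hε₀, hexp⟩ := hexp
  have hf : Measurable fun x => |p x - lam| := (hpmeas.sub_const lam).abs
  rcases hγ.eq_or_lt with rfl | hγ
  · refine ⟨L_Q, hL, fun G₁ G₂ _ _ hG => ?_⟩
    rw [zero_div, ENNReal.rpow_zero, mul_one]
    exact hG.trans le_add_self
  obtain ⟨C, hC, hbound⟩ :=
    exists_le_mul_rpow_of_forall_le_add_div (L := L_Q) hγ hc₀ hε₀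
  refine ⟨C, hC, fun G₁ G₂ _ _ hG => ?_⟩
  set D := symmDiff G₁ G₂
  set H := ∫⁻ x in D, ENNReal.ofReal |p x - lam| ∂Q
  have hsplit : Q D ≤ Q (D ∩ {x | p x = lam}) + Q (D ∩ {x | 0 < |p x - lam|}) := by
    refine (measure_mono fun x hx => ?_).trans (measure_union_le _ _)
    by_cases h : p x = lam
    · exact Or.inl ⟨hx, h⟩
    · exact Or.inr ⟨hx, abs_pos.2 (sub_ne_zero.2 h)⟩
  refine hsplit.trans ?_
  gcongr
  have hexponent : 0 < γ / (1 + γ) := by positivity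
  by_cases hH : H = ⊤
  · rw [hH, ENNReal.top_rpow_of_pos hexponent,
      ENNReal.mul_top (ENNReal.ofReal_pos.2 hC).ne']
    exact le_top
  have hmL : Q (D ∩ {x | 0 < |p x - lam|}) ≤ ENNReal.ofReal L_Q :=
    (measure_mono Set.inter_subset_left).trans hG
  have hmarkov := fun ε (hε : 0 < ε) (hεε₀ : ε ≤ ε₀) =>
    (measure_inter_pos_le_add_lintegral_div Q hf D hε).trans
      (add_le_add_left (hexp ε hε hεε₀) _)
  set m := Q (D ∩ {x | 0 < |p x - lam|})
  have hm : m ≠ ⊤ := ne_top_of_le_ne_top ENNReal.ofReal_ne_top hmL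
  rcases eq_or_ne m 0 with hm0 | hm0
  · rw [hm0]
    exact zero_le
  rw [← ENNReal.ofReal_toReal hm, ← ENNReal.ofReal_toReal hH,
    ENNReal.ofReal_rpow_of_nonneg ENNReal.toReal_nonneg hexponent.le,
    ← ENNReal.ofReal_mul hC.le]
  refine ENNReal.ofReal_le_ofReal (hbound _ _ (ENNReal.toReal_pos hm0 hm)
    (ENNReal.toReal_le_of_le_ofReal hL.le hmL) ENNReal.toReal_nonneg fun ε hε hεε₀ => ?_)
  refine ENNReal.toReal_le_of_le_ofReal (by positivity) ((hmarkov ε hε hεε₀).trans_eq ?_)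
  change ENNReal.ofReal (c₀ * ε ^ γ) + H / ENNReal.ofReal ε = _
  rw [ENNReal.ofReal_add (by positivity) (by positivity), ENNReal.ofReal_div_of_pos hε,
    ENNReal.ofReal_toReal hH]
end

section
/- Fix β, L, r, λ, γ, β', L*, η > 0 with γ(β ∧ 1) > 1. Then for every density p in the class P_Σ(β,L,r,λ,γ,β',L*,η), either the level set Γ_p(λ) = {x : p(x) > λ} has empty interior or its complement {x : p(x) ≤ λ} has empty interior. -/
open MeasureTheory ENNReal

/-- The `(β,L,r,x₀)`-locally Hölder class `Σ(β,L,r,x₀)`: functions that are `⌊β⌋` times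
continuously differentiable at `x₀` and whose Taylor polynomial of degree `⌊β⌋` at `x₀`
approximates them up to `L‖x-x₀‖^β` on the closed ball of radius `r` around `x₀`. -/
def LocHolder {d : ℕ} (β L r : ℝ) (x₀ : EuclideanSpace ℝ (Fin d))
    (g : EuclideanSpace ℝ (Fin d) → ℝ) : Prop :=
  ContDiffAt ℝ (⌊β⌋₊) g x₀ ∧
    ∀ x ∈ Metric.closedBall x₀ r,
      |g x - ∑ k ∈ Finset.range (⌊β⌋₊ + 1),
          ((k.factorial : ℝ))⁻¹ * iteratedFDeriv ℝ k g x₀ (fun _ => x - x₀)| ≤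
        L * ‖x - x₀‖ ^ β

/-- The class `P_Σ(β,L,r,λ,γ,β',L*,η)` of probability densities on `ℝ^d` (w.r.t. Lebesgue
measure) that are locally `β`-Hölder a.e. on the neighborhood `𝒟(η) = {λ-η < p < λ+η}`,
locally `β'`-Hölder a.e. outside of it, have `γ`-exponent at level `λ` w.r.t. Lebesgue
measure, and are uniformly bounded by `L*`. -/
def MemPSigma {d : ℕ} (β L r lam γ β' Lstar η : ℝ)
    (p : EuclideanSpace ℝ (Fin d) → ℝ) : Prop :=
  Measurable p ∧ (∀ x, 0 ≤ p x) ∧ (∫⁻ x, ENNReal.ofReal (p x) = 1) ∧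
    (∀ᵐ x₀, lam - η < p x₀ → p x₀ < lam + η → LocHolder β L r x₀ p) ∧
    (∀ᵐ x₀, η ≤ |p x₀ - lam| → LocHolder β' L r x₀ p) ∧
    (∃ c₀ > (0 : ℝ), ∃ ε₀ > (0 : ℝ), ∀ ε : ℝ, 0 < ε → ε ≤ ε₀ →
      volume {x | 0 < |p x - lam| ∧ |p x - lam| ≤ ε} ≤ ENNReal.ofReal (c₀ * ε ^ γ)) ∧
    (∀ x, p x ≤ Lstar)

open Filter Topology

/-- The coefficients of a polynomial of degree at most `n` are controlled by its values on the
unit interval. -/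
theorem exists_forall_abs_coeff_le (n : ℕ) : ∃ K : ℝ, 0 ≤ K ∧ ∀ (c : ℕ → ℝ) (M : ℝ),
    (∀ t ∈ Set.Icc (0 : ℝ) 1, |∑ k ∈ Finset.range (n + 1), c k * t ^ k| ≤ M) →
      ∀ k ∈ Finset.range (n + 1), |c k| ≤ K * M := by
  let v : Fin (n + 1) → ℝ := fun i => (i : ℝ) / (n + 1)
  have hn : (0 : ℝ) < n + 1 := by positivity
  have hv : Function.Injective v := by
    intro i j hij
    have : (i : ℝ) = j := (div_left_inj' hn.ne').1 hij
    exact Fin.ext (by exact_mod_cast this)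
  let V := Matrix.vandermonde v
  have hV : IsUnit V.det := isUnit_iff_ne_zero.2 (Matrix.det_vandermonde_ne_zero_iff.2 hv)
  refine ⟨∑ i, ∑ j, |V⁻¹ i j|, by positivity, fun c M hM k hk => ?_⟩
  have hM0 : 0 ≤ M := (abs_nonneg _).trans (hM 0 (by simp))
  let q : Fin (n + 1) → ℝ := V.mulVec (fun i => c i)
  have hq : ∀ j, |q j| ≤ M := by
    intro j
    have h := hM (v j) ⟨by positivity, by
      rw [div_le_one hn]
      exact_mod_cast j.2.le⟩
    rw [Finset.sum_range] at h
    convert h using 3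
    simp [q, Matrix.mulVec, dotProduct, V, Matrix.vandermonde_apply, mul_comm]
  have hc : V⁻¹.mulVec q = fun i : Fin (n + 1) => c i := by
    simp [q, Matrix.mulVec_mulVec, Matrix.nonsing_inv_mul _ hV]
  have hck := congrFun hc ⟨k, Finset.mem_range.1 hk⟩
  simp only [Matrix.mulVec, dotProduct] at hck
  rw [← hck, Finset.sum_mul]
  refine (Finset.abs_sum_le_sum_abs _ _).trans ?_
  refine le_trans ?_ (Finset.single_le_sum (f := fun i => (∑ j, |V⁻¹ i j|) * M)
    (fun i _ => by positivity) (Finset.mem_univ ⟨k, Finset.mem_range.1 hk⟩))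
  simp only [Finset.sum_mul, abs_mul]
  gcongr with j
  exact hq j

/-- A bounded function in the local Hölder class of exponent `β` at `x₀` is Hölder of exponent
`min β 1` at `x₀`, with a constant that does not depend on `x₀`. -/
theorem LocHolder.exists_abs_sub_le {d : ℕ} {β L r B : ℝ} (hβ : 0 < β) (hL : 0 < L) (hr : 0 < r)
    (hB : 0 < B) : ∃ C : ℝ, 0 < C ∧ ∀ (g : EuclideanSpace ℝ (Fin d) → ℝ) (x₀ : _),
      (∀ x, |g x| ≤ B) → LocHolder β L r x₀ g →
        ∀ x, ‖x - x₀‖ ≤ min r 1 → |g x - g x₀| ≤ C * ‖x - x₀‖ ^ min β 1 := by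
  set n := ⌊β⌋₊ with hn
  obtain ⟨K, hK, hcoeff⟩ := exists_forall_abs_coeff_le n
  set M := B + L * r ^ β with hM
  have hM0 : 0 < M := by positivity
  refine ⟨L + n * (K * M) / r, by positivity, fun g x₀ hg hloc x hx => ?_⟩
  set h := ‖x - x₀‖ with hh
  have h0 : 0 ≤ h := norm_nonneg _
  have hxr : h ≤ r := hx.trans (min_le_left _ _)
  have hx1 : h ≤ 1 := hx.trans (min_le_right _ _)
  rcases h0.eq_or_lt with h00 | hpos
  · have : x = x₀ := by rwa [eq_comm, hh, norm_eq_zero, sub_eq_zero] at h00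
    subst this
    simp only [sub_self, abs_zero]
    positivity
  have hmin : 0 < min β 1 := lt_min hβ one_pos
  have hle1 : h ^ β ≤ h ^ min β 1 :=
    Real.rpow_le_rpow_of_exponent_ge hpos hx1 (min_le_left _ _)
  have hle2 : h ≤ h ^ min β 1 := by
    simpa using Real.rpow_le_rpow_of_exponent_ge hpos hx1 (min_le_right β 1)
  set u := (r / h) • (x - x₀) with hu
  have hun : ‖u‖ = r := by
    rw [hu, norm_smul, ← hh, Real.norm_of_nonneg (by positivity), div_mul_cancel₀ _ hpos.ne']
  let c : ℕ → ℝ := fun k => ((k.factorial : ℝ))⁻¹ * iteratedFDeriv ℝ k g x₀ (fun _ => u)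
  have htaylor : ∀ t ∈ Set.Icc (0 : ℝ) 1,
      |g (x₀ + t • u) - ∑ k ∈ Finset.range (n + 1), c k * t ^ k| ≤ L * (t * r) ^ β := by
    intro t ht
    have hnorm : ‖t • u‖ = t * r := by
      rw [norm_smul, hun, Real.norm_of_nonneg ht.1]
    have := hloc.2 (x₀ + t • u) (by
      rw [Metric.mem_closedBall, dist_eq_norm, add_sub_cancel_left, hnorm]
      exact mul_le_of_le_one_left hr.le ht.2)
    simp only [add_sub_cancel_left, hnorm] at this
    convert this using 4 with k hk
    rw [ContinuousMultilinearMap.map_smul_univ _ (fun _ => t) (fun _ => u)]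
    simp [c]
    ring
  have hc := hcoeff c M fun t ht => by
    have h1 := htaylor t ht
    have h2 : (t * r) ^ β ≤ r ^ β :=
      Real.rpow_le_rpow (mul_nonneg ht.1 hr.le) (mul_le_of_le_one_left hr.le ht.2) hβ.le
    have h3 := hg (x₀ + t • u)
    have h4 := mul_le_mul_of_nonneg_left h2 hL.le
    rw [abs_le] at *
    constructor <;> linarith
  have hs : h / r ∈ Set.Icc (0 : ℝ) 1 := ⟨by positivity, (div_le_one hr).2 hxr⟩
  have hx' := htaylor (h / r) hs
  have hxu : x₀ + (h / r) • u = x := by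
    rw [hu, smul_smul, div_mul_div_cancel₀ hr.ne', div_self hpos.ne', one_smul]
    abel
  rw [hxu, div_mul_cancel₀ _ hr.ne', Finset.sum_range_succ'] at hx'
  have hc0 : c 0 * (h / r) ^ 0 = g x₀ := by simp [c]
  have hsum : |∑ k ∈ Finset.range n, c (k + 1) * (h / r) ^ (k + 1)| ≤ n * (K * M) / r * h := by
    calc _ ≤ ∑ k ∈ Finset.range n, |c (k + 1) * (h / r) ^ (k + 1)| :=
          Finset.abs_sum_le_sum_abs _ _
      _ ≤ ∑ k ∈ Finset.range n, K * M * (h / r) := by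
          refine Finset.sum_le_sum fun k hk => ?_
          rw [abs_mul, abs_of_nonneg (pow_nonneg hs.1 _)]
          refine mul_le_mul (hc (k + 1) (by simpa using hk)) ?_ (pow_nonneg hs.1 _) (by positivity)
          exact pow_le_of_le_one hs.1 hs.2 (Nat.succ_ne_zero k)
      _ = _ := by simp; ring
  rw [hc0] at hx'
  have h1 : n * (K * M) / r * h ≤ n * (K * M) / r * h ^ min β 1 := by gcongr
  have h2 : L * h ^ β ≤ L * h ^ min β 1 := by gcongr
  rw [abs_le] at *
  constructor <;> nlinarith

/-- If almost every point of `A` that leaves `A` under translation by `w` lies in `D`, then a set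
of points of `A` that have left `A` after `N` such translations has measure at most `N` times that
of `D`. -/
theorem measure_le_nat_mul_of_translate {E : Type*} [AddCommGroup E] [MeasurableSpace E]
    [MeasurableAdd E] {μ : Measure E} [μ.IsAddRightInvariant] {A B D : Set E} {w : E} (N : ℕ)
    (hD : ∀ᵐ x ∂μ, x ∈ A → x + w ∉ A → x ∈ D) (hBA : B ⊆ A) (hB : ∀ x ∈ B, x + N • w ∉ A) :
    μ B ≤ N * μ D := by
  have hae : ∀ᵐ x ∂μ, ∀ k : ℕ, x + k • w ∈ A → x + k • w + w ∉ A → x + k • w ∈ D :=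
    ae_all_iff.2 fun k =>
      (measurePreserving_add_right μ (k • w)).quasiMeasurePreserving.ae hD
  calc μ B ≤ μ (⋃ k ∈ Finset.range N, (fun x => x + k • w) ⁻¹' D) := by
        refine measure_mono_ae ?_
        filter_upwards [hae] with x hx hxB
        by_contra hnot
        have hmem : ∀ k ≤ N, x + k • w ∈ A := by
          intro k
          induction k with
          | zero => exact fun _ => by simpa using hBA hxB
          | succ k ih =>
            intro hk
            by_contra hA
            rw [succ_nsmul, ← add_assoc] at hA
            exact hnot (Set.mem_biUnion (Finset.mem_coe.2 (Finset.mem_range.2 hk))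
              (hx k (ih (by omega)) hA))
        exact hB x hxB (hmem N le_rfl)
    _ ≤ ∑ k ∈ Finset.range N, μ ((fun x => x + k • w) ⁻¹' D) := measure_biUnion_finset_le _ _
    _ = N * μ D := by simp [measure_preimage_add_right]

/-- **Proposition 4.1 (first part).**  If `γ(β ∧ 1) > 1`, then for every density `p` in the
class `P_Σ(β,L,r,λ,γ,β',L*,η)`, either the level set `Γ_p(λ) = {p > λ}` has empty interior
or its complement `{p ≤ λ}` has empty interior. -/
theorem empty_interior_of_gamma_beta_large (d : ℕ) (β L r lam γ β' Lstar η : ℝ)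
    (hβ : 0 < β) (hL : 0 < L) (hr : 0 < r) (hlam : 0 < lam) (hγ : 0 < γ)
    (hβ' : 0 < β') (hLstar : 0 < Lstar) (hη : 0 < η)
    (hγβ : 1 < γ * min β 1)
    (p : EuclideanSpace ℝ (Fin d) → ℝ) (hp : MemPSigma β L r lam γ β' Lstar η p) :
    interior {x | lam < p x} = ∅ ∨ interior {x | p x ≤ lam} = ∅ := by
  obtain ⟨-, hp0, -, hnear, hfar, ⟨c₀, hc₀, ε₀, hε₀, hexp⟩, hpL⟩ := hp
  by_contra! hne
  obtain ⟨⟨a, ha⟩, b, hb⟩ := hne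
  set v := b - a with hv
  set B := interior {x | lam < p x} ∩ (fun x => x + v) ⁻¹' interior {x | p x ≤ lam} with hBdef
  have hBopen : IsOpen B :=
    isOpen_interior.inter (isOpen_interior.preimage (continuous_add_const v))
  have hBpos : 0 < volume B := hBopen.measure_pos volume ⟨a, ha, by simpa [hv] using hb⟩
  have hbdd : ∀ x, |p x| ≤ Lstar := fun x => (abs_of_nonneg (hp0 x)).trans_le (hpL x)
  obtain ⟨C, hC, hCp⟩ := LocHolder.exists_abs_sub_le (d := d) hβ hL hr hLstar
  obtain ⟨C', hC', hCp'⟩ := LocHolder.exists_abs_sub_le (d := d) hβ' hL hr hLstar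
  set α := min β 1
  have hα : 0 < α := lt_min hβ one_pos
  have hα' : 0 < min β' 1 := lt_min hβ' one_pos
  let e : ℕ → ℝ := fun N => (‖v‖ + 1) / N
  have he : Tendsto e atTop (𝓝 0) := tendsto_const_div_atTop_nhds_zero_nat _
  have hpow : ∀ (s A : ℝ), 0 < s → Tendsto (fun N => A * e N ^ s) atTop (𝓝 0) := by
    intro s A hs
    simpa [Real.zero_rpow hs.ne'] using (he.rpow_const (Or.inr hs.le)).const_mul A
  have hlim : Tendsto (fun N => ENNReal.ofReal (c₀ * C ^ γ * (‖v‖ + 1) * e N ^ (γ * α - 1)))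
      atTop (𝓝 0) := by
    simpa using ENNReal.tendsto_ofReal (hpow (γ * α - 1) (c₀ * C ^ γ * (‖v‖ + 1)) (by linarith))
  refine hBpos.not_ge (ge_of_tendsto hlim ?_)
  filter_upwards [eventually_gt_atTop 0, he.eventually_lt_const (lt_min hr one_pos),
    (hpow α C hα).eventually_lt_const hε₀, (hpow _ C' hα').eventually_lt_const hη]
    with N hN heN hεN hηN
  have hN' : (0 : ℝ) < N := by exact_mod_cast hN
  have hepos : 0 < e N := by positivity
  set w := (N : ℝ)⁻¹ • v with hw
  have hwe : ‖w‖ ≤ e N := by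
    rw [hw, norm_smul, norm_inv, Real.norm_natCast, inv_mul_eq_div]
    exact div_le_div_of_nonneg_right (by linarith) hN'.le
  have hstep : ∀ᵐ x, x ∈ {x | lam < p x} → x + w ∉ {x | lam < p x} →
      x ∈ {x | 0 < |p x - lam| ∧ |p x - lam| ≤ C * e N ^ α} := by
    filter_upwards [hnear, hfar] with x hx hx' hxA hxw
    simp only [not_lt] at hxA hxw ⊢
    have hpos : 0 < p x - lam := sub_pos.2 hxA
    rw [abs_of_pos hpos]
    refine ⟨hpos, ?_⟩
    have hwx : ‖x + w - x‖ ≤ min r 1 := by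
      rw [add_sub_cancel_left]
      exact hwe.trans heN.le
    by_cases hxη : p x < lam + η
    · have h1 := hCp p x hbdd (hx (by linarith) hxη) (x + w) hwx
      have h2 : C * ‖x + w - x‖ ^ α ≤ C * e N ^ α := by
        rw [add_sub_cancel_left]
        gcongr
      linarith [(abs_le.1 h1).1]
    · have h1 := hCp' p x hbdd (hx' (by rw [abs_of_pos hpos]; linarith)) (x + w) hwx
      have h2 : C' * ‖x + w - x‖ ^ min β' 1 ≤ C' * e N ^ min β' 1 := by
        rw [add_sub_cancel_left]
        gcongr
      linarith [(abs_le.1 h1).1]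
  refine (measure_le_nat_mul_of_translate N hstep
    (fun x hx => interior_subset hx.1) fun x hx => ?_).trans ?_
  · have hNw : N • w = v := by
      rw [hw, ← Nat.cast_smul_eq_nsmul ℝ, smul_smul, mul_inv_cancel₀ hN'.ne', one_smul]
    rw [hNw]
    have hxv : x + v ∈ {x | p x ≤ lam} := interior_subset hx.2
    simpa only [Set.mem_ofPred_eq, not_lt] using hxv
  · refine (mul_le_mul_right (hexp _ (by positivity) hεN.le) _).trans_eq ?_
    rw [← ENNReal.ofReal_natCast, ← ENNReal.ofReal_mul hN'.le]
    congr 1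
    rw [Real.mul_rpow hC.le (by positivity), ← Real.rpow_mul hepos.le, mul_comm α γ,
      Real.rpow_sub_one hepos.ne']
    simp only [e]
    field_simp
end

section
/- Fix λ > 0 and β, γ > 0 with γ(β ∧ 1) ≤ 1. Then there exist parameters L, r, β', L*, η > 0 and a probability density p in the class P_Σ(β,L,r,λ,γ,β',L*,η) such that both the level set Γ_p(λ) = {x : p(x) > λ} and its complement {x : p(x) ≤ λ} have non-empty interior. -/
open MeasureTheory ENNReal

/-- The odd power function `t ↦ sign t * |t| ^ b`. -/
noncomputable def signedPow (b t : ℝ) : ℝ := max t 0 ^ b - max (-t) 0 ^ b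

/-- The radial function decreasing from `1` at the origin to `-1` on `{c‖x‖ ≥ 1}`, quadratic
in between. -/
noncomputable def radialProfile {E : Type*} [Norm E] (c : ℝ) (x : E) : ℝ :=
  1 - 2 * min (c * ‖x‖) 1 ^ 2

/-- A compactly supported bump crossing the level `lam` like a `b`-th power of the radius. -/
noncomputable def radialBump {E : Type*} [Norm E] (lam b c : ℝ) (x : E) : ℝ :=
  lam * (1 + signedPow b (radialProfile c x))

theorem signedPow_of_nonneg {b t : ℝ} (hb : 0 < b) (ht : 0 ≤ t) : signedPow b t = t ^ b := by
  simp [signedPow, ht, Real.zero_rpow hb.ne']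

theorem signedPow_of_nonpos {b t : ℝ} (hb : 0 < b) (ht : t ≤ 0) :
    signedPow b t = -(-t) ^ b := by
  simp [signedPow, ht, Real.zero_rpow hb.ne']

theorem abs_signedPow {b : ℝ} (hb : 0 < b) (t : ℝ) : |signedPow b t| = |t| ^ b := by
  rcases le_total 0 t with ht | ht
  · rw [signedPow_of_nonneg hb ht, abs_of_nonneg ht, abs_of_nonneg (by positivity)]
  · rw [signedPow_of_nonpos hb ht, abs_of_nonpos ht, abs_neg,
      abs_of_nonneg (Real.rpow_nonneg (by linarith) _)]

theorem signedPow_one (t : ℝ) : signedPow 1 t = t := by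
  rcases le_total 0 t with ht | ht
  · simp [signedPow_of_nonneg one_pos ht]
  · simp [signedPow_of_nonpos one_pos ht]

theorem continuous_signedPow {b : ℝ} (hb : 0 < b) : Continuous (signedPow b) := by
  unfold signedPow
  exact ((continuous_id.max continuous_const).rpow_const fun _ => Or.inr hb.le).sub
    ((continuous_neg.max continuous_const).rpow_const fun _ => Or.inr hb.le)

theorem abs_rpow_sub_rpow_le {b s t : ℝ} (hb : 0 < b) (hb1 : b ≤ 1) (hs : 0 ≤ s) (ht : 0 ≤ t) :
    |s ^ b - t ^ b| ≤ |s - t| ^ b := by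
  wlog h : t ≤ s generalizing s t
  · rw [abs_sub_comm, abs_sub_comm s]
    exact this ht hs (le_of_not_ge h)
  rw [abs_of_nonneg (sub_nonneg.2 (Real.rpow_le_rpow ht h hb.le)), abs_of_nonneg (sub_nonneg.2 h)]
  have := Real.rpow_add_le_add_rpow (sub_nonneg.2 h) ht hb.le hb1
  rw [sub_add_cancel] at this
  linarith

theorem abs_signedPow_sub_le {b : ℝ} (hb : 0 < b) (hb1 : b ≤ 1) (s t : ℝ) :
    |signedPow b s - signedPow b t| ≤ 2 * |s - t| ^ b := by
  have h1 := (abs_rpow_sub_rpow_le hb hb1 (le_max_right s 0) (le_max_right t 0)).trans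
    (Real.rpow_le_rpow (abs_nonneg _) (abs_max_sub_max_le_abs s t 0) hb.le)
  have h2 := (abs_rpow_sub_rpow_le hb hb1 (le_max_right (-s) 0) (le_max_right (-t) 0)).trans
    (Real.rpow_le_rpow (abs_nonneg _) (abs_max_sub_max_le_abs (-s) (-t) 0) hb.le)
  rw [neg_sub_neg, abs_sub_comm t s] at h2
  rw [abs_le] at *
  unfold signedPow
  constructor <;> linarith [h1.1, h1.2, h2.1, h2.2]

section Profile

variable {E : Type*} [NormedAddCommGroup E]

theorem abs_radialProfile_le_one {c : ℝ} (hc : 0 < c) (x : E) : |radialProfile c x| ≤ 1 := by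
  have h0 : 0 ≤ min (c * ‖x‖) 1 := by positivity
  have h1 : min (c * ‖x‖) 1 ≤ 1 := min_le_right _ _
  rw [radialProfile, abs_le]
  constructor <;> nlinarith

theorem abs_radialProfile_sub_le {c : ℝ} (hc : 0 < c) (x y : E) :
    |radialProfile c x - radialProfile c y| ≤ 4 * c * ‖x - y‖ := by
  have hx0 : 0 ≤ min (c * ‖x‖) 1 := by positivity
  have hx1 : min (c * ‖x‖) 1 ≤ 1 := min_le_right _ _
  have hy0 : 0 ≤ min (c * ‖y‖) 1 := by positivity
  have hy1 : min (c * ‖y‖) 1 ≤ 1 := min_le_right _ _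
  have h : |min (c * ‖x‖) 1 - min (c * ‖y‖) 1| ≤ c * ‖x - y‖ := by
    refine (abs_min_sub_min_le_max _ _ _ _).trans ?_
    rw [sub_self, abs_zero, ← mul_sub, abs_mul, abs_of_pos hc]
    exact max_le (mul_le_mul_of_nonneg_left (abs_norm_sub_norm_le x y) hc.le) (by positivity)
  unfold radialProfile
  set u := min (c * ‖x‖) 1
  set v := min (c * ‖y‖) 1
  have e : 1 - 2 * u ^ 2 - (1 - 2 * v ^ 2) = -(2 * (u + v) * (u - v)) := by ring
  rw [e, abs_neg, abs_mul, abs_of_nonneg (by positivity)]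
  calc 2 * (u + v) * |u - v| ≤ 4 * |u - v| := by
        refine mul_le_mul_of_nonneg_right (by linarith) (abs_nonneg _)
    _ ≤ 4 * c * ‖x - y‖ := by linarith

theorem continuous_radialProfile (c : ℝ) : Continuous (radialProfile c : E → ℝ) := by
  unfold radialProfile
  fun_prop

theorem continuous_radialBump (lam : ℝ) {b : ℝ} (hb : 0 < b) (c : ℝ) :
    Continuous (radialBump lam b c : E → ℝ) :=
  continuous_const.mul
    (continuous_const.add ((continuous_signedPow hb).comp (continuous_radialProfile c)))

theorem radialBump_mem_Icc {lam b c : ℝ} (hlam : 0 < lam) (hb : 0 < b) (hc : 0 < c) (x : E) :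
    radialBump lam b c x ∈ Set.Icc 0 (2 * lam) := by
  have h : |signedPow b (radialProfile c x)| ≤ 1 := by
    rw [abs_signedPow hb]
    exact Real.rpow_le_one (abs_nonneg _) (abs_radialProfile_le_one hc x) hb.le
  rw [abs_le] at h
  unfold radialBump
  constructor <;> nlinarith

theorem radialBump_zero (lam : ℝ) {b : ℝ} (hb : 0 < b) (c : ℝ) :
    radialBump lam b c (0 : E) = 2 * lam := by
  simp [radialBump, radialProfile, signedPow_of_nonneg hb]
  ring

theorem radialBump_eq_zero {lam b c : ℝ} (hb : 0 < b) {x : E} (hx : 1 ≤ c * ‖x‖) :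
    radialBump lam b c x = 0 := by
  have : radialProfile c x = -1 := by rw [radialProfile, min_eq_right hx]; norm_num
  rw [radialBump, this, signedPow_of_nonpos hb (by norm_num)]
  norm_num

theorem abs_radialBump_sub_le {lam b c : ℝ} (hlam : 0 < lam) (hb : 0 < b) (hb1 : b ≤ 1)
    (hc : 0 < c) (x y : E) :
    |radialBump lam b c x - radialBump lam b c y| ≤ 2 * lam * (4 * c) ^ b * ‖x - y‖ ^ b := by
  rw [radialBump, radialBump, ← mul_sub, abs_mul, abs_of_pos hlam, add_sub_add_left_eq_sub,
    mul_assoc, ← Real.mul_rpow (by positivity) (norm_nonneg _)]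
  have h1 := abs_signedPow_sub_le hb hb1 (radialProfile c x) (radialProfile c y)
  have h2 := Real.rpow_le_rpow (abs_nonneg _) (abs_radialProfile_sub_le hc x y) hb.le
  nlinarith

theorem radialBump_smul [NormedSpace ℝ E] (lam b : ℝ) {c : ℝ} (hc : 0 < c) (x : E) :
    radialBump lam b 1 (c • x) = radialBump lam b c x := by
  simp [radialBump, radialProfile, norm_smul, abs_of_pos hc]

theorem hasCompactSupport_radialBump [ProperSpace E] (lam : ℝ) {b c : ℝ} (hb : 0 < b)
    (hc : 0 < c) : HasCompactSupport (radialBump lam b c : E → ℝ) := by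
  refine HasCompactSupport.intro (isCompact_closedBall (0 : E) c⁻¹) fun x hx => ?_
  rw [mem_closedBall_zero_iff, not_le] at hx
  refine radialBump_eq_zero hb ?_
  rw [inv_lt_iff_one_lt_mul₀ hc] at hx
  linarith

end Profile

section Measure

variable {E : Type*} [NormedAddCommGroup E] [NormedSpace ℝ E] [FiniteDimensional ℝ E]
  [MeasurableSpace E] [BorelSpace E] (μ : Measure E) [μ.IsAddHaarMeasure]

theorem exists_lintegral_radialBump_eq_one [Nontrivial E] {lam b : ℝ} (hlam : 0 < lam)
    (hb : 0 < b) : ∃ c : ℝ, 0 < c ∧ ∫⁻ x : E, ENNReal.ofReal (radialBump lam b c x) ∂μ = 1 := by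
  have hcont := continuous_radialBump (E := E) lam hb 1
  have hI : 0 < ∫ x : E, radialBump lam b 1 x ∂μ :=
    hcont.integral_pos_of_hasCompactSupport_nonneg_nonzero
      (hasCompactSupport_radialBump lam hb one_pos)
      (fun x => (radialBump_mem_Icc hlam hb one_pos x).1) (x := 0)
      (by rw [radialBump_zero lam hb]; positivity)
  set I := ∫ x : E, radialBump lam b 1 x ∂μ
  have hd : Module.finrank ℝ E ≠ 0 := Module.finrank_pos.ne'
  have hc : 0 < I ^ ((Module.finrank ℝ E : ℝ)⁻¹) := by positivity
  refine ⟨I ^ ((Module.finrank ℝ E : ℝ)⁻¹), hc, ?_⟩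
  rw [← ofReal_integral_eq_lintegral_ofReal]
  · simp_rw [← radialBump_smul lam b hc]
    rw [Measure.integral_comp_smul_of_nonneg μ (hR := hc.le), Real.rpow_inv_natCast_pow hI.le hd,
      smul_eq_mul, inv_mul_cancel₀ hI.ne', ENNReal.ofReal_one]
  · exact (continuous_radialBump (E := E) lam hb _).integrable_of_hasCompactSupport
      (hasCompactSupport_radialBump lam hb hc)
  · exact Filter.Eventually.of_forall fun x => (radialBump_mem_Icc hlam hb hc x).1

theorem measure_abs_radialProfile_le [Nontrivial E] {c : ℝ} (hc : 0 < c) :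
    ∃ C : ℝ, 0 < C ∧ ∀ δ : ℝ, 0 < δ → δ < 1 →
      μ {x : E | |radialProfile c x| ≤ δ} ≤ ENNReal.ofReal (C * δ) := by
  set n := Module.finrank ℝ E
  have hn0 : 0 < n := Module.finrank_pos
  have hV : 0 < μ.real (Metric.ball (0 : E) 1) :=
    ENNReal.toReal_pos (Metric.measure_ball_pos μ 0 one_pos).ne' measure_ball_lt_top.ne
  set V := μ.real (Metric.ball (0 : E) 1)
  have hVμ : μ (Metric.ball (0 : E) 1) = ENNReal.ofReal V :=
    (ENNReal.ofReal_toReal measure_ball_lt_top.ne).symm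
  refine ⟨2 / c * n * (1 / c) ^ (n - 1) * V, by positivity, fun δ hδ hδ1 => ?_⟩
  set s := √((1 - δ) / 2)
  set t := √((1 + δ) / 2)
  have hs : s ^ 2 = (1 - δ) / 2 := Real.sq_sqrt (by linarith)
  have ht : t ^ 2 = (1 + δ) / 2 := Real.sq_sqrt (by linarith)
  have hs0 : 0 ≤ s := Real.sqrt_nonneg _
  have ht0 : 0 ≤ t := Real.sqrt_nonneg _
  have hst : s ≤ t := Real.sqrt_le_sqrt (by linarith)
  have ht1 : t ≤ 1 := by nlinarith
  have hth : 1 / 2 ≤ t := by nlinarith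
  have hsub : {x : E | |radialProfile c x| ≤ δ} ⊆
      Metric.closedBall 0 (t / c) \ Metric.ball 0 (s / c) := by
    intro x hx
    have hx' := abs_le.1 (show |radialProfile c x| ≤ δ from hx)
    unfold radialProfile at hx'
    have hlt : c * ‖x‖ < 1 := by
      by_contra! h
      rw [min_eq_right h] at hx'
      linarith [hx'.1]
    rw [min_eq_left hlt.le] at hx'
    have h0 : 0 ≤ c * ‖x‖ := by positivity
    simp only [Set.mem_sdiff, mem_closedBall_zero_iff, mem_ball_zero_iff, not_lt, le_div_iff₀ hc,
      div_le_iff₀ hc]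
    constructor
    · refine le_of_sq_le_sq ?_ ht0
      nlinarith [hx'.1]
    · refine le_of_sq_le_sq ?_ (by positivity)
      nlinarith [hx'.2]
  refine (measure_mono hsub).trans ?_
  rw [measure_sdiff (Metric.ball_subset_closedBall.trans
      (Metric.closedBall_subset_closedBall (by gcongr))) measurableSet_ball.nullMeasurableSet
      measure_ball_lt_top.ne,
    Measure.addHaar_closedBall μ _ (div_nonneg ht0 hc.le),
    Measure.addHaar_ball μ _ (div_nonneg hs0 hc.le),
    hVμ,
    ← ENNReal.ofReal_mul (by positivity), ← ENNReal.ofReal_mul (by positivity),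
    ← ENNReal.ofReal_sub _ (by positivity)]
  refine ENNReal.ofReal_le_ofReal ?_
  change (t / c) ^ n * V - (s / c) ^ n * V ≤ _
  rw [← sub_mul, mul_right_comm]
  refine mul_le_mul_of_nonneg_right ?_ hV.le
  have h1 := (le_abs_self _).trans (abs_pow_sub_pow_le (t / c) (s / c) n)
  have h2 : |t / c - s / c| ≤ 2 / c * δ := by
    rw [← sub_div, abs_of_nonneg (div_nonneg (sub_nonneg.2 hst) hc.le), div_mul_eq_mul_div]
    gcongr
    nlinarith
  have h3 : max |t / c| |s / c| ≤ 1 / c := by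
    rw [abs_of_nonneg (by positivity), abs_of_nonneg (by positivity)]
    exact max_le (by gcongr) (by gcongr; linarith)
  calc _ ≤ _ := h1
    _ ≤ 2 / c * δ * n * (1 / c) ^ (n - 1) := by gcongr
    _ = _ := by ring

theorem measure_radialBump_exponent [Nontrivial E] {lam b c γ : ℝ} (hlam : 0 < lam) (hb : 0 < b)
    (hc : 0 < c) (hγb : γ * b ≤ 1) :
    ∃ c₀ > (0 : ℝ), ∃ ε₀ > (0 : ℝ), ∀ ε : ℝ, 0 < ε → ε ≤ ε₀ →
      μ {x : E | 0 < |radialBump lam b c x - lam| ∧ |radialBump lam b c x - lam| ≤ ε} ≤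
        ENNReal.ofReal (c₀ * ε ^ γ) := by
  obtain ⟨C, hC, h⟩ := measure_abs_radialProfile_le μ (E := E) hc
  refine ⟨C * (lam ^ γ)⁻¹, by positivity, lam / 2, by positivity, fun ε hε hε' => ?_⟩
  have hq : ε / lam < 1 := by rw [div_lt_one hlam]; linarith
  have hq0 : 0 < ε / lam := by positivity
  have hδ : (ε / lam) ^ b⁻¹ ≤ (lam ^ γ)⁻¹ * ε ^ γ := by
    rw [mul_comm, ← div_eq_mul_inv, ← Real.div_rpow hε.le hlam.le]
    refine Real.rpow_le_rpow_of_exponent_ge hq0 hq.le ?_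
    rwa [← one_div, le_div_iff₀ hb]
  refine ((measure_mono ?_).trans (h ((ε / lam) ^ b⁻¹) (by positivity)
    (Real.rpow_lt_one hq0.le hq (by positivity)))).trans (ENNReal.ofReal_le_ofReal ?_)
  · rintro x ⟨-, hx⟩
    have e : radialBump lam b c x - lam = lam * signedPow b (radialProfile c x) := by
      rw [radialBump]; ring
    rw [e, abs_mul, abs_of_pos hlam, abs_signedPow hb, ← le_div_iff₀' hlam] at hx
    exact (Real.le_rpow_inv_iff_of_pos (abs_nonneg _) hq0.le hb).2 hx
  · rw [mul_assoc]
    gcongr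

end Measure

section Taylor

variable {F : Type*} [NormedAddCommGroup F] [InnerProductSpace ℝ F]

theorem fderiv_const_sub_mul_norm_sq (A B : ℝ) :
    fderiv ℝ (fun x : F => A - B * ‖x‖ ^ 2) = ((-2 * B) • innerSL ℝ : F →L[ℝ] F →L[ℝ] ℝ) := by
  ext x y
  have h := (((hasStrictFDerivAt_norm_sq x).hasFDerivAt.const_mul B).const_sub A).fderiv
  rw [h]
  simp
  ring

theorem iteratedFDeriv_const_sub_mul_norm_sq (A B : ℝ) (k : ℕ) (x h : F) :
    iteratedFDeriv ℝ k (fun x : F => A - B * ‖x‖ ^ 2) x (fun _ => h) =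
      match k with
      | 0 => A - B * ‖x‖ ^ 2
      | 1 => -2 * B * inner ℝ x h
      | 2 => -2 * B * ‖h‖ ^ 2
      | _ + 3 => 0 := by
  match k with
  | 0 => simp
  | 1 => simp [iteratedFDeriv_one_apply, fderiv_const_sub_mul_norm_sq]
  | 2 =>
    rw [iteratedFDeriv_two_apply, fderiv_const_sub_mul_norm_sq, ContinuousLinearMap.fderiv]
    change -2 * B * inner ℝ h h = _
    rw [real_inner_self_eq_norm_sq]
  | k + 3 =>
    have e : fderiv ℝ ((-2 * B) • innerSL ℝ : F →L[ℝ] F →L[ℝ] ℝ) = fun _ => (-2 * B) • innerSL ℝ :=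
      funext fun x => ContinuousLinearMap.fderiv _
    rw [iteratedFDeriv_succ_apply_right, fderiv_const_sub_mul_norm_sq,
      iteratedFDeriv_succ_apply_right, e, iteratedFDeriv_succ_const]
    simp

theorem abs_sub_taylor_const_sub_mul_norm_sq_le {A B β : ℝ} (hB : 0 ≤ B) (hβ : 1 ≤ β) {x₀ x : F}
    (hx : ‖x - x₀‖ ≤ 1) :
    |(A - B * ‖x‖ ^ 2) - ∑ k ∈ Finset.range (⌊β⌋₊ + 1), ((k.factorial : ℝ))⁻¹ *
        iteratedFDeriv ℝ k (fun x : F => A - B * ‖x‖ ^ 2) x₀ (fun _ => x - x₀)| ≤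
      B * ‖x - x₀‖ ^ β := by
  have key : ‖x‖ ^ 2 = ‖x₀‖ ^ 2 + 2 * inner ℝ x₀ (x - x₀) + ‖x - x₀‖ ^ 2 := by
    rw [← norm_add_sq_real, add_sub_cancel]
  have h1 : 1 ≤ ⌊β⌋₊ := Nat.le_floor (by simpa using hβ)
  obtain ⟨m, hm⟩ := Nat.exists_eq_add_of_le' h1
  simp_rw [iteratedFDeriv_const_sub_mul_norm_sq]
  rw [hm]
  match m with
  | 0 =>
    have h2 : β ≤ 2 := by
      have := Nat.lt_floor_add_one β
      rw [hm] at this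
      norm_num at this
      linarith
    have h3 : ‖x - x₀‖ ^ 2 ≤ ‖x - x₀‖ ^ β := by
      rw [← Real.rpow_natCast]
      exact Real.rpow_le_rpow_of_exponent_ge_of_imp (norm_nonneg _) hx (by simpa using h2)
        fun _ h => absurd h (by norm_num)
    simp only [Finset.sum_range_succ, Finset.sum_range_zero]
    rw [key, abs_le]
    norm_num
    have := mul_le_mul_of_nonneg_left h3 hB
    have := mul_nonneg hB (sq_nonneg ‖x - x₀‖)
    constructor <;> linarith
  | m + 1 =>
    rw [Finset.eventually_constant_sum (N := 3) _ (by omega)]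
    · simp only [Finset.sum_range_succ, Finset.sum_range_zero]
      rw [key]
      norm_num [Nat.factorial]
      ring_nf
      simp
      positivity
    · intro k hk
      obtain ⟨j, rfl⟩ := Nat.exists_eq_add_of_le' hk
      simp

end Taylor

theorem radialBump_one_eq {d : ℕ} {lam c : ℝ} {x : EuclideanSpace ℝ (Fin d)}
    (hx : c * ‖x‖ ≤ 1) :
    radialBump lam 1 c x = 2 * lam - 2 * lam * c ^ 2 * ‖x‖ ^ 2 := by
  rw [radialBump, signedPow_one, radialProfile, min_eq_left hx]
  ring

theorem LocHolder.mono {d : ℕ} {β L L' r : ℝ} {x₀ : EuclideanSpace ℝ (Fin d)}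
    {g : EuclideanSpace ℝ (Fin d) → ℝ} (h : LocHolder β L r x₀ g) (hL : L ≤ L') :
    LocHolder β L' r x₀ g :=
  ⟨h.1, fun x hx => (h.2 x hx).trans
    (mul_le_mul_of_nonneg_right hL (Real.rpow_nonneg (norm_nonneg _) _))⟩

theorem locHolder_of_abs_sub_le {d : ℕ} {β b L r : ℝ} {x₀ : EuclideanSpace ℝ (Fin d)}
    {g : EuclideanSpace ℝ (Fin d) → ℝ} (hβ : 0 < β) (hβ1 : β < 1) (hβb : β ≤ b) (hL : 0 ≤ L)
    (hr : r ≤ 1) (hg : Continuous g) (h : ∀ x, |g x - g x₀| ≤ L * ‖x - x₀‖ ^ b) :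
    LocHolder β L r x₀ g := by
  have hfl : ⌊β⌋₊ = 0 := Nat.floor_eq_zero.2 hβ1
  refine ⟨?_, fun x hx => ?_⟩
  · rw [hfl]
    exact (contDiff_zero.2 hg).contDiffAt
  · rw [mem_closedBall_iff_norm] at hx
    rw [hfl]
    simp only [zero_add, Finset.range_one, Finset.sum_singleton, Nat.factorial_zero,
      Nat.cast_one, inv_one, one_mul, iteratedFDeriv_zero_apply]
    refine (h x).trans (mul_le_mul_of_nonneg_left ?_ hL)
    exact Real.rpow_le_rpow_of_exponent_ge_of_imp (norm_nonneg _) (hx.trans hr) hβb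
      fun _ h0 => absurd h0 (hβ.trans_le hβb).ne'

theorem locHolder_radialBump_one {d : ℕ} {lam c β r : ℝ} {x₀ : EuclideanSpace ℝ (Fin d)}
    (hlam : 0 < lam) (hc : 0 < c) (hβ : 1 ≤ β) (hr : r ≤ 1) (hrc : c * r ≤ 1 / 8)
    (hx₀ : lam / 2 < radialBump lam 1 c x₀) :
    LocHolder β (2 * lam * c ^ 2) r x₀ (radialBump lam 1 c) := by
  have hlt : c * ‖x₀‖ < 1 := by
    by_contra! h
    rw [radialBump_eq_zero one_pos h] at hx₀
    linarith
  have h78 : c * ‖x₀‖ < 7 / 8 := by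
    rw [radialBump_one_eq hlt.le] at hx₀
    have h1 : lam * (c * ‖x₀‖) ^ 2 < lam * (3 / 4) := by linarith
    have h2 := lt_of_mul_lt_mul_left h1 hlam.le
    nlinarith
  have hev : radialBump lam 1 c =ᶠ[nhds x₀]
      fun x => 2 * lam - 2 * lam * c ^ 2 * ‖x‖ ^ 2 := by
    have : ∀ᶠ x in nhds x₀, c * ‖x‖ < 1 :=
      (continuous_const.mul continuous_norm).continuousAt.eventually_lt_const hlt
    filter_upwards [this] with x hx using radialBump_one_eq hx.le
  refine ⟨ContDiffAt.congr_of_eventuallyEq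
    (contDiff_const.sub (contDiff_const.mul (contDiff_norm_sq ℝ))).contDiffAt hev,
    fun x hx => ?_⟩
  rw [mem_closedBall_iff_norm] at hx
  have hx1 : c * ‖x‖ ≤ 1 := by
    have h1 : ‖x‖ ≤ ‖x₀‖ + r := by linarith [norm_sub_norm_le x x₀]
    nlinarith
  simp_rw [fun k => (Filter.EventuallyEq.iteratedFDeriv ℝ hev k).eq_of_nhds]
  rw [radialBump_one_eq hx1]
  exact abs_sub_taylor_const_sub_mul_norm_sq_le (by positivity) hβ (hx.trans hr)

/-- **Proposition 4.1 (second part).**  Fix `λ > 0` and `β, γ > 0` with `γ(β ∧ 1) ≤ 1`.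
Then there exist parameters `L, r, β', L*, η > 0` and a probability density `p` in the
class `P_Σ(β,L,r,λ,γ,β',L*,η)` such that both the level set `Γ_p(λ) = {p > λ}` and its
complement `{p ≤ λ}` have non-empty interior. -/
theorem exists_density_both_interiors_nonempty (d : ℕ) (hd : 0 < d) (lam β γ : ℝ)
    (hlam : 0 < lam) (hβ : 0 < β) (hγ : 0 < γ) (hγβ : γ * min β 1 ≤ 1) :
    ∃ L r β' Lstar η : ℝ, 0 < L ∧ 0 < r ∧ 0 < β' ∧ 0 < Lstar ∧ 0 < η ∧
      ∃ p : EuclideanSpace ℝ (Fin d) → ℝ, MemPSigma β L r lam γ β' Lstar η p ∧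
        (interior {x | lam < p x}).Nonempty ∧ (interior {x | p x ≤ lam}).Nonempty := by
  have : Nonempty (Fin d) := ⟨⟨0, hd⟩⟩
  set b := min β 1
  have hb : 0 < b := lt_min hβ one_pos
  have hb1 : b ≤ 1 := min_le_right _ _
  obtain ⟨c, hc, hint⟩ := exists_lintegral_radialBump_eq_one
    (volume : Measure (EuclideanSpace ℝ (Fin d))) hlam hb
  set L := 2 * lam * (4 * c) ^ b + 2 * lam * c ^ 2
  have hL : 0 < L := by positivity
  have hhol : ∀ x₀ x : EuclideanSpace ℝ (Fin d),
      |radialBump lam b c x - radialBump lam b c x₀| ≤ L * ‖x - x₀‖ ^ b := fun x₀ x =>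
    (abs_radialBump_sub_le hlam hb hb1 hc x x₀).trans <|
      mul_le_mul_of_nonneg_right (le_add_of_nonneg_right (by positivity)) (by positivity)
  have hcont : Continuous (radialBump lam b c : EuclideanSpace ℝ (Fin d) → ℝ) :=
    continuous_radialBump lam hb c
  set r := min 1 (1 / (8 * c))
  have hr1 : r ≤ 1 := min_le_left _ _
  have hrc : c * r ≤ 1 / 8 := by
    calc c * r ≤ c * (1 / (8 * c)) := mul_le_mul_of_nonneg_left (min_le_right _ _) hc.le
      _ = 1 / 8 := by field_simp
  refine ⟨L, r, b / 2, 2 * lam, lam / 2, hL, by positivity, by positivity, by positivity,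
    by positivity, radialBump lam b c,
    ⟨hcont.measurable, fun x => (radialBump_mem_Icc hlam hb hc x).1, hint, ?_, ?_,
      measure_radialBump_exponent volume hlam hb hc hγβ,
      fun x => (radialBump_mem_Icc hlam hb hc x).2⟩, ?_, ?_⟩
  · refine Filter.Eventually.of_forall fun x₀ hx₀ _ => ?_
    rcases lt_or_ge β 1 with h | h
    · exact locHolder_of_abs_sub_le hβ h (le_min le_rfl h.le) hL.le hr1 hcont (hhol x₀)
    · have hb' : b = 1 := min_eq_right h
      rw [hb'] at hx₀ ⊢
      exact (locHolder_radialBump_one hlam hc h hr1 hrc (by linarith)).mono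
        (le_add_of_nonneg_left (by positivity))
  · exact Filter.Eventually.of_forall fun x₀ _ =>
      locHolder_of_abs_sub_le (by positivity) (by linarith) (by linarith) hL.le hr1 hcont (hhol x₀)
  · refine ⟨0, mem_interior_iff_mem_nhds.2 ((isOpen_lt continuous_const hcont).mem_nhds ?_)⟩
    simp only [Set.mem_ofPred_eq, radialBump_zero lam hb]
    linarith
  · obtain ⟨x, hx⟩ := NormedSpace.exists_lt_norm ℝ (EuclideanSpace ℝ (Fin d)) (1 / c)
    refine ⟨x, mem_interior_iff_mem_nhds.2 (Filter.mem_of_superset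
      ((isOpen_lt continuous_const continuous_norm).mem_nhds hx) fun y hy => ?_)⟩
    rw [Set.mem_ofPred_eq, div_lt_iff₀' hc] at hy
    simp only [Set.mem_ofPred_eq, radialBump_eq_zero hb hy.le, hlam.le]
end

section
/- Fix β, L, r > 0 and x₀ ∈ ℝ^d. Let p be a probability density on ℝ^d with respect to Lebesgue measure with p ∈ Σ(β,L,r,x₀), and let K be a β-valid kernel on ℝ^d. Then for every bandwidth h > 0 with h√d ≤ r, the pointwise bias of the kernel smoother satisfies |∫_{ℝ^d} h^{−d} K((t − x₀)/h) p(t) dt − p(x₀)| ≤ L h^β ∫_{ℝ^d} ‖t‖^β |K(t)| dt. -/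
open MeasureTheory ENNReal

/-- A `β`-valid kernel on `ℝ^d`: a function supported in `[-1,1]^d` with `∫ K = 1`,
`∫ |K|^q < ∞` for all `q ≥ 1`, `∫ ‖t‖^β |K(t)| dt < ∞`, and vanishing moments
`∫ t^s K(t) dt = 0` for all multi-indices `s` with `1 ≤ |s| ≤ ⌊β⌋` (when `⌊β⌋ ≥ 1`). -/
def ValidKernel {d : ℕ} (β : ℝ) (K : EuclideanSpace ℝ (Fin d) → ℝ) : Prop :=
  Measurable K ∧
    (Function.support K ⊆ {x | ∀ i, |x i| ≤ 1}) ∧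
    (∫ t, K t = 1) ∧
    (∀ q : ℝ, 1 ≤ q → Integrable fun t => |K t| ^ q) ∧
    (Integrable fun t => ‖t‖ ^ β * |K t|) ∧
    (1 ≤ ⌊β⌋₊ → ∀ s : Fin d → ℕ, 1 ≤ ∑ i, s i → ∑ i, s i ≤ ⌊β⌋₊ →
      ∫ t, (∏ i, (t i) ^ (s i)) * K t = 0)

/-- Expansion of a multilinear form on the diagonal of `ℝ^d` into monomials. -/
theorem multilinear_diag_eq_sum_monomials {d k : ℕ}
    (m : ContinuousMultilinearMap ℝ (fun _ : Fin k => EuclideanSpace ℝ (Fin d)) ℝ)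
    (u : EuclideanSpace ℝ (Fin d)) :
    m (fun _ => u) = ∑ f : Fin k → Fin d,
      m (fun j => EuclideanSpace.single (f j) (1 : ℝ)) *
        ∏ i, u i ^ (Finset.univ.filter fun j => f j = i).card := by
  have hu : u = ∑ i, u i • EuclideanSpace.single i (1 : ℝ) := by
    ext j
    simp [Pi.single_apply]
  conv_lhs => rw [hu]
  rw [ContinuousMultilinearMap.map_sum]
  refine Finset.sum_congr rfl fun f _ => ?_
  rw [ContinuousMultilinearMap.map_smul_univ, smul_eq_mul, mul_comm,
    ← Finset.prod_fiberwise' Finset.univ f fun i => u i]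
  simp only [Finset.prod_const]

section ValidKernel

variable {d : ℕ} {β : ℝ} {K : EuclideanSpace ℝ (Fin d) → ℝ}

theorem ValidKernel.integrable (hK : ValidKernel β K) : Integrable K := by
  have h1 := hK.2.2.2.1 1 le_rfl
  simp only [Real.rpow_one] at h1
  exact h1.mono' hK.1.aestronglyMeasurable (.of_forall fun _ => le_rfl)

theorem ValidKernel.norm_le_sqrt (hK : ValidKernel β K) {u : EuclideanSpace ℝ (Fin d)}
    (hu : K u ≠ 0) : ‖u‖ ≤ Real.sqrt d := by
  rw [EuclideanSpace.norm_eq]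
  refine Real.sqrt_le_sqrt ?_
  calc ∑ i, ‖u i‖ ^ 2 ≤ ∑ _i : Fin d, (1 : ℝ) :=
        Finset.sum_le_sum fun i _ => pow_le_one₀ (norm_nonneg _) (hK.2.1 hu i)
    _ = d := by simp

theorem ValidKernel.integrable_monomial_mul (hK : ValidKernel β K) (s : Fin d → ℕ) :
    Integrable fun u => (∏ i, (u i) ^ (s i)) * K u := by
  refine hK.integrable.norm.mono' ?_ (.of_forall fun u => ?_)
  · exact (Continuous.aestronglyMeasurable (by fun_prop)).mul hK.1.aestronglyMeasurable
  · by_cases hu : K u = 0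
    · simp [hu]
    · rw [norm_mul, norm_prod]
      refine mul_le_of_le_one_left (norm_nonneg _) ?_
      refine Finset.prod_le_one (fun _ _ => norm_nonneg _) fun i _ => ?_
      rw [norm_pow]
      exact pow_le_one₀ (norm_nonneg _) (hK.2.1 hu i)

theorem ValidKernel.integrable_multilinear_mul (hK : ValidKernel β K) {k : ℕ}
    (m : ContinuousMultilinearMap ℝ (fun _ : Fin k => EuclideanSpace ℝ (Fin d)) ℝ) :
    Integrable fun u => m (fun _ => u) * K u := by
  simp only [multilinear_diag_eq_sum_monomials m, Finset.sum_mul, mul_assoc]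
  exact integrable_finsetSum _ fun f _ => (hK.integrable_monomial_mul _).const_mul _

/-- A `β`-valid kernel annihilates homogeneous polynomials of degree between `1` and `⌊β⌋`. -/
theorem ValidKernel.integral_multilinear_mul (hK : ValidKernel β K) {k : ℕ} (hk : 1 ≤ k)
    (hkβ : k ≤ ⌊β⌋₊)
    (m : ContinuousMultilinearMap ℝ (fun _ : Fin k => EuclideanSpace ℝ (Fin d)) ℝ) :
    ∫ u, m (fun _ => u) * K u = 0 := by
  simp only [multilinear_diag_eq_sum_monomials m, Finset.sum_mul, mul_assoc]
  rw [integral_finsetSum _ fun f _ => (hK.integrable_monomial_mul _).const_mul _]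
  refine Finset.sum_eq_zero fun f _ => ?_
  have hcard : ∑ i, (Finset.univ.filter fun j => f j = i).card = k := by
    rw [← Finset.card_eq_sum_card_fiberwise fun _ _ => Finset.mem_coe.2 (Finset.mem_univ _)]
    simp
  rw [integral_const_mul, hK.2.2.2.2.2 (hk.trans hkβ) _ (hcard.symm ▸ hk) (hcard.symm ▸ hkβ),
    mul_zero]

/-- Smoothing a polynomial of degree at most `⌊β⌋` with a `β`-valid kernel reproduces its
constant term. -/
theorem ValidKernel.integral_sum_multilinear_mul (hK : ValidKernel β K)
    (m : (k : ℕ) → ContinuousMultilinearMap ℝ (fun _ : Fin k => EuclideanSpace ℝ (Fin d)) ℝ) :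
    Integrable (fun u => (∑ k ∈ Finset.range (⌊β⌋₊ + 1), m k fun _ => u) * K u) ∧
      ∫ u, (∑ k ∈ Finset.range (⌊β⌋₊ + 1), m k fun _ => u) * K u = m 0 0 := by
  simp only [Finset.sum_mul]
  have hint := fun k (_ : k ∈ Finset.range (⌊β⌋₊ + 1)) => hK.integrable_multilinear_mul (m k)
  refine ⟨integrable_finsetSum _ hint, ?_⟩
  rw [integral_finsetSum _ hint, Finset.sum_range_succ', Finset.sum_eq_zero, zero_add]
  · have h0 : ∀ u : EuclideanSpace ℝ (Fin d), (m 0 fun _ => u) = m 0 0 := fun u =>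
      congrArg (m 0) (Subsingleton.elim _ _)
    simp only [h0, integral_const_mul, hK.2.2.1, mul_one]
  · intro k hk
    exact hK.integral_multilinear_mul (Nat.le_add_left 1 k)
      (Nat.succ_le_of_lt (Finset.mem_range.1 hk)) _

end ValidKernel

/-- Change of variables `t = x₀ + h u` in the kernel smoother. -/
theorem integral_kernel_smoother_eq {d : ℕ} (K p : EuclideanSpace ℝ (Fin d) → ℝ)
    (x₀ : EuclideanSpace ℝ (Fin d)) {h : ℝ} (hh : 0 < h) :
    ∫ t, (h ^ d : ℝ)⁻¹ * K (h⁻¹ • (t - x₀)) * p t = ∫ u, p (x₀ + h • u) * K u := by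
  have hG : ∀ t, (h ^ d : ℝ)⁻¹ * K (h⁻¹ • (t - x₀)) * p t =
      (h ^ d : ℝ)⁻¹ * (fun u => p (x₀ + h • u) * K u) (h⁻¹ • (t - x₀)) := by
    intro t
    simp only [smul_inv_smul₀ hh.ne', add_sub_cancel]
    ring
  simp only [hG]
  rw [integral_const_mul,
    integral_sub_right_eq_self (fun t => (fun u => p (x₀ + h • u) * K u) (h⁻¹ • t)) x₀,
    Measure.integral_comp_smul volume (fun u => p (x₀ + h • u) * K u),
    finrank_euclideanSpace_fin, smul_eq_mul, ← mul_assoc,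
    inv_pow, inv_inv, abs_of_pos (pow_pos hh d), inv_mul_cancel₀ (pow_pos hh d).ne', one_mul]

/-- **Pointwise bias bound for the kernel smoother.**  If `p` is a probability density on
`ℝ^d` belonging to `Σ(β,L,r,x₀)` and `K` is a `β`-valid kernel, then for every bandwidth
`h > 0` with `h√d ≤ r`, `|∫ h^{-d} K((t-x₀)/h) p(t) dt - p(x₀)| ≤ L h^β ∫ ‖t‖^β |K(t)| dt`. -/
theorem kernel_bias_bound (d : ℕ) (β L r : ℝ) (hβ : 0 < β) (hL : 0 < L) (hr : 0 < r)
    (x₀ : EuclideanSpace ℝ (Fin d))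
    (p : EuclideanSpace ℝ (Fin d) → ℝ) (hpmeas : Measurable p) (hpnn : ∀ x, 0 ≤ p x)
    (hpdens : ∫⁻ x, ENNReal.ofReal (p x) = 1)
    (hphold : LocHolder β L r x₀ p)
    (K : EuclideanSpace ℝ (Fin d) → ℝ) (hK : ValidKernel β K)
    (h : ℝ) (hh : 0 < h) (hhr : h * Real.sqrt d ≤ r) :
    |(∫ t, (h ^ d : ℝ)⁻¹ * K (h⁻¹ • (t - x₀)) * p t) - p x₀| ≤
      L * h ^ β * ∫ t, ‖t‖ ^ β * |K t| := by
  obtain ⟨hKm, -, -, -, hKβ, -⟩ := id hK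
  obtain ⟨-, htaylor⟩ := hphold
  set m : (k : ℕ) → ContinuousMultilinearMap ℝ (fun _ : Fin k => EuclideanSpace ℝ (Fin d)) ℝ :=
    fun k => (((k.factorial : ℝ))⁻¹ * h ^ k) • iteratedFDeriv ℝ k p x₀ with hm
  set T : EuclideanSpace ℝ (Fin d) → ℝ :=
    fun u => ∑ k ∈ Finset.range (⌊β⌋₊ + 1), m k fun _ => u with hT
  have hTtaylor : ∀ u, T u = ∑ k ∈ Finset.range (⌊β⌋₊ + 1),
      ((k.factorial : ℝ))⁻¹ * iteratedFDeriv ℝ k p x₀ (fun _ => x₀ + h • u - x₀) := by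
    intro u
    refine Finset.sum_congr rfl fun k _ => ?_
    have := (iteratedFDeriv ℝ k p x₀).map_smul_univ (fun _ => h) (fun _ => u)
    simp only [Finset.prod_const, Finset.card_univ, Fintype.card_fin] at this
    simp [hm, this, mul_assoc]
  obtain ⟨hTint, hTval⟩ := hK.integral_sum_multilinear_mul m
  have hm0 : m 0 0 = p x₀ := by simp [hm]
  have hbound : ∀ u, ‖(p (x₀ + h • u) - T u) * K u‖ ≤ L * h ^ β * (‖u‖ ^ β * |K u|) := by
    intro u
    by_cases hu : K u = 0
    · simp [hu]
    have hnorm : ‖x₀ + h • u - x₀‖ = h * ‖u‖ := by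
      rw [add_sub_cancel_left, norm_smul, Real.norm_of_nonneg hh.le]
    have hball : x₀ + h • u ∈ Metric.closedBall x₀ r := by
      rw [mem_closedBall_iff_norm, hnorm]
      exact (mul_le_mul_of_nonneg_left (hK.norm_le_sqrt hu) hh.le).trans hhr
    have hb := htaylor _ hball
    rw [← hTtaylor, hnorm, Real.mul_rpow hh.le (norm_nonneg _)] at hb
    calc ‖(p (x₀ + h • u) - T u) * K u‖ = |p (x₀ + h • u) - T u| * |K u| := abs_mul _ _
      _ ≤ L * (h ^ β * ‖u‖ ^ β) * |K u| := mul_le_mul_of_nonneg_right hb (abs_nonneg _)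
      _ = L * h ^ β * (‖u‖ ^ β * |K u|) := by ring
  have hTmeas : Measurable T := by
    refine Continuous.measurable (continuous_finsetSum _ fun k _ => ?_)
    exact (m k).cont.comp (continuous_pi fun _ => continuous_id)
  have hremint : Integrable fun u => (p (x₀ + h • u) - T u) * K u := by
    refine (hKβ.const_mul (L * h ^ β)).mono' ?_ (.of_forall hbound)
    exact (((hpmeas.comp (by fun_prop)).sub hTmeas).mul hKm).aestronglyMeasurable
  have hsplit : ∫ u, p (x₀ + h • u) * K u =
      (∫ u, (p (x₀ + h • u) - T u) * K u) + p x₀ := by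
    rw [← hm0, ← hTval, ← integral_add hremint hTint]
    exact integral_congr_ae (.of_forall fun u => by simp only [hT]; ring)
  rw [integral_kernel_smoother_eq K p x₀ hh, hsplit, add_sub_cancel_right,
    ← integral_const_mul, ← Real.norm_eq_abs]
  exact norm_integral_le_of_norm_le (hKβ.const_mul _) (.of_forall hbound)
end

section
/- Fix λ > 0 and β, γ > 0 with γβ ≤ 1. Then there exist parameters L, r, β', L*, η > 0 and a constant C > 0 such that, with P_Σ = P_Σ(β,L,r,λ,γ,β',L*,η), for every n ≥ 1 and every estimator Ĝ_n of Γ_p(λ) constructed from an i.i.d. sample X₁,…,X_n (i.e., any map from samples in (ℝ^d)^n to measurable subsets of ℝ^d such that (x, sample) ↦ 1_{Ĝ_n}(x) is jointly measurable), one has sup_{p∈P_Σ} 𝔼_p[d_H(Γ_p(λ), Ĝ_n)] ≥ C n^{−(1+γ)β/(2β+d)}, where for each p the expectation is over the n-fold product of the measure with density p and d_H is computed with that p. -/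
open MeasureTheory ENNReal

/-- The `n`-fold product of the probability measure on `ℝ^d` with density `p` with respect
to Lebesgue measure. -/
noncomputable def prodMeasure (d n : ℕ) (p : EuclideanSpace ℝ (Fin d) → ℝ) :
    Measure (Fin n → EuclideanSpace ℝ (Fin d)) :=
  Measure.pi fun _ : Fin n => volume.withDensity fun x => ENNReal.ofReal (p x)

section Holder

variable {E : Type*} [NormedAddCommGroup E] [NormedSpace ℝ E]

/-- The remainder at `x` of the Taylor expansion of degree `⌊β⌋` of `u` at `x₀`. -/
noncomputable def taylorRem (β : ℝ) (u : E → ℝ) (x₀ x : E) : ℝ :=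
  u x - ∑ k ∈ Finset.range (⌊β⌋₊ + 1),
    ((k.factorial : ℝ))⁻¹ * iteratedFDeriv ℝ k u x₀ (fun _ => x - x₀)

/-- Functions satisfying the local Hölder condition at every point, without restriction to a
ball. -/
def GlobalHolder (β L : ℝ) (u : E → ℝ) : Prop :=
  ContDiff ℝ ⌊β⌋₊ u ∧ ∀ x₀ x, |taylorRem β u x₀ x| ≤ L * ‖x - x₀‖ ^ β

theorem GlobalHolder.mono {β L L' : ℝ} {u : E → ℝ} (h : GlobalHolder β L u) (hL : L ≤ L') :
    GlobalHolder β L' u :=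
  ⟨h.1, fun x₀ x => (h.2 x₀ x).trans
    (mul_le_mul_of_nonneg_right hL (Real.rpow_nonneg (norm_nonneg _) _))⟩

theorem taylorRem_sum {β : ℝ} {ι : Type*} (s : Finset ι) {u : ι → E → ℝ} (c : ι → ℝ)
    (h : ∀ i ∈ s, ContDiff ℝ ⌊β⌋₊ (u i)) (x₀ x : E) :
    taylorRem β (fun y => ∑ i ∈ s, c i * u i y) x₀ x = ∑ i ∈ s, c i * taylorRem β (u i) x₀ x := by
  unfold taylorRem
  simp only [mul_sub, Finset.sum_sub_distrib, Finset.mul_sum]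
  rw [Finset.sum_comm (s := s)]
  congr 1
  refine Finset.sum_congr rfl fun k hk => ?_
  have hk' : (k : WithTop ℕ∞) ≤ (⌊β⌋₊ : WithTop ℕ∞) := by
    exact_mod_cast Nat.lt_succ_iff.1 (Finset.mem_range.1 hk)
  have hc : ∀ i ∈ s, ContDiffAt ℝ k (u i) x₀ := fun i hi => ((h i hi).of_le hk').contDiffAt
  rw [iteratedFDeriv_fun_sum_apply (f := fun i y => c i * u i y)
    (fun i hi => contDiffAt_const.mul (hc i hi)), sum_apply, Finset.mul_sum]
  refine Finset.sum_congr rfl fun i hi => ?_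
  have := iteratedFDeriv_const_smul_apply' (a := c i) (hc i hi)
  simp only [smul_eq_mul] at this
  rw [this, smul_apply, smul_eq_mul]
  ring

theorem taylorRem_eq_zero {β : ℝ} {u : E → ℝ} {x₀ x : E} (h₀ : x₀ ∉ tsupport u)
    (h : x ∉ tsupport u) : taylorRem β u x₀ x = 0 := by
  unfold taylorRem
  rw [image_eq_zero_of_notMem_tsupport h, zero_sub, neg_eq_zero]
  refine Finset.sum_eq_zero fun k _ => ?_
  have : iteratedFDeriv ℝ k u x₀ = 0 := by
    by_contra hne
    exact h₀ (support_iteratedFDeriv_subset k hne)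
  simp [this]

theorem GlobalHolder.sum_of_disjoint {β L : ℝ} {ι : Type*} (s : Finset ι) {u : ι → E → ℝ}
    {c : ι → ℝ} (hc : ∀ i ∈ s, |c i| ≤ 1) (h : ∀ i ∈ s, GlobalHolder β L (u i)) (hL : 0 ≤ L)
    (hd : ∀ x, ∀ i ∈ s, ∀ j ∈ s, x ∈ tsupport (u i) → x ∈ tsupport (u j) → i = j) :
    GlobalHolder β (2 * L) (fun y => ∑ i ∈ s, c i * u i y) := by
  classical
  refine ⟨ContDiff.sum fun i hi => contDiff_const.mul (h i hi).1, fun x₀ x => ?_⟩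
  rw [taylorRem_sum s c (fun i hi => (h i hi).1)]
  set B := L * ‖x - x₀‖ ^ β with hB
  have hB0 : 0 ≤ B := mul_nonneg hL (Real.rpow_nonneg (norm_nonneg _) _)
  have hcard : ∀ y, (∑ i ∈ s, if y ∈ tsupport (u i) then B else 0) ≤ B := by
    intro y
    rw [← Finset.sum_filter, Finset.sum_const, nsmul_eq_mul]
    have : (s.filter fun i => y ∈ tsupport (u i)).card ≤ 1 := by
      refine Finset.card_le_one.2 fun i hi j hj => ?_
      rw [Finset.mem_filter] at hi hj
      exact hd y i hi.1 j hj.1 hi.2 hj.2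
    have h1 : ((s.filter fun i => y ∈ tsupport (u i)).card : ℝ) ≤ 1 := by exact_mod_cast this
    nlinarith
  calc |∑ i ∈ s, c i * taylorRem β (u i) x₀ x|
      ≤ ∑ i ∈ s, |c i * taylorRem β (u i) x₀ x| := Finset.abs_sum_le_sum_abs _ _
    _ ≤ ∑ i ∈ s, ((if x₀ ∈ tsupport (u i) then B else 0) +
          (if x ∈ tsupport (u i) then B else 0)) := by
        refine Finset.sum_le_sum fun i hi => ?_
        have hle : |c i * taylorRem β (u i) x₀ x| ≤ B := by
          rw [abs_mul]
          calc _ ≤ 1 * |taylorRem β (u i) x₀ x| :=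
                mul_le_mul_of_nonneg_right (hc i hi) (abs_nonneg _)
            _ ≤ B := by rw [one_mul]; exact (h i hi).2 x₀ x
        by_cases h0 : x₀ ∈ tsupport (u i)
        · rw [if_pos h0]
          split_ifs <;> linarith
        by_cases h1 : x ∈ tsupport (u i)
        · rw [if_pos h1, if_neg h0]
          linarith
        · rw [taylorRem_eq_zero h0 h1, if_neg h0, if_neg h1]
          simp
    _ ≤ B + B := by
        rw [Finset.sum_add_distrib]
        exact add_le_add (hcard x₀) (hcard x)
    _ = 2 * L * ‖x - x₀‖ ^ β := by rw [hB]; ring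

theorem GlobalHolder.add {β L L' : ℝ} {u v : E → ℝ} (hu : GlobalHolder β L u)
    (hv : GlobalHolder β L' v) : GlobalHolder β (L + L') (fun y => u y + v y) := by
  refine ⟨hu.1.add hv.1, fun x₀ x => ?_⟩
  have := taylorRem_sum (β := β) (Finset.univ : Finset (Fin 2)) (u := ![u, v]) (fun _ => 1)
    (by intro i _; fin_cases i; exacts [hu.1, hv.1]) x₀ x
  simp only [Fin.sum_univ_two, one_mul, Matrix.cons_val_zero, Matrix.cons_val_one] at this
  rw [this, add_mul]
  exact (abs_add_le _ _).trans (add_le_add (hu.2 x₀ x) (hv.2 x₀ x))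

theorem GlobalHolder.const_mul {β L : ℝ} {u : E → ℝ} (hu : GlobalHolder β L u) (a : ℝ) :
    GlobalHolder β (|a| * L) (fun y => a * u y) := by
  refine ⟨contDiff_const.mul hu.1, fun x₀ x => ?_⟩
  have := taylorRem_sum (β := β) (Finset.univ : Finset (Fin 1)) (u := fun _ => u) (fun _ => a)
    (fun i _ => hu.1) x₀ x
  simp only [Fin.sum_univ_one] at this
  rw [this, abs_mul, mul_assoc]
  exact mul_le_mul_of_nonneg_left (hu.2 x₀ x) (abs_nonneg _)

theorem GlobalHolder.comp_affine {β L : ℝ} {u : E → ℝ} (hu : GlobalHolder β L u) {b : ℝ}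
    (hb : 0 ≤ b) (z : E) : GlobalHolder β (L * b ^ β) (fun y => u (b • y - z)) := by
  have hu' : ContDiff ℝ ⌊β⌋₊ (fun y => u (y - z)) := hu.1.comp (contDiff_id.sub contDiff_const)
  refine ⟨hu'.comp (contDiff_const_smul b), fun x₀ x => ?_⟩
  have : taylorRem β (fun y => u (b • y - z)) x₀ x = taylorRem β u (b • x₀ - z) (b • x - z) := by
    unfold taylorRem
    congr 1
    refine Finset.sum_congr rfl fun k hk => ?_
    have hk' : (k : WithTop ℕ∞) ≤ (⌊β⌋₊ : WithTop ℕ∞) := by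
      exact_mod_cast Nat.lt_succ_iff.1 (Finset.mem_range.1 hk)
    rw [iteratedFDeriv_comp_const_smul (f := fun y => u (y - z)) b (hu'.of_le hk'),
      iteratedFDeriv_comp_sub']
    have : (fun _ : Fin k => b • x - z - (b • x₀ - z)) = fun _ : Fin k => b • (x - x₀) := by
      funext; rw [smul_sub]; abel
    rw [this, ContinuousMultilinearMap.map_smul_univ (m := fun _ => x - x₀)]
    simp
  rw [this]
  refine (hu.2 _ _).trans (le_of_eq ?_)
  have : b • x - z - (b • x₀ - z) = b • (x - x₀) := by rw [smul_sub]; abel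
  rw [this, norm_smul, Real.norm_of_nonneg hb, Real.mul_rpow hb (norm_nonneg _), mul_assoc]

theorem ContDiff.exists_globalHolder {β : ℝ} (hβ : 0 ≤ β) {u : E → ℝ}
    (hu : ContDiff ℝ ((⊤ : ℕ∞) : WithTop ℕ∞) u) (hc : HasCompactSupport u) :
    ∃ L, 0 < L ∧ GlobalHolder β L u := by
  have hbd : ∀ k : ℕ, ∃ C, ∀ x, ‖iteratedFDeriv ℝ k u x‖ ≤ C := fun k =>
    (hu.continuous_iteratedFDeriv (by exact_mod_cast le_top)).bounded_above_of_compact_support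
      (hc.iteratedFDeriv k)
  choose C hC using hbd
  have hC0 : ∀ k, 0 ≤ C k := fun k => (norm_nonneg _).trans (hC k 0)
  set m := ⌊β⌋₊ with hm
  have hmβ : (m : ℝ) ≤ β := Nat.floor_le hβ
  have hmβ' : β ≤ (m + 1 : ℕ) := by push_cast; exact (Nat.lt_floor_add_one β).le
  have happ : ∀ k (x v : E), |iteratedFDeriv ℝ k u x (fun _ => v)| ≤ C k * ‖v‖ ^ k := by
    intro k x v
    have := (iteratedFDeriv ℝ k u x).le_opNorm (fun _ => v)
    simp only [Finset.prod_const, Finset.card_univ, Fintype.card_fin, Real.norm_eq_abs] at this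
    exact this.trans (mul_le_mul_of_nonneg_right (hC k x) (by positivity))
  set L := C (m + 1) + (C 0 + ∑ k ∈ Finset.range (m + 1), C k) + 1 with hL
  have hS : 0 ≤ ∑ k ∈ Finset.range (m + 1), C k := Finset.sum_nonneg fun k _ => hC0 k
  refine ⟨L, by have := hC0 0; have := hC0 (m+1); positivity,
    hu.of_le (by exact_mod_cast le_top), fun x₀ x => ?_⟩
  have hp : 0 ≤ ‖x - x₀‖ ^ β := Real.rpow_nonneg (norm_nonneg _) _
  rcases le_total ‖x - x₀‖ 1 with h1 | h1
  · have key := map_add_eq_sum_add_integral_iteratedFDeriv (f := u) (x := x₀) (y := x - x₀) (n := m)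
      (fun t _ => hu.contDiffAt.of_le (by exact_mod_cast le_top))
    rw [add_sub_cancel] at key
    have : taylorRem β u x₀ x = (m.factorial : ℝ)⁻¹ • ∫ t in (0:ℝ)..1,
        (1 - t) ^ m • iteratedFDeriv ℝ (m + 1) u (x₀ + t • (x - x₀)) (fun _ => x - x₀) := by
      unfold taylorRem
      rw [key]
      simp only [smul_eq_mul]
      ring
    rw [this, smul_eq_mul, abs_mul]
    have h2 : |((m.factorial : ℝ))⁻¹| ≤ 1 := by
      rw [abs_of_nonneg (by positivity)]
      exact inv_le_one_of_one_le₀ (by exact_mod_cast Nat.one_le_iff_ne_zero.2 m.factorial_ne_zero)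
    have h3 := intervalIntegral.norm_integral_le_of_norm_le_const (a := (0:ℝ)) (b := 1)
      (f := fun t : ℝ => (1 - t) ^ m •
        iteratedFDeriv ℝ (m + 1) u (x₀ + t • (x - x₀)) (fun _ => x - x₀))
      (C := C (m+1) * ‖x - x₀‖ ^ (m+1)) (by
        intro t ht
        rw [Set.uIoc_of_le zero_le_one] at ht
        rw [norm_smul, Real.norm_eq_abs, Real.norm_eq_abs, abs_pow]
        have : |1 - t| ^ m ≤ 1 := pow_le_one₀ (abs_nonneg _)
          (by rw [abs_of_nonneg (by linarith [ht.2])]; linarith [ht.1])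
        have h4 := happ (m+1) (x₀ + t • (x - x₀)) (x - x₀)
        calc _ ≤ 1 * (C (m+1) * ‖x - x₀‖ ^ (m+1)) :=
              mul_le_mul this h4 (abs_nonneg _) zero_le_one
          _ = _ := one_mul _)
    rw [Real.norm_eq_abs] at h3
    simp only [sub_zero, abs_one, mul_one] at h3
    have h5 : ‖x - x₀‖ ^ (m+1) ≤ ‖x - x₀‖ ^ β := by
      rcases (norm_nonneg (x - x₀)).eq_or_lt with h0 | h0
      · rw [← h0, zero_pow (Nat.succ_ne_zero _)]; exact Real.rpow_nonneg le_rfl _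
      rw [← Real.rpow_natCast]
      exact Real.rpow_le_rpow_of_exponent_ge h0 h1 hmβ'
    calc _ ≤ 1 * (C (m+1) * ‖x - x₀‖ ^ (m+1)) := mul_le_mul h2 h3 (abs_nonneg _) zero_le_one
      _ ≤ C (m+1) * ‖x - x₀‖ ^ β := by
        rw [one_mul]; exact mul_le_mul_of_nonneg_left h5 (hC0 _)
      _ ≤ L * ‖x - x₀‖ ^ β := mul_le_mul_of_nonneg_right (by have := hC0 0; linarith) hp
  · have h1β : 1 ≤ ‖x - x₀‖ ^ β := Real.one_le_rpow h1 hβ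
    have hux : |u x| ≤ C 0 * ‖x - x₀‖ ^ β := by
      have := hC 0 x
      rw [norm_iteratedFDeriv_zero, Real.norm_eq_abs] at this
      have := hC0 0
      nlinarith
    have hk : ∀ k ∈ Finset.range (m+1), |((k.factorial : ℝ))⁻¹ *
        iteratedFDeriv ℝ k u x₀ (fun _ => x - x₀)| ≤ C k * ‖x - x₀‖ ^ β := by
      intro k hk
      have hkm : k ≤ m := Nat.lt_succ_iff.1 (Finset.mem_range.1 hk)
      have h2 : |((k.factorial : ℝ))⁻¹| ≤ 1 := by
        rw [abs_of_nonneg (by positivity)]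
        exact inv_le_one_of_one_le₀ (by exact_mod_cast Nat.one_le_iff_ne_zero.2 k.factorial_ne_zero)
      have h5 : ‖x - x₀‖ ^ k ≤ ‖x - x₀‖ ^ β := by
        rw [← Real.rpow_natCast]
        exact Real.rpow_le_rpow_of_exponent_le h1 (le_trans (by exact_mod_cast hkm) hmβ)
      rw [abs_mul]
      calc _ ≤ 1 * (C k * ‖x - x₀‖ ^ k) := mul_le_mul h2 (happ k _ _) (abs_nonneg _) zero_le_one
        _ ≤ _ := by rw [one_mul]; exact mul_le_mul_of_nonneg_left h5 (hC0 _)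
    calc |taylorRem β u x₀ x| ≤ |u x| + |∑ k ∈ Finset.range (m + 1),
            ((k.factorial : ℝ))⁻¹ * iteratedFDeriv ℝ k u x₀ (fun _ => x - x₀)| := abs_sub _ _
      _ ≤ C 0 * ‖x - x₀‖ ^ β + ∑ k ∈ Finset.range (m + 1), C k * ‖x - x₀‖ ^ β :=
          add_le_add hux ((Finset.abs_sum_le_sum_abs _ _).trans (Finset.sum_le_sum hk))
      _ = (C 0 + ∑ k ∈ Finset.range (m + 1), C k) * ‖x - x₀‖ ^ β := by
          rw [add_mul, Finset.sum_mul]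
      _ ≤ L * ‖x - x₀‖ ^ β := mul_le_mul_of_nonneg_right (by have := hC0 (m+1); linarith) hp

theorem globalHolder_of_lt_one {β L : ℝ} (hβ : β < 1) {u : E → ℝ} (hu : Continuous u)
    (h : ∀ x₀ x, |u x - u x₀| ≤ L * ‖x - x₀‖ ^ β) : GlobalHolder β L u := by
  have : ⌊β⌋₊ = 0 := Nat.floor_eq_zero.2 hβ
  refine ⟨by rw [this]; exact contDiff_zero.2 hu, fun x₀ x => ?_⟩
  simpa [taylorRem, this] using h x₀ x

end Holder

section Product

variable {E : Type*} [MeasurableSpace E] {μ : Measure E} [SigmaFinite μ]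

theorem lintegral_pi_prod {n : ℕ} {f : Fin n → E → ℝ≥0∞} (hf : ∀ i, Measurable (f i)) :
    ∫⁻ ω, ∏ i, f i (ω i) ∂(Measure.pi fun _ : Fin n => μ) = ∏ i, ∫⁻ x, f i x ∂μ := by
  induction n with
  | zero => simp
  | succ n ih =>
    have := (measurePreserving_piFinSuccAbove (fun _ : Fin (n + 1) => μ) 0).symm
    rw [← this.lintegral_comp (by fun_prop)]
    simp only [MeasurableEquiv.piFinSuccAbove_symm_apply, Fin.insertNthEquiv,
      Fin.prod_univ_succ, Fin.insertNth_zero, Equiv.coe_fn_mk, Fin.cons_succ, Fin.zero_succAbove,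
      cast_eq, Fin.cons_zero]
    rw [lintegral_prod_mul (f := f 0) (g := fun ω : Fin n → E => ∏ i, f i.succ (ω i))
      (hf 0).aemeasurable (Finset.measurable_prod _ fun i _ =>
        (hf i.succ).comp (measurable_pi_apply i)).aemeasurable, ih fun i => hf i.succ]

theorem pi_withDensity_eq {n : ℕ} {f : E → ℝ≥0∞} (hf : Measurable f)
    [SigmaFinite (μ.withDensity f)] :
    (Measure.pi fun _ : Fin n => μ.withDensity f) =
      (Measure.pi fun _ : Fin n => μ).withDensity fun ω => ∏ i, f (ω i) := by
  refine Measure.pi_eq (μ := fun _ : Fin n => μ.withDensity f) fun s hs => ?_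
  rw [withDensity_apply _ (MeasurableSet.univ_pi hs),
    ← lintegral_indicator (MeasurableSet.univ_pi hs)]
  have : (Set.univ.pi s).indicator (fun ω : Fin n → E => ∏ i, f (ω i)) =
      fun ω => ∏ i, (s i).indicator f (ω i) := by
    classical
    funext ω
    by_cases h : ω ∈ Set.univ.pi s
    · rw [Set.indicator_of_mem h]
      exact Finset.prod_congr rfl fun i _ => (Set.indicator_of_mem (h i (Set.mem_univ i)) _).symm
    · rw [Set.indicator_of_notMem h]
      simp only [Set.mem_pi, Set.mem_univ, true_imp_iff, not_forall] at h
      obtain ⟨i, hi⟩ := h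
      exact (Finset.prod_eq_zero (Finset.mem_univ i) (Set.indicator_of_notMem hi _)).symm
  rw [this, lintegral_pi_prod fun i => hf.indicator (hs i)]
  refine Finset.prod_congr rfl fun i _ => ?_
  rw [lintegral_indicator (hs i), withDensity_apply _ (hs i)]

end Product

section TwoPoint

/-- Le Cam's inequality between affinity and overlap, in a form sufficient for product densities. -/
theorem le_lintegral_min_prod {E : Type*} [MeasurableSpace E] {μ : Measure E} [SigmaFinite μ]
    {n : ℕ} {p q : E → ℝ} (hp : Measurable p) (hq : Measurable q) (hp0 : ∀ x, 0 ≤ p x)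
    (hq0 : ∀ x, 0 ≤ q x) (hp1 : ∫⁻ x, ENNReal.ofReal (p x) ∂μ = 1)
    (hq1 : ∫⁻ x, ENNReal.ofReal (q x) ∂μ = 1)
    (h : ENNReal.ofReal (1 - 1 / (2 * n)) ≤ ∫⁻ x, ENNReal.ofReal (√(p x * q x)) ∂μ) :
    (8 : ℝ≥0∞)⁻¹ ≤ ∫⁻ ω, min (∏ i, ENNReal.ofReal (p (ω i))) (∏ i, ENNReal.ofReal (q (ω i)))
      ∂(Measure.pi fun _ : Fin n => μ) := by
  set ν := Measure.pi fun _ : Fin n => μ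
  have hA : ENNReal.ofReal (1 / 2) ≤ ∫⁻ ω, ∏ i, ENNReal.ofReal (√(p (ω i) * q (ω i))) ∂ν := by
    rw [lintegral_pi_prod (f := fun _ x => ENNReal.ofReal (√(p x * q x)))
      (fun _ => by fun_prop), Finset.prod_const, Finset.card_univ, Fintype.card_fin]
    refine le_trans ?_ (pow_le_pow_left₀ zero_le h n)
    rcases n.eq_zero_or_pos with rfl | hn
    · norm_num
    have hn1 : (1 : ℝ) ≤ n := by exact_mod_cast hn
    have h2 : (1 : ℝ) / (2 * n) ≤ 1 / 2 := by
      apply one_div_le_one_div_of_le <;> linarith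
    rw [← ENNReal.ofReal_pow (by linarith)]
    apply ENNReal.ofReal_le_ofReal
    have := one_add_mul_le_pow (a := -(1 / (2 * (n:ℝ)))) (by linarith) n
    have h3 : (n : ℝ) * (1 / (2 * n)) = 1 / 2 := by field_simp
    calc (1:ℝ) / 2 = 1 + n * -(1 / (2 * n)) := by linarith
      _ ≤ _ := by rw [sub_eq_add_neg]; exact this
  have hpt : ∀ ω : Fin n → E, 8 * ∏ i, ENNReal.ofReal (√(p (ω i) * q (ω i))) ≤
      16 * min (∏ i, ENNReal.ofReal (p (ω i))) (∏ i, ENNReal.ofReal (q (ω i))) +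
      (∏ i, ENNReal.ofReal (p (ω i)) + ∏ i, ENNReal.ofReal (q (ω i))) := by
    intro ω
    rw [← ENNReal.ofReal_prod_of_nonneg fun i _ => Real.sqrt_nonneg _,
      ← ENNReal.ofReal_prod_of_nonneg fun i _ => hp0 _,
      ← ENNReal.ofReal_prod_of_nonneg fun i _ => hq0 _]
    have hs : ∏ i, √(p (ω i) * q (ω i)) = √((∏ i, p (ω i)) * ∏ i, q (ω i)) := by
      rw [← Finset.prod_mul_distrib]
      refine (Real.sqrt_eq_iff_mul_self_eq
        (Finset.prod_nonneg fun i _ => mul_nonneg (hp0 _) (hq0 _))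
        (Finset.prod_nonneg fun i _ => Real.sqrt_nonneg _)).2 ?_ |>.symm
      rw [← Finset.prod_mul_distrib]
      exact Finset.prod_congr rfl fun i _ =>
        (Real.mul_self_sqrt (mul_nonneg (hp0 _) (hq0 _))).symm
    rw [hs]
    have ha : 0 ≤ ∏ i, p (ω i) := Finset.prod_nonneg fun i _ => hp0 _
    have hb : 0 ≤ ∏ i, q (ω i) := Finset.prod_nonneg fun i _ => hq0 _
    generalize ∏ i, p (ω i) = a at *
    generalize ∏ i, q (ω i) = b at *
    rw [← (ENNReal.ofReal_mono : Monotone ENNReal.ofReal).map_min, ← ENNReal.ofReal_add ha hb]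
    have e8 : (8 : ℝ≥0∞) = ENNReal.ofReal 8 := by norm_num
    have e16 : (16 : ℝ≥0∞) = ENNReal.ofReal 16 := by norm_num
    rw [e8, e16, ← ENNReal.ofReal_mul (by norm_num), ← ENNReal.ofReal_mul (by norm_num),
      ← ENNReal.ofReal_add (by positivity) (by positivity)]
    apply ENNReal.ofReal_le_ofReal
    rw [Real.sqrt_mul ha]
    have h1 := Real.sq_sqrt ha
    have h2 := Real.sq_sqrt hb
    have h3 := Real.sqrt_nonneg a
    have h4 := Real.sqrt_nonneg b
    rcases le_total a b with hab | hab
    · rw [min_eq_left hab]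
      nlinarith [sq_nonneg (4 * √a - √b)]
    · rw [min_eq_right hab]
      nlinarith [sq_nonneg (√a - 4 * √b)]
  have hI := lintegral_mono (μ := ν) hpt
  have hmp : Measurable fun ω : Fin n → E => ∏ i, ENNReal.ofReal (p (ω i)) := by fun_prop
  have hmq : Measurable fun ω : Fin n → E => ∏ i, ENNReal.ofReal (q (ω i)) := by fun_prop
  rw [lintegral_const_mul _ (by fun_prop), lintegral_add_right (g := fun ω : Fin n → E =>
      ∏ i, ENNReal.ofReal (p (ω i)) + ∏ i, ENNReal.ofReal (q (ω i))) _ (hmp.add hmq),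
    lintegral_const_mul _ (hmp.min hmq), lintegral_add_right _ hmq,
    lintegral_pi_prod (f := fun _ x => ENNReal.ofReal (p x)) (fun _ => by fun_prop),
    lintegral_pi_prod (f := fun _ x => ENNReal.ofReal (q x)) (fun _ => by fun_prop)] at hI
  simp only [hp1, hq1, Finset.prod_const_one] at hI
  have h4 : (8 : ℝ≥0∞) * ENNReal.ofReal (1 / 2) = 2 + 2 := by
    rw [show (8 : ℝ≥0∞) = ENNReal.ofReal 8 by norm_num, ← ENNReal.ofReal_mul (by norm_num)]
    norm_num
  have h5 : (2 : ℝ≥0∞) + 2 ≤ 16 * (∫⁻ ω, min (∏ i, ENNReal.ofReal (p (ω i)))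
      (∏ i, ENNReal.ofReal (q (ω i))) ∂ν) + 2 := by
    rw [← h4]
    refine (mul_le_mul_right hA _).trans (hI.trans (le_of_eq ?_))
    norm_num
  have h6 := (ENNReal.add_le_add_iff_right (by norm_num : (2:ℝ≥0∞) ≠ ⊤)).1 h5
  rw [show (16 : ℝ≥0∞) = 2 * 8 by norm_num, mul_assoc] at h6
  have h7 : (1 : ℝ≥0∞) ≤ 8 * (∫⁻ ω, min (∏ i, ENNReal.ofReal (p (ω i)))
      (∏ i, ENNReal.ofReal (q (ω i))) ∂ν) := by
    refine (ENNReal.mul_le_mul_iff_right (a := 2) (by norm_num) (by norm_num)).1 ?_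
    simpa using h6
  exact (ENNReal.inv_le_iff_le_mul (by simp) (by simp)).2 h7

/-- The affinity of two densities that differ only on a set of finite measure. -/
theorem le_lintegral_sqrt_mul {E : Type*} [MeasurableSpace E] {μ : Measure E}
    {p q : E → ℝ} (hp : Measurable p) (hq : Measurable q) (hp0 : ∀ x, 0 ≤ p x)
    (hp1 : ∫⁻ x, ENNReal.ofReal (p x) ∂μ = 1)
    (hq0 : ∀ x, 0 ≤ q x) (hq1 : ∫⁻ x, ENNReal.ofReal (q x) ∂μ = 1)
    {A : Set E} (hA : MeasurableSet A) (hAμ : μ A ≠ ⊤) (hpq : ∀ x ∉ A, p x = q x)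
    {c D : ℝ} (hc : 0 < c) (hcp : ∀ x ∈ A, c ≤ p x) (hcq : ∀ x ∈ A, c ≤ q x)
    (hD : ∀ x ∈ A, |p x - q x| ≤ D) :
    ENNReal.ofReal (1 - D ^ 2 * μ.real A / (4 * c)) ≤
      ∫⁻ x, ENNReal.ofReal (√(p x * q x)) ∂μ := by
  have hint : ∀ f : E → ℝ, Measurable f → (∀ x, 0 ≤ f x) →
      ∫⁻ x, ENNReal.ofReal (f x) ∂μ = 1 → Integrable f μ ∧ ∫ x, f x ∂μ = 1 := by
    intro f hf h0 h1
    refine ⟨⟨hf.aestronglyMeasurable, ?_⟩, ?_⟩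
    · rw [hasFiniteIntegral_iff_ofReal (Filter.Eventually.of_forall h0), h1]
      exact one_lt_top
    · rw [integral_eq_lintegral_of_nonneg_ae (Filter.Eventually.of_forall h0)
        hf.aestronglyMeasurable, h1]
      rfl
  obtain ⟨ip, jp⟩ := hint p hp hp0 hp1
  obtain ⟨iq, jq⟩ := hint q hq hq0 hq1
  have hle : ∀ x, (p x + q x) / 2 - A.indicator (fun _ => D ^ 2 / (4 * c)) x ≤ √(p x * q x) := by
    intro x
    by_cases hx : x ∈ A
    · rw [Set.indicator_of_mem hx]
      have h1 := hcp x hx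
      have h2 := hcq x hx
      have h3 := hD x hx
      have hsq : (p x - q x) ^ 2 ≤ D ^ 2 := sq_le_sq' (by linarith [neg_abs_le (p x - q x)])
        ((le_abs_self _).trans h3)
      rw [Real.sqrt_mul (hp0 x)]
      have e1 := Real.sq_sqrt (hp0 x)
      have e2 := Real.sq_sqrt (hq0 x)
      have e3 := Real.sqrt_nonneg (p x)
      have e4 := Real.sqrt_nonneg (q x)
      rw [sub_le_iff_le_add, ← sub_le_iff_le_add', le_div_iff₀ (by positivity)]
      generalize √(p x) = a at *
      generalize √(q x) = b at *
      rw [← e1, ← e2] at hsq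
      have h5 : 2 * c ≤ (a + b) ^ 2 := by nlinarith
      nlinarith [mul_le_mul_of_nonneg_left h5 (sq_nonneg (a - b))]
    · rw [Set.indicator_of_notMem hx, ← hpq x hx, Real.sqrt_mul_self (hp0 x)]
      linarith
  have iA : Integrable (A.indicator (fun _ => D ^ 2 / (4 * c))) μ :=
    (integrable_indicator_iff hA).2 (integrableOn_const hAμ)
  have i2 : Integrable (fun x => (p x + q x) / 2 - A.indicator (fun _ => D ^ 2 / (4 * c)) x) μ :=
    ((ip.add iq).div_const 2).sub iA
  have hval : ∫ x, ((p x + q x) / 2 - A.indicator (fun _ => D ^ 2 / (4 * c)) x) ∂μ =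
      1 - D ^ 2 * μ.real A / (4 * c) := by
    rw [integral_sub (f := fun x => (p x + q x) / 2) ((ip.add iq).div_const 2) iA,
      integral_div, integral_add ip iq, jp, jq,
      integral_indicator hA, setIntegral_const, smul_eq_mul]
    ring
  have hs : Integrable (fun x => √(p x * q x)) μ := by
    refine (ip.add iq).mono' (by fun_prop) (Filter.Eventually.of_forall fun x => ?_)
    rw [Real.norm_of_nonneg (Real.sqrt_nonneg _)]
    refine Real.sqrt_le_iff.2 ⟨add_nonneg (hp0 x) (hq0 x), ?_⟩
    simp only [Pi.add_apply]
    nlinarith [hp0 x, hq0 x, mul_nonneg (hp0 x) (hq0 x)]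
  rw [← ofReal_integral_eq_lintegral_ofReal hs
    (Filter.Eventually.of_forall fun x => Real.sqrt_nonneg _), ← hval]
  exact ENNReal.ofReal_le_ofReal (integral_mono i2 hs hle)

end TwoPoint

section Assouad

theorem exists_average_le {ι : Type*} [Fintype ι] [DecidableEq ι] {X : (ι → Bool) → ι → ℝ≥0∞}
    {R : (ι → Bool) → ℝ≥0∞} {c : ℝ≥0∞} (hR : ∀ σ, ∑ z, X σ z ≤ R σ)
    (hX : ∀ σ z, c ≤ X σ z + X (Function.update σ z (!σ z)) z) :
    ∃ σ, Fintype.card ι * c ≤ 2 * R σ := by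
  obtain ⟨σ₀, hσ₀⟩ := Finite.exists_max R
  refine ⟨σ₀, ?_⟩
  have hflip : ∀ z, ∑ σ, X (Function.update σ z (!σ z)) z = ∑ σ, X σ z := fun z => by
    have hinv : Function.Involutive fun σ : ι → Bool => Function.update σ z (!σ z) := fun σ => by
      simp
    exact Equiv.sum_comp hinv.toPerm fun σ => X σ z
  have h1 : ∑ _σ : ι → Bool, ∑ _z : ι, c ≤ ∑ _σ : ι → Bool, 2 * R σ₀ := by
    calc ∑ _σ : ι → Bool, ∑ _z : ι, c
        ≤ ∑ σ, ∑ z, (X σ z + X (Function.update σ z (!σ z)) z) :=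
          Finset.sum_le_sum fun σ _ => Finset.sum_le_sum fun z _ => hX σ z
      _ = ∑ σ, 2 * ∑ z, X σ z := by
          simp only [Finset.sum_add_distrib]
          rw [Finset.sum_comm (f := fun σ z => X (Function.update σ z (!σ z)) z)]
          simp only [hflip]
          rw [Finset.sum_comm, ← two_mul, ← Finset.mul_sum, Finset.sum_comm]
      _ ≤ ∑ _σ : ι → Bool, 2 * R σ₀ :=
          Finset.sum_le_sum fun σ _ => mul_le_mul_right ((hR σ).trans (hσ₀ σ)) _
  simp only [Finset.sum_const, Finset.card_univ, nsmul_eq_mul] at h1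
  exact (ENNReal.mul_le_mul_iff_right (by simp) (by simp)).1 h1

/-- A lower bound of Assouad type for the weighted symmetric difference risk of level set
estimators over a hypercube of densities. -/
theorem exists_le_risk {d n : ℕ} {ι : Type*} [Fintype ι] [DecidableEq ι] {lam b : ℝ} (hb : 0 < b)
    {V : ℝ≥0∞} {p : (ι → Bool) → EuclideanSpace ℝ (Fin d) → ℝ} (hpm : ∀ σ, Measurable (p σ))
    (haff : ∀ σ z, (8 : ℝ≥0∞)⁻¹ ≤ ∫⁻ ω, min (∏ i, ENNReal.ofReal (p σ (ω i)))
      (∏ i, ENNReal.ofReal (p (Function.update σ z (!σ z)) (ω i)))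
      ∂(Measure.pi fun _ : Fin n => (volume : Measure (EuclideanSpace ℝ (Fin d)))))
    {D : ι → Set (EuclideanSpace ℝ (Fin d))} (hDm : ∀ z, MeasurableSet (D z))
    (hDd : Pairwise (Function.onFun Disjoint D)) (hDV : ∀ z, V ≤ volume (D z))
    (hpos : ∀ σ z x, x ∈ D z → σ z = true → lam + b ≤ p σ x)
    (hneg : ∀ σ z x, x ∈ D z → σ z = false → p σ x ≤ lam - b)
    {Ghat : (Fin n → EuclideanSpace ℝ (Fin d)) → Set (EuclideanSpace ℝ (Fin d))}
    (hG : MeasurableSet {q : EuclideanSpace ℝ (Fin d) ×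
          (Fin n → EuclideanSpace ℝ (Fin d)) | q.1 ∈ Ghat q.2}) :
    ∃ σ, Fintype.card ι * (ENNReal.ofReal b * V * 8⁻¹) ≤
      2 * ∫⁻ ω, (∫⁻ x in symmDiff {x | lam < p σ x} (Ghat ω),
              ENNReal.ofReal |p σ x - lam|) ∂(prodMeasure d n (p σ)) := by
  set ν := Measure.pi fun _ : Fin n => (volume : Measure (EuclideanSpace ℝ (Fin d))) with hν
  let S : Bool → (Fin n → EuclideanSpace ℝ (Fin d)) → Set (EuclideanSpace ℝ (Fin d)) :=
    fun s ω => if s then (Ghat ω)ᶜ else Ghat ω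
  have hSm : ∀ s, MeasurableSet {q : EuclideanSpace ℝ (Fin d) ×
      (Fin n → EuclideanSpace ℝ (Fin d)) | q.1 ∈ S s q.2} := by
    intro s
    cases s
    · simpa [S] using hG
    · exact hG.compl
  let a : Bool → ι → (Fin n → EuclideanSpace ℝ (Fin d)) → ℝ≥0∞ :=
    fun s z ω => ENNReal.ofReal b * volume (D z ∩ S s ω)
  have ham : ∀ s z, Measurable (a s z) := by
    intro s z
    refine Measurable.const_mul ?_ _
    exact measurable_measure_prodMk_right
      (s := {q | q.1 ∈ D z} ∩ {q | q.1 ∈ S s q.2}) ((measurable_fst (hDm z)).inter (hSm s))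
  have hGω : ∀ ω, MeasurableSet (Ghat ω) := fun ω => measurable_prodMk_right hG
  have hprod : ∀ σ, prodMeasure d n (p σ) =
      ν.withDensity fun ω => ∏ i, ENNReal.ofReal (p σ (ω i)) := fun σ =>
    pi_withDensity_eq (hpm σ).ennreal_ofReal
  have hdm : ∀ σ, Measurable fun ω : Fin n → EuclideanSpace ℝ (Fin d) =>
      ∏ i, ENNReal.ofReal (p σ (ω i)) := fun σ => by have := hpm σ; fun_prop
  refine exists_average_le (X := fun σ z => ∫⁻ ω, a (σ z) z ω ∂(prodMeasure d n (p σ)))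
    (R := fun σ => ∫⁻ ω, (∫⁻ x in symmDiff {x | lam < p σ x} (Ghat ω),
      ENNReal.ofReal |p σ x - lam|) ∂(prodMeasure d n (p σ))) (fun σ => ?_) (fun σ z => ?_)
  · rw [← lintegral_finsetSum _ fun z _ => ham (σ z) z]
    refine lintegral_mono fun ω => ?_
    have hTm : ∀ z, MeasurableSet (D z ∩ S (σ z) ω) := fun z =>
      (hDm z).inter (measurable_prodMk_right (hSm (σ z)))
    have hsub : (⋃ z ∈ (Finset.univ : Finset ι), D z ∩ S (σ z) ω) ⊆
        symmDiff {x | lam < p σ x} (Ghat ω) := by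
      intro x hx
      simp only [Finset.mem_univ, Set.iUnion_true, Set.mem_iUnion] at hx
      obtain ⟨z, hz, hs⟩ := hx
      cases hσ : σ z
      · have := hneg σ z x hz hσ
        refine Or.inr ⟨by simpa [S, hσ] using hs, ?_⟩
        simp only [Set.mem_ofPred_eq, not_lt]
        linarith
      · have := hpos σ z x hz hσ
        refine Or.inl ⟨?_, by simpa [S, hσ] using hs⟩
        simp only [Set.mem_ofPred_eq]
        linarith
    refine le_trans ?_ (lintegral_mono_set hsub)
    rw [lintegral_biUnion_finset (fun i _ j _ hij =>
      (hDd hij).mono Set.inter_subset_left Set.inter_subset_left) fun z _ => hTm z]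
    refine Finset.sum_le_sum fun z _ => ?_
    simp only [a]
    rw [← setLIntegral_const]
    refine setLIntegral_mono' (hTm z) fun x hx => ENNReal.ofReal_le_ofReal ?_
    cases hσ : σ z
    · have := hneg σ z x hx.1 hσ
      rw [abs_sub_comm]
      exact le_trans (by linarith) (le_abs_self _)
    · have := hpos σ z x hx.1 hσ
      exact le_trans (by linarith) (le_abs_self _)
  · have hsum : ∀ ω, ENNReal.ofReal b * V ≤ a (σ z) z ω + a (!σ z) z ω := by
      intro ω
      simp only [a]
      rw [← mul_add]
      refine mul_le_mul_right ((hDV z).trans ?_) _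
      cases σ z
      · simpa [S, Set.sdiff_eq] using (measure_inter_add_sdiff (D z) (hGω ω)).ge
      · simpa [S, Set.sdiff_eq, add_comm] using (measure_inter_add_sdiff (D z) (hGω ω)).ge
    simp only [Function.update_self]
    set σ' := Function.update σ z (!σ z) with hσ'
    rw [hprod, hprod, lintegral_withDensity_eq_lintegral_mul _ (hdm _) (ham _ _),
      lintegral_withDensity_eq_lintegral_mul _ (hdm _) (ham _ _),
      ← lintegral_add_left ((hdm _).mul (ham _ _))]
    calc ENNReal.ofReal b * V * 8⁻¹
        ≤ ENNReal.ofReal b * V * ∫⁻ ω, min (∏ i, ENNReal.ofReal (p σ (ω i)))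
            (∏ i, ENNReal.ofReal (p σ' (ω i))) ∂ν := mul_le_mul_right (haff σ z) _
      _ = ∫⁻ ω, ENNReal.ofReal b * V * min (∏ i, ENNReal.ofReal (p σ (ω i)))
            (∏ i, ENNReal.ofReal (p σ' (ω i))) ∂ν :=
          (lintegral_const_mul _ ((hdm _).min (hdm _))).symm
      _ ≤ _ := by
          refine lintegral_mono fun ω => ?_
          simp only [Pi.mul_apply]
          refine (mul_le_mul_left (hsum ω) _).trans ?_
          rw [add_mul, mul_comm, mul_comm (a (!σ z) z ω)]
          exact add_le_add (mul_le_mul_left (min_le_left _ _) _)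
            (mul_le_mul_left (min_le_right _ _) _)

end Assouad

section MarginExponent

variable {d : ℕ}

/-- The `γ`-exponent condition at level `0` with respect to Lebesgue measure. -/
def HasExponent (γ : ℝ) (f : EuclideanSpace ℝ (Fin d) → ℝ) : Prop :=
  ∃ c₀ > (0 : ℝ), ∃ ε₀ > (0 : ℝ), ∀ ε : ℝ, 0 < ε → ε ≤ ε₀ →
    volume {x | 0 < |f x| ∧ |f x| ≤ ε} ≤ ENNReal.ofReal (c₀ * ε ^ γ)

theorem hasExponent_zero (γ : ℝ) : HasExponent γ (fun _ : EuclideanSpace ℝ (Fin d) => 0) := by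
  refine ⟨1, one_pos, 1, one_pos, fun ε _ _ => ?_⟩
  simp

theorem HasExponent.add {γ : ℝ} {f g : EuclideanSpace ℝ (Fin d) → ℝ} (hf : HasExponent γ f)
    (hg : HasExponent γ g) (hfg : ∀ x, f x = 0 ∨ g x = 0) :
    HasExponent γ (fun x => f x + g x) := by
  obtain ⟨c, hc, ε₀, hε₀, h⟩ := hf
  obtain ⟨c', hc', ε₀', hε₀', h'⟩ := hg
  refine ⟨c + c', by positivity, min ε₀ ε₀', lt_min hε₀ hε₀', fun ε hε hle => ?_⟩
  have hsub : {x | 0 < |f x + g x| ∧ |f x + g x| ≤ ε} ⊆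
      {x | 0 < |f x| ∧ |f x| ≤ ε} ∪ {x | 0 < |g x| ∧ |g x| ≤ ε} := by
    rintro x ⟨h1, h2⟩
    rcases hfg x with h0 | h0
    · exact Or.inr (by simpa [h0] using And.intro h1 h2)
    · exact Or.inl (by simpa [h0] using And.intro h1 h2)
  refine (measure_mono hsub).trans ((measure_union_le _ _).trans ?_)
  rw [add_mul, ENNReal.ofReal_add (by positivity) (by positivity)]
  exact add_le_add (h ε hε (hle.trans (min_le_left _ _))) (h' ε hε (hle.trans (min_le_right _ _)))

theorem HasExponent.sum {γ : ℝ} {ι : Type*} (s : Finset ι)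
    {f : ι → EuclideanSpace ℝ (Fin d) → ℝ} (hf : ∀ i ∈ s, HasExponent γ (f i))
    (hd : ∀ x, ∀ i ∈ s, ∀ j ∈ s, i ≠ j → f i x = 0 ∨ f j x = 0) :
    HasExponent γ (fun x => ∑ i ∈ s, f i x) := by
  classical
  induction s using Finset.induction_on with
  | empty => simpa using hasExponent_zero γ
  | insert i s hi ih =>
    simp only [Finset.sum_insert hi]
    refine (hf i (Finset.mem_insert_self _ _)).add
      (ih (fun j hj => hf j (Finset.mem_insert_of_mem hj)) fun x j hj k hk =>
        hd x j (Finset.mem_insert_of_mem hj) k (Finset.mem_insert_of_mem hk)) fun x => ?_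
    by_cases h0 : f i x = 0
    · exact Or.inl h0
    · refine Or.inr (Finset.sum_eq_zero fun j hj => ?_)
      exact (hd x i (Finset.mem_insert_self _ _) j (Finset.mem_insert_of_mem hj)
        (by rintro rfl; exact hi hj)).resolve_left h0

theorem addHaar_preimage_affine {b : ℝ} (hb : 0 < b) (z : EuclideanSpace ℝ (Fin d))
    (s : Set (EuclideanSpace ℝ (Fin d))) :
    volume ((fun x => b • x - z) ⁻¹' s) = ENNReal.ofReal ((b ^ d)⁻¹) * volume s := by
  have : (fun x : EuclideanSpace ℝ (Fin d) => b • x - z) ⁻¹' s =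
      (fun x => b • x) ⁻¹' ((fun x => x + -z) ⁻¹' s) := by
    ext x; simp [sub_eq_add_neg]
  rw [this, Measure.addHaar_preimage_smul _ hb.ne', measure_preimage_add_right,
    finrank_euclideanSpace_fin,
    abs_of_pos (by positivity)]

theorem HasExponent.comp_affine {γ : ℝ} {f : EuclideanSpace ℝ (Fin d) → ℝ}
    (hf : HasExponent γ f) {κ b : ℝ} (hκ : κ ≠ 0) (hb : 0 < b) (z : EuclideanSpace ℝ (Fin d)) :
    HasExponent γ (fun x => κ * f (b • x - z)) := by
  obtain ⟨c, hc, ε₀, hε₀, h⟩ := hf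
  have hκ' : 0 < |κ| := abs_pos.2 hκ
  refine ⟨(b ^ d)⁻¹ * (c * (|κ|⁻¹) ^ γ), by positivity, |κ| * ε₀, by positivity,
    fun ε hε hle => ?_⟩
  have hset : {x | 0 < |κ * f (b • x - z)| ∧ |κ * f (b • x - z)| ≤ ε} =
      (fun x => b • x - z) ⁻¹' {x | 0 < |f x| ∧ |f x| ≤ |κ|⁻¹ * ε} := by
    ext x
    simp only [abs_mul, Set.mem_ofPred_eq, Set.mem_preimage, mul_pos_iff_of_pos_left hκ',
      le_inv_mul_iff₀ hκ']
  rw [hset, addHaar_preimage_affine hb, mul_assoc, ENNReal.ofReal_mul (by positivity)]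
  refine mul_le_mul_right ((h _ (by positivity) ?_).trans_eq ?_) _
  · rwa [inv_mul_le_iff₀ hκ']
  · rw [Real.mul_rpow (by positivity) hε.le, mul_assoc]

/-- Almost every level of a measurable function is approached linearly in measure. -/
theorem ae_exists_measure_abs_sub_le {f : EuclideanSpace ℝ (Fin d) → ℝ} (hf : Measurable f)
    {K : Set (EuclideanSpace ℝ (Fin d))} (hK : MeasurableSet K) (hKf : volume K ≠ ∞) :
    ∀ᵐ t : ℝ, ∃ C > (0 : ℝ), ∃ ε₀ > (0 : ℝ), ∀ ε : ℝ, 0 < ε → ε ≤ ε₀ →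
      volume ({x | |f x - t| ≤ ε} ∩ K) ≤ ENNReal.ofReal (C * ε) := by
  let G : ℝ → ℝ := fun t => volume.real ({x | f x ≤ t} ∩ K)
  have hfin : ∀ s, volume (s ∩ K) ≠ ∞ := fun s =>
    measure_ne_top_of_subset Set.inter_subset_right hKf
  have hG : Monotone G := fun s t hst =>
    measureReal_mono (Set.inter_subset_inter_left _ fun x hx => le_trans hx hst) (hfin _)
  filter_upwards [hG.ae_differentiableAt] with t ht
  obtain ⟨C, hC, hO⟩ := ht.isBigO_sub.exists_pos
  obtain ⟨δ, hδ, hb⟩ := Metric.eventually_nhds_iff.1 hO.bound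
  refine ⟨3 * C, by positivity, δ / 3, by positivity, fun ε hε hle => ?_⟩
  have h1 := hb (y := t + ε) (by rw [Real.dist_eq, add_sub_cancel_left, abs_of_pos hε]; linarith)
  have h2 := hb (y := t - 2 * ε) (by
    rw [Real.dist_eq, show t - 2 * ε - t = -(2 * ε) by ring, abs_neg, abs_of_pos (by positivity)]
    linarith)
  rw [show t + ε - t = ε by ring, Real.norm_eq_abs, Real.norm_eq_abs, abs_of_pos hε] at h1
  rw [show t - 2 * ε - t = -(2 * ε) by ring, Real.norm_eq_abs, norm_neg, Real.norm_eq_abs,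
    abs_of_pos (show 0 < 2 * ε by positivity)] at h2
  have h3 : volume.real ({x | |f x - t| ≤ ε} ∩ K) ≤ G (t + ε) - G (t - 2 * ε) := by
    have hm : MeasurableSet ({x | f x ≤ t - 2 * ε} ∩ K) :=
      (measurableSet_le hf measurable_const).inter hK
    have hs : {x | f x ≤ t - 2 * ε} ∩ K ⊆ {x | f x ≤ t + ε} ∩ K :=
      Set.inter_subset_inter_left _ fun x (hx : f x ≤ _) => hx.trans (by linarith)
    have := measureReal_sdiff hs hm (hfin _)
    simp only [G]
    rw [← this]
    refine measureReal_mono ?_ (measure_ne_top_of_subset Set.sdiff_subset (hfin _))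
    rintro x ⟨hx, hxK⟩
    have hx' := abs_le.1 (show |f x - t| ≤ ε from hx)
    refine ⟨⟨show f x ≤ t + ε by linarith, hxK⟩, fun hx2 => ?_⟩
    have : f x ≤ t - 2 * ε := hx2.1
    linarith
  rw [← ofReal_measureReal (hfin _)]
  refine ENNReal.ofReal_le_ofReal (h3.trans ?_)
  have := (abs_le.1 h1).2
  have := (abs_le.1 h2).1
  linarith

theorem hasExponent_of_abs_sub_le {β γ : ℝ} (hβ : 0 < β) (hγβ : γ * β ≤ 1)
    {f g : EuclideanSpace ℝ (Fin d) → ℝ} {K : Set (EuclideanSpace ℝ (Fin d))} {t : ℝ}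
    (ht : ∃ C > (0 : ℝ), ∃ ε₀ > (0 : ℝ), ∀ ε : ℝ, 0 < ε → ε ≤ ε₀ →
      volume ({x | |f x - t| ≤ ε} ∩ K) ≤ ENNReal.ofReal (C * ε))
    (hg : ∀ x, 0 < |g x| → |g x| ≤ 1 / 4 → x ∈ K ∧ |f x - t| ≤ |g x| ^ β⁻¹) :
    HasExponent γ g := by
  obtain ⟨C, hC, ε₀, hε₀, h⟩ := ht
  refine ⟨C, hC, min (1 / 4) (ε₀ ^ β), by positivity, fun ε hε hle => ?_⟩
  have h1 : ε ≤ 1 / 4 := hle.trans (min_le_left _ _)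
  have h2 : ε ^ β⁻¹ ≤ ε₀ := by
    rw [Real.rpow_inv_le_iff_of_pos hε.le hε₀.le hβ]
    exact hle.trans (min_le_right _ _)
  have hsub : {x | 0 < |g x| ∧ |g x| ≤ ε} ⊆ {x | |f x - t| ≤ ε ^ β⁻¹} ∩ K := by
    rintro x ⟨hx0, hx⟩
    obtain ⟨hK, hx'⟩ := hg x hx0 (hx.trans h1)
    exact ⟨hx'.trans (Real.rpow_le_rpow hx0.le hx (by positivity)), hK⟩
  refine (measure_mono hsub).trans ((h _ (by positivity) h2).trans (ENNReal.ofReal_le_ofReal ?_))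
  refine mul_le_mul_of_nonneg_left ?_ hC.le
  refine Real.rpow_le_rpow_of_exponent_ge hε (by linarith) ?_
  rwa [← one_div, le_div_iff₀ hβ]

end MarginExponent

section Perturbation

variable {d N : ℕ}

/-- A point of `{0, …, N - 1}^d`, seen in Euclidean space. -/
noncomputable def latticePoint (z : Fin d → Fin N) : EuclideanSpace ℝ (Fin d) :=
  WithLp.toLp 2 fun i => ((z i : ℕ) : ℝ)

theorem norm_latticePoint_le (z : Fin d → Fin N) : ‖latticePoint z‖ ≤ d * N := by
  rw [EuclideanSpace.norm_eq]
  refine Real.sqrt_le_iff.2 ⟨by positivity, ?_⟩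
  calc ∑ i, ‖latticePoint z i‖ ^ 2 ≤ ∑ _i : Fin d, (N : ℝ) ^ 2 := by
        refine Finset.sum_le_sum fun i _ => ?_
        simp only [latticePoint, Real.norm_natCast]
        have : ((z i : ℕ) : ℝ) ≤ N := by exact_mod_cast (z i).2.le
        gcongr
    _ = d * N ^ 2 := by simp
    _ ≤ (d * N) ^ 2 := by
        rw [mul_pow]
        gcongr
        exact_mod_cast Nat.le_self_pow two_ne_zero d

theorem latticePoint_eq_of_norm_sub_lt {z z' : Fin d → Fin N}
    (h : ‖latticePoint z - latticePoint z'‖ < 1) : z = z' := by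
  funext i
  have h1 := (PiLp.norm_apply_le (latticePoint z - latticePoint z') i).trans_lt h
  simp only [latticePoint, PiLp.sub_apply, Real.norm_eq_abs] at h1
  have h2 : |((z i : ℕ) : ℤ) - ((z' i : ℕ) : ℤ)| < 1 := by exact_mod_cast h1
  have := Int.abs_lt_one_iff.1 h2
  exact Fin.ext (by omega)

theorem eq_of_mem_cell {y : EuclideanSpace ℝ (Fin d)} {z z' : Fin d → Fin N}
    (h : ‖y - latticePoint z‖ ≤ 3 / 8) (h' : ‖y - latticePoint z'‖ ≤ 3 / 8) : z = z' := by
  refine latticePoint_eq_of_norm_sub_lt ?_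
  have := norm_sub_le (y - latticePoint z') (y - latticePoint z)
  rw [_root_.sub_sub_sub_cancel_left] at this
  linarith

theorem norm_le_of_mem_cell (hN : 0 < N) {x : EuclideanSpace ℝ (Fin d)} {z : Fin d → Fin N}
    (h : ‖(N : ℝ) • x - latticePoint z‖ ≤ 3 / 8) : ‖x‖ ≤ d + 1 := by
  have h1 := norm_le_norm_add_norm_sub' ((N : ℝ) • x) (latticePoint z)
  have h2 := norm_latticePoint_le z
  rw [norm_smul, Real.norm_natCast] at h1
  have h3 : (1 : ℝ) ≤ N := by exact_mod_cast hN
  by_contra! hlt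
  nlinarith

/-- The sign `±1` attached to a Boolean. -/
def boolSign (s : Bool) : ℝ := if s then 1 else -1

theorem abs_boolSign (s : Bool) : |boolSign s| = 1 := by cases s <;> simp [boolSign]

/-- The base function `B` perturbed by `±α` times a rescaled copy of the bump `φ` around each
point of the lattice `N⁻¹{0, …, N - 1}^d`. -/
noncomputable def perturb (B φ : EuclideanSpace ℝ (Fin d) → ℝ) (α : ℝ)
    (σ : (Fin d → Fin N) → Bool) (x : EuclideanSpace ℝ (Fin d)) : ℝ :=
  B x + α * ∑ z, boolSign (σ z) * φ ((N : ℝ) • x - latticePoint z)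

/-- The requirements on a base function `B` and a bump `φ`. -/
structure IsProfile (β L : ℝ) (B φ : EuclideanSpace ℝ (Fin d) → ℝ) : Prop where
  holder_base : GlobalHolder β L B
  holder_bump : GlobalHolder β L φ
  const_pos : 0 < L
  base_nonneg : ∀ x, 0 ≤ B x
  base_le_one : ∀ x, B x ≤ 1
  base_eq_one : ∀ x, ‖x‖ ≤ d + 1 → B x = 1
  base_support : HasCompactSupport B
  bump_support : tsupport φ ⊆ Metric.closedBall 0 (3 / 8)
  bump_abs_le : ∀ x, |φ x| ≤ 1
  bump_integral : ∫ x, φ x = 0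

namespace IsProfile

variable {β L α : ℝ} {B φ : EuclideanSpace ℝ (Fin d) → ℝ}

theorem continuous_base (h : IsProfile β L B φ) : Continuous B := h.holder_base.1.continuous

theorem continuous_bump (h : IsProfile β L B φ) : Continuous φ := h.holder_bump.1.continuous

theorem bump_eq_zero (h : IsProfile β L B φ) {y : EuclideanSpace ℝ (Fin d)} (hy : 3 / 8 < ‖y‖) :
    φ y = 0 := by
  by_contra hne
  have := h.bump_support (subset_tsupport φ hne)
  rw [mem_closedBall_zero_iff] at this
  linarith

theorem perturb_of_mem_cell (h : IsProfile β L B φ) (hN : 0 < N)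
    (σ : (Fin d → Fin N) → Bool) {x : EuclideanSpace ℝ (Fin d)} {z : Fin d → Fin N}
    (hx : ‖(N : ℝ) • x - latticePoint z‖ ≤ 3 / 8) :
    perturb B φ α σ x = 1 + α * (boolSign (σ z) * φ ((N : ℝ) • x - latticePoint z)) := by
  rw [perturb, h.base_eq_one x (norm_le_of_mem_cell hN hx), Finset.sum_eq_single z]
  · intro z' _ hz'
    rw [h.bump_eq_zero, mul_zero]
    by_contra! hle
    exact hz' (eq_of_mem_cell hle hx)
  · simp

theorem perturb_of_notMem_cell (h : IsProfile β L B φ) (σ : (Fin d → Fin N) → Bool)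
    {x : EuclideanSpace ℝ (Fin d)} (hx : ∀ z : Fin d → Fin N,
      3 / 8 < ‖(N : ℝ) • x - latticePoint z‖) :
    perturb B φ α σ x = B x := by
  rw [perturb, Finset.sum_eq_zero fun z _ => by rw [h.bump_eq_zero (hx z), mul_zero]]
  simp

theorem perturb_update (h : IsProfile β L B φ) (σ : (Fin d → Fin N) → Bool) (z : Fin d → Fin N)
    (s : Bool) {x : EuclideanSpace ℝ (Fin d)}
    (hx : 3 / 8 < ‖(N : ℝ) • x - latticePoint z‖) :
    perturb B φ α (Function.update σ z s) x = perturb B φ α σ x := by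
  unfold perturb
  congr 2
  refine Finset.sum_congr rfl fun z' _ => ?_
  rcases eq_or_ne z' z with rfl | hne
  · rw [h.bump_eq_zero hx, mul_zero, mul_zero]
  · rw [Function.update_of_ne hne]

theorem abs_perturb_sub_le (h : IsProfile β L B φ) (hN : 0 < N) (hα : 0 ≤ α)
    (σ : (Fin d → Fin N) → Bool) (x : EuclideanSpace ℝ (Fin d)) :
    |perturb B φ α σ x - B x| ≤ α := by
  by_cases hx : ∃ z : Fin d → Fin N, ‖(N : ℝ) • x - latticePoint z‖ ≤ 3 / 8
  · obtain ⟨z, hz⟩ := hx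
    rw [h.perturb_of_mem_cell hN σ hz, h.base_eq_one x (norm_le_of_mem_cell hN hz),
      add_sub_cancel_left, abs_mul, abs_mul, abs_boolSign, one_mul, abs_of_nonneg hα]
    exact mul_le_of_le_one_right hα (h.bump_abs_le _)
  · push Not at hx
    rw [h.perturb_of_notMem_cell σ hx, sub_self, abs_zero]
    exact hα

theorem base_ne_zero (h : IsProfile β L B φ) (hN : 0 < N) {σ : (Fin d → Fin N) → Bool}
    {x : EuclideanSpace ℝ (Fin d)} (hx : perturb B φ α σ x ≠ 0) : B x ≠ 0 := by
  by_cases hx' : ∃ z : Fin d → Fin N, ‖(N : ℝ) • x - latticePoint z‖ ≤ 3 / 8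
  · obtain ⟨z, hz⟩ := hx'
    rw [h.base_eq_one x (norm_le_of_mem_cell hN hz)]
    exact one_ne_zero
  · push Not at hx'
    rwa [← h.perturb_of_notMem_cell (α := α) σ hx']

theorem perturb_nonneg (h : IsProfile β L B φ) (hN : 0 < N) (hα : |α| ≤ 1)
    (σ : (Fin d → Fin N) → Bool) (x : EuclideanSpace ℝ (Fin d)) : 0 ≤ perturb B φ α σ x := by
  by_cases hx : ∃ z : Fin d → Fin N, ‖(N : ℝ) • x - latticePoint z‖ ≤ 3 / 8
  · obtain ⟨z, hz⟩ := hx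
    rw [h.perturb_of_mem_cell hN σ hz]
    have : |α * (boolSign (σ z) * φ ((N : ℝ) • x - latticePoint z))| ≤ 1 := by
      rw [abs_mul, abs_mul, abs_boolSign, one_mul]
      exact mul_le_one₀ hα (abs_nonneg _) (h.bump_abs_le _)
    linarith [(abs_le.1 this).1]
  · push Not at hx
    rw [h.perturb_of_notMem_cell σ hx]
    exact h.base_nonneg x

theorem hasCompactSupport_perturb (h : IsProfile β L B φ) (hN : 0 < N)
    (σ : (Fin d → Fin N) → Bool) : HasCompactSupport (perturb B φ α σ) :=
  h.base_support.mono fun _ hx => h.base_ne_zero hN hx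

theorem globalHolder_perturb (h : IsProfile β L B φ) (hN : 0 < N) (σ : (Fin d → Fin N) → Bool) :
    GlobalHolder β (L + |α| * (2 * (L * (N : ℝ) ^ β))) (perturb B φ α σ) := by
  refine h.holder_base.add (GlobalHolder.const_mul ?_ α)
  have hL := h.const_pos
  refine GlobalHolder.sum_of_disjoint Finset.univ (fun z _ => (abs_boolSign _).le)
    (u := fun z y => φ ((N : ℝ) • y - latticePoint z))
    (fun z _ => h.holder_bump.comp_affine (by positivity) _) (by positivity) ?_
  have hsupp : ∀ (x : EuclideanSpace ℝ (Fin d)) (z : Fin d → Fin N),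
      x ∈ tsupport (fun y => φ ((N : ℝ) • y - latticePoint z)) →
      ‖(N : ℝ) • x - latticePoint z‖ ≤ 3 / 8 := by
    intro x z hx
    have hcl : IsClosed {x : EuclideanSpace ℝ (Fin d) |
        ‖(N : ℝ) • x - latticePoint z‖ ≤ 3 / 8} :=
      isClosed_le (by fun_prop) continuous_const
    refine closure_minimal (fun y hy => ?_) hcl hx
    by_contra hlt
    exact hy (h.bump_eq_zero (not_le.1 hlt))
  intro x z _ z' _ hz hz'
  exact eq_of_mem_cell (hsupp x z hz) (hsupp x z' hz')

theorem continuous_perturb (h : IsProfile β L B φ) (hN : 0 < N) (σ : (Fin d → Fin N) → Bool) :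
    Continuous (perturb B φ α σ) :=
  (h.globalHolder_perturb hN σ).1.continuous

theorem integral_perturb (h : IsProfile β L B φ) (hN : 0 < N) (σ : (Fin d → Fin N) → Bool) :
    ∫ x, perturb B φ α σ x = ∫ x, B x := by
  have hφ : HasCompactSupport φ :=
    HasCompactSupport.of_support_subset_isCompact (isCompact_closedBall 0 (3 / 8))
      ((subset_tsupport φ).trans h.bump_support)
  have hN' : (N : ℝ) ≠ 0 := by exact_mod_cast hN.ne'
  have hi : Integrable φ := h.continuous_bump.integrable_of_hasCompactSupport hφ
  have hint : ∀ z : Fin d → Fin N,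
      Integrable fun x : EuclideanSpace ℝ (Fin d) => φ ((N : ℝ) • x - latticePoint z) :=
    fun z => (hi.comp_sub_right (latticePoint z)).comp_smul hN'
  have hz : ∀ z : Fin d → Fin N, ∫ x, φ ((N : ℝ) • x - latticePoint z) = 0 := fun z => by
    rw [Measure.integral_comp_smul volume (fun x => φ (x - latticePoint z)),
      integral_sub_right_eq_self, h.bump_integral, smul_zero]
  unfold perturb
  rw [integral_add (h.continuous_base.integrable_of_hasCompactSupport h.base_support)
    ((integrable_finsetSum _ fun z _ => (hint z).const_mul _).const_mul _),
    integral_const_mul, integral_finsetSum _ fun z _ => (hint z).const_mul _]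
  simp [integral_const_mul, hz]

end IsProfile

end Perturbation

section Profiles

variable {d : ℕ}

/-- The difference of two copies of `w` centered at `v` and `-v`. -/
def dipole (w : EuclideanSpace ℝ (Fin d) → ℝ) (v x : EuclideanSpace ℝ (Fin d)) : ℝ :=
  w (x - v) + -1 * w (x + v)

theorem dipole_eq_zero {w : EuclideanSpace ℝ (Fin d) → ℝ} {v : EuclideanSpace ℝ (Fin d)}
    (hv : ‖v‖ = 1 / 4) (hws : ∀ x, 1 / 8 ≤ ‖x‖ → w x = 0) (x : EuclideanSpace ℝ (Fin d)) :
    w (x - v) = 0 ∨ w (x + v) = 0 := by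
  by_contra! hne
  have h1 := lt_of_not_ge fun hle => hne.1 (hws _ hle)
  have h2 := lt_of_not_ge fun hle => hne.2 (hws _ hle)
  have h3 := norm_sub_le (x + v) (x - v)
  rw [show x + v - (x - v) = (2 : ℝ) • v by rw [two_smul]; abel, norm_smul, hv] at h3
  norm_num at h3
  linarith

theorem le_dipole {w : EuclideanSpace ℝ (Fin d) → ℝ} {v : EuclideanSpace ℝ (Fin d)}
    (hv : ‖v‖ = 1 / 4) (hws : ∀ x, 1 / 8 ≤ ‖x‖ → w x = 0) {c s : ℝ} (hc : 0 < c)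
    (hw : ∀ x, ‖x‖ < s → c ≤ w x) {x : EuclideanSpace ℝ (Fin d)} (hx : ‖x - v‖ < s) :
    c ≤ dipole w v x := by
  have h1 := hw _ hx
  rw [dipole, (dipole_eq_zero hv hws x).resolve_left (hc.trans_le h1).ne']
  linarith

theorem isProfile_dipole {β L : ℝ} {B w : EuclideanSpace ℝ (Fin d) → ℝ}
    {v : EuclideanSpace ℝ (Fin d)} (hv : ‖v‖ = 1 / 4) (hL : 0 < L) (hB : GlobalHolder β L B)
    (hw : GlobalHolder β L w) (hB0 : ∀ x, 0 ≤ B x) (hB1 : ∀ x, B x ≤ 1)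
    (hBd : ∀ x, ‖x‖ ≤ d + 1 → B x = 1) (hBs : HasCompactSupport B) (hw0 : ∀ x, 0 ≤ w x)
    (hw1 : ∀ x, w x ≤ 1) (hws : ∀ x, 1 / 8 ≤ ‖x‖ → w x = 0) :
    IsProfile β (2 * L) B (dipole w v) where
  holder_base := hB.mono (by linarith)
  holder_bump := by
    have h1 := hw.comp_affine zero_le_one v
    have h2 := (hw.comp_affine zero_le_one (-v)).const_mul (-1)
    simp only [one_smul, sub_neg_eq_add, Real.one_rpow, mul_one, abs_neg, abs_one, one_mul]
      at h1 h2
    exact two_mul L ▸ h1.add h2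
  const_pos := by positivity
  base_nonneg := hB0
  base_le_one := hB1
  base_eq_one := hBd
  base_support := hBs
  bump_support := by
    refine closure_minimal (fun x hx => ?_) Metric.isClosed_closedBall
    rw [mem_closedBall_zero_iff]
    by_contra! hlt
    have h1 := norm_sub_norm_le x v
    have h2 := norm_sub_norm_le x (-v)
    rw [norm_neg, sub_neg_eq_add] at h2
    refine hx ?_
    rw [dipole, hws _ (by linarith), hws _ (by linarith)]
    simp
  bump_abs_le := fun x => by
    rw [dipole, abs_le]
    constructor <;> linarith [hw0 (x - v), hw0 (x + v), hw1 (x - v), hw1 (x + v)]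
  bump_integral := by
    have hws' : HasCompactSupport w := by
      refine HasCompactSupport.of_support_subset_isCompact (isCompact_closedBall 0 (1 / 8))
        fun x hx => ?_
      rw [mem_closedBall_zero_iff]
      by_contra! hlt
      exact hx (hws x hlt.le)
    have hi : Integrable w := hw.1.continuous.integrable_of_hasCompactSupport hws'
    unfold dipole
    rw [integral_add (hi.comp_sub_right v) ((hi.comp_add_right v).const_mul _),
      integral_const_mul, integral_sub_right_eq_self, integral_add_right_eq_self]
    ring

theorem exists_norm_eq_quarter (hd : 0 < d) : ∃ v : EuclideanSpace ℝ (Fin d), ‖v‖ = 1 / 4 :=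
  ⟨EuclideanSpace.single ⟨0, hd⟩ (1 / 4), by rw [PiLp.norm_single]; norm_num⟩

theorem exists_mem_of_ae {P : ℝ → Prop} (h : ∀ᵐ t, P t) {a b : ℝ} (hab : a < b) :
    ∃ t, a < t ∧ t < b ∧ P t := by
  obtain ⟨t, ht, hP⟩ := (Measure.dense_of_ae h).exists_mem_open isOpen_Ioo (Set.nonempty_Ioo.2 hab)
  exact ⟨t, hP.1, hP.2, ht⟩

theorem abs_rpow_sub_rpow_le_s11 {β : ℝ} (hβ : 0 < β) (hβ1 : β ≤ 1) {a b : ℝ} (ha : 0 ≤ a)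
    (hb : 0 ≤ b) : |a ^ β - b ^ β| ≤ |a - b| ^ β := by
  wlog hab : b ≤ a generalizing a b
  · rw [abs_sub_comm, abs_sub_comm a]
    exact this hb ha (le_of_not_ge hab)
  rw [abs_of_nonneg (sub_nonneg.2 (Real.rpow_le_rpow hb hab hβ.le)), abs_of_nonneg (by linarith)]
  have := Real.rpow_add_le_add_rpow (sub_nonneg.2 hab) hb hβ.le hβ1
  rw [sub_add_cancel] at this
  linarith

/-- All the properties of the base function, of the bump and of the perturbed functions that the
lower bound uses. -/
def ExistsProfile (d : ℕ) (β γ : ℝ) : Prop :=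
  ∃ (B φ : EuclideanSpace ℝ (Fin d) → ℝ) (L c s : ℝ) (v : EuclideanSpace ℝ (Fin d)),
    IsProfile β L B φ ∧ 0 < c ∧ 0 < s ∧ s ≤ 1 / 8 ∧ ‖v‖ = 1 / 4 ∧
    (∀ x, ‖x - v‖ < s → c ≤ φ x) ∧
    ∀ (N : ℕ) (α δ : ℝ), 0 < N → 0 < α → 0 < δ → ∃ t, |t| ≤ δ ∧
      ∀ σ : (Fin d → Fin N) → Bool, HasExponent γ fun x => perturb B φ α σ x - (1 + t)

theorem IsProfile.exists_level {β γ L α δ : ℝ} {N : ℕ} {B φ : EuclideanSpace ℝ (Fin d) → ℝ}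
    (h : IsProfile β L B φ) (hγ : γ ≤ 1) (hN : 0 < N) (hδ : 0 < δ) :
    ∃ t, |t| ≤ δ ∧ ∀ σ : (Fin d → Fin N) → Bool,
      HasExponent γ fun x => perturb B φ α σ x - (1 + t) := by
  have hK : IsCompact (tsupport B) := h.base_support
  have hae := ae_all_iff.2 fun σ : (Fin d → Fin N) → Bool =>
    ae_exists_measure_abs_sub_le (h.continuous_perturb (α := α) hN σ).measurable
      hK.measurableSet hK.measure_lt_top.ne
  set δ' := min δ (1 / 2) with hδ'
  have h0 : 0 < δ' := by positivity
  obtain ⟨l, hl1, hl2, hl⟩ := exists_mem_of_ae hae (show 1 - δ' < 1 + δ' by linarith)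
  have h1 : δ' ≤ δ := min_le_left _ _
  have h2 : δ' ≤ 1 / 2 := min_le_right _ _
  refine ⟨l - 1, abs_le.2 ⟨by linarith, by linarith⟩, fun σ => ?_⟩
  refine hasExponent_of_abs_sub_le one_pos (by linarith) (hl σ) fun x _ hx => ⟨?_, ?_⟩
  · refine subset_tsupport B (h.base_ne_zero (α := α) (σ := σ) hN fun h0 => ?_)
    rw [h0] at hx
    linarith [neg_abs_le (0 - (1 + (l - 1)))]
  · simp

theorem existsProfile_of_one_le (hd : 0 < d) {β γ : ℝ} (hβ : 1 ≤ β) (hγ : 0 < γ)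
    (hγβ : γ * β ≤ 1) : ExistsProfile d β γ := by
  obtain ⟨v, hv⟩ := exists_norm_eq_quarter hd
  let B : ContDiffBump (0 : EuclideanSpace ℝ (Fin d)) :=
    ⟨d + 1, d + 2, by positivity, by linarith⟩
  let w : ContDiffBump (0 : EuclideanSpace ℝ (Fin d)) :=
    ⟨1 / 16, 1 / 8, by positivity, by norm_num⟩
  obtain ⟨L₁, hL₁, hB⟩ := B.contDiff.exists_globalHolder (β := β) (by linarith) B.hasCompactSupport
  obtain ⟨L₂, hL₂, hw⟩ := w.contDiff.exists_globalHolder (β := β) (by linarith) w.hasCompactSupport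
  have hws : ∀ x, 1 / 8 ≤ ‖x‖ → w x = 0 := fun x hx =>
    w.zero_of_le_dist (by simpa only [dist_zero_right] using hx)
  have hp := isProfile_dipole hv (add_pos hL₁ hL₂) (hB.mono (by linarith)) (hw.mono (by linarith))
    (fun x => B.nonneg) (fun x => B.le_one)
    (fun x hx => B.one_of_mem_closedBall (by simpa using hx)) B.hasCompactSupport
    (fun x => w.nonneg) (fun x => w.le_one) hws
  refine ⟨B, dipole w v, 2 * (L₁ + L₂), 1, 1 / 16, v, hp, one_pos, by norm_num, by norm_num, hv,
    fun x hx => le_dipole hv hws one_pos (fun y hy => ?_) hx,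
    fun N α δ hN _ hδ => hp.exists_level (by nlinarith) hN hδ⟩
  exact (w.one_of_mem_closedBall (mem_closedBall_zero_iff.2 hy.le)).ge

theorem existsProfile_of_lt_one (hd : 0 < d) {β γ : ℝ} (hβ : 0 < β) (hβ1 : β < 1)
    (hγβ : γ * β ≤ 1) : ExistsProfile d β γ := by
  obtain ⟨v, hv⟩ := exists_norm_eq_quarter hd
  have hae : ∀ r : ℝ, ∀ᵐ t : ℝ, ∃ C > (0 : ℝ), ∃ ε₀ > (0 : ℝ), ∀ ε : ℝ, 0 < ε → ε ≤ ε₀ →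
      volume ({x : EuclideanSpace ℝ (Fin d) | |‖x‖ - t| ≤ ε} ∩ Metric.closedBall 0 r) ≤
        ENNReal.ofReal (C * ε) := fun r =>
    ae_exists_measure_abs_sub_le measurable_norm measurableSet_closedBall
      measure_closedBall_lt_top.ne
  obtain ⟨s, hs1, hs2, hs⟩ := exists_mem_of_ae (hae 1) (show (1 / 16 : ℝ) < 1 / 8 by norm_num)
  obtain ⟨R, hR1, hR2, hR⟩ := exists_mem_of_ae (hae (d + 3))
    (show (d + 1 : ℝ) < d + 2 by linarith)
  let w : EuclideanSpace ℝ (Fin d) → ℝ := fun x => max (s - ‖x‖) 0 ^ β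
  let B : EuclideanSpace ℝ (Fin d) → ℝ := fun x => 1 - min 1 (max (‖x‖ - R) 0) ^ β
  have hw : GlobalHolder β 1 w := by
    refine globalHolder_of_lt_one hβ1 ?_ fun x₀ x => ?_
    · exact Continuous.rpow_const (by fun_prop) fun _ => Or.inr hβ.le
    · rw [one_mul]
      refine (abs_rpow_sub_rpow_le_s11 hβ hβ1.le (le_max_right _ _) (le_max_right _ _)).trans
        (Real.rpow_le_rpow (abs_nonneg _) ?_ hβ.le)
      refine (abs_max_sub_max_le_abs _ _ _).trans ?_
      rw [_root_.sub_sub_sub_cancel_left, norm_sub_rev]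
      exact abs_norm_sub_norm_le _ _
  have hB : GlobalHolder β 1 B := by
    refine globalHolder_of_lt_one hβ1 ?_ fun x₀ x => ?_
    · exact continuous_const.sub (Continuous.rpow_const (by fun_prop) fun _ => Or.inr hβ.le)
    · rw [one_mul]
      simp only [B, _root_.sub_sub_sub_cancel_left]
      rw [abs_sub_comm]
      refine (abs_rpow_sub_rpow_le_s11 hβ hβ1.le (by positivity) (by positivity)).trans
        (Real.rpow_le_rpow (abs_nonneg _) ?_ hβ.le)
      refine (abs_min_sub_min_le_max _ _ _ _).trans ?_
      rw [sub_self, abs_zero, max_eq_right (abs_nonneg _)]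
      refine (abs_max_sub_max_le_abs _ _ _).trans ?_
      rw [sub_sub_sub_cancel_right]
      exact abs_norm_sub_norm_le _ _
  have hws' : ∀ x, s ≤ ‖x‖ → w x = 0 := fun x hx => by
    simp [w, max_eq_right (sub_nonpos.2 hx), hβ.ne']
  have hws : ∀ x, 1 / 8 ≤ ‖x‖ → w x = 0 := fun x hx => hws' x (by linarith)
  have hBR : ∀ x, ‖x‖ ≤ R → B x = 1 := fun x hx => by
    simp [B, max_eq_right (sub_nonpos.2 hx), hβ.ne']
  have hw0 : ∀ x, 0 ≤ w x := fun x => by positivity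
  have hp := isProfile_dipole (v := v) hv one_pos hB hw
    (fun x => sub_nonneg.2 (Real.rpow_le_one (by positivity) (min_le_left _ _) hβ.le))
    (fun x => sub_le_self _ (by positivity)) (fun x hx => hBR x (by linarith))
    (by
      refine HasCompactSupport.of_support_subset_isCompact (isCompact_closedBall 0 (R + 1))
        fun x hx => ?_
      rw [mem_closedBall_zero_iff]
      by_contra! hlt
      refine hx ?_
      simp [B, max_eq_left (show 0 ≤ ‖x‖ - R by linarith),
        min_eq_left (show 1 ≤ ‖x‖ - R by linarith)])
    hw0 (fun x => Real.rpow_le_one (by positivity)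
      (max_le (by linarith [norm_nonneg x]) zero_le_one) hβ.le) hws
  have hwe : HasExponent γ w := by
    refine hasExponent_of_abs_sub_le hβ hγβ hs fun x hx _ => ?_
    have hlt : ‖x‖ < s := lt_of_not_ge fun hle => by simp [hws' x hle] at hx
    refine ⟨by rw [mem_closedBall_zero_iff]; linarith, ?_⟩
    rw [abs_of_nonneg (hw0 x)]
    simp only [w]
    rw [Real.rpow_rpow_inv (by positivity) hβ.ne', abs_sub_comm, abs_of_pos (by linarith)]
    exact le_max_left _ _
  have hBe : HasExponent γ fun x => B x - 1 := by
    refine hasExponent_of_abs_sub_le hβ hγβ hR fun x hx hx1 => ?_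
    have hlt : R < ‖x‖ := lt_of_not_ge fun hle => by simp [hBR x hle] at hx
    have heq : |B x - 1| = min 1 (max (‖x‖ - R) 0) ^ β := by
      simp only [B, sub_sub_cancel_left, abs_neg]
      exact abs_of_nonneg (by positivity)
    rw [heq] at hx1 ⊢
    rw [Real.rpow_rpow_inv (by positivity) hβ.ne', abs_of_pos (by linarith)]
    rw [max_eq_left (by linarith)] at hx1 ⊢
    have hle : ‖x‖ - R ≤ 1 := by
      by_contra! hlt1
      rw [min_eq_left hlt1.le, Real.one_rpow] at hx1
      norm_num at hx1
    exact ⟨by rw [mem_closedBall_zero_iff]; linarith, (min_eq_right hle).ge⟩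
  have hφe : HasExponent γ (dipole w v) := by
    have h1 := hwe.comp_affine one_ne_zero one_pos v
    have h2 := hwe.comp_affine (neg_ne_zero.2 one_ne_zero) one_pos (-v)
    simp only [one_smul, sub_neg_eq_add, one_mul] at h1 h2
    refine h1.add h2 fun x => ?_
    simpa using dipole_eq_zero hv hws x
  refine ⟨B, dipole w v, 2 * 1, (1 / 32) ^ β, 1 / 32, v, hp, by positivity, by norm_num,
    by norm_num, hv, fun x hx => le_dipole hv hws (by positivity) (fun y hy => ?_) hx,
    fun N α δ hN hα hδ => ⟨0, by simpa using hδ.le, fun σ => ?_⟩⟩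
  · exact Real.rpow_le_rpow (by norm_num) (le_max_of_le_left (by linarith)) hβ.le
  · have hz : ∀ z : Fin d → Fin N, HasExponent γ fun x =>
        α * (boolSign (σ z) * dipole w v ((N : ℝ) • x - latticePoint z)) := fun z => by
      have hs0 : boolSign (σ z) ≠ 0 := abs_pos.1 (by rw [abs_boolSign]; exact one_pos)
      have := hφe.comp_affine (mul_ne_zero hα.ne' hs0) (show (0 : ℝ) < N by exact_mod_cast hN)
        (latticePoint z)
      simpa only [mul_assoc] using this
    have hcell : ∀ (x : EuclideanSpace ℝ (Fin d)) (z : Fin d → Fin N),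
        dipole w v ((N : ℝ) • x - latticePoint z) ≠ 0 →
        ‖(N : ℝ) • x - latticePoint z‖ ≤ 3 / 8 := fun x z hne =>
      le_of_not_gt fun hlt => hne (hp.bump_eq_zero hlt)
    have hsum := hBe.add (HasExponent.sum Finset.univ (fun z _ => hz z) fun x z _ z' _ hne => by
        by_contra! h2
        exact hne (eq_of_mem_cell (hcell x z (right_ne_zero_of_mul (right_ne_zero_of_mul h2.1)))
          (hcell x z' (right_ne_zero_of_mul (right_ne_zero_of_mul h2.2))))) fun x => by
        by_contra! h2
        obtain ⟨z, -, hz⟩ := Finset.exists_ne_zero_of_sum_ne_zero h2.2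
        have := norm_le_of_mem_cell hN
          (hcell x z (right_ne_zero_of_mul (right_ne_zero_of_mul hz)))
        exact h2.1 (by rw [hp.base_eq_one x this, sub_self])
    convert hsum using 2 with x
    rw [perturb, Finset.mul_sum]
    ring

theorem existsProfile (hd : 0 < d) {β γ : ℝ} (hβ : 0 < β) (hγ : 0 < γ) (hγβ : γ * β ≤ 1) :
    ExistsProfile d β γ :=
  (le_or_gt 1 β).elim (fun h => existsProfile_of_one_le hd h hγ hγβ) fun h =>
    existsProfile_of_lt_one hd hβ h hγβ

end Profiles

section LowerBound

namespace IsProfile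

variable {d N : ℕ} {β L α κ b : ℝ} {B φ : EuclideanSpace ℝ (Fin d) → ℝ}

theorem integral_base_pos (h : IsProfile β L B φ) : 0 < ∫ x, B x := by
  refine h.continuous_base.integral_pos_of_hasCompactSupport_nonneg_nonzero h.base_support
    h.base_nonneg (x := 0) ?_
  rw [h.base_eq_one 0 (by rw [norm_zero]; positivity)]
  exact one_ne_zero

theorem integral_scaled (h : IsProfile β L B φ) (hN : 0 < N) (hκ : 0 < κ)
    (hbM : b ^ d = κ * ∫ x, B x) (σ : (Fin d → Fin N) → Bool) :
    ∫ x, κ * perturb B φ α σ (b • x) = 1 := by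
  have := h.integral_base_pos
  rw [integral_const_mul, Measure.integral_comp_smul, h.integral_perturb hN,
    finrank_euclideanSpace_fin, hbM, abs_of_pos (by positivity), smul_eq_mul]
  field_simp

theorem lintegral_scaled (h : IsProfile β L B φ) (hN : 0 < N) (hα : |α| ≤ 1) (hκ : 0 < κ)
    (hb : 0 < b) (hbM : b ^ d = κ * ∫ x, B x) (σ : (Fin d → Fin N) → Bool) :
    ∫⁻ x, ENNReal.ofReal (κ * perturb B φ α σ (b • x)) = 1 := by
  have hi := ((h.continuous_perturb (α := α) hN σ).integrable_of_hasCompactSupport (μ := volume)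
    (h.hasCompactSupport_perturb hN σ)).comp_smul hb.ne'
  rw [← ofReal_integral_eq_lintegral_ofReal (hi.const_mul κ)
    (Filter.Eventually.of_forall fun x => mul_nonneg hκ.le (h.perturb_nonneg hN hα σ _)),
    h.integral_scaled hN hκ hbM, ENNReal.ofReal_one]

theorem memPSigma (h : IsProfile β L B φ) (hN : 0 < N) (hα : 0 ≤ α) (hα1 : α ≤ 1 / 4)
    {lam γ t Λ : ℝ} (hlam : 0 < lam) (ht : |t| ≤ 1 / 2) (hκ : κ * (1 + t) = lam) (hb : 0 < b)
    (hbM : b ^ d = κ * ∫ x, B x) {σ : (Fin d → Fin N) → Bool}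
    (hexp : HasExponent γ fun x => perturb B φ α σ x - (1 + t))
    (hΛ : κ * ((L + α * (2 * (L * (N : ℝ) ^ β))) * b ^ β) ≤ Λ) :
    MemPSigma β Λ 1 lam γ β (4 * lam) 1 fun x => κ * perturb B φ α σ (b • x) := by
  have ht' := abs_le.1 ht
  have hκ0 : 0 < κ := pos_of_mul_pos_left (hκ ▸ hlam) (by linarith)
  have hα' : |α| ≤ 1 := by rw [abs_of_nonneg hα]; linarith
  have hH : GlobalHolder β Λ fun x => κ * perturb B φ α σ (b • x) := by
    have := ((h.globalHolder_perturb (α := α) hN σ).comp_affine hb.le 0).const_mul κ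
    simp only [sub_zero, abs_of_nonneg hα, abs_of_pos hκ0] at this
    exact this.mono hΛ
  have hloc : ∀ x₀, LocHolder β Λ 1 x₀ fun x => κ * perturb B φ α σ (b • x) := fun x₀ =>
    ⟨hH.1.contDiffAt, fun x _ => hH.2 x₀ x⟩
  refine ⟨hH.1.continuous.measurable,
    fun x => mul_nonneg hκ0.le (h.perturb_nonneg hN hα' σ _),
    h.lintegral_scaled hN hα' hκ0 hb hbM σ, Filter.Eventually.of_forall fun x₀ _ _ => hloc x₀,
    Filter.Eventually.of_forall fun x₀ _ => hloc x₀, ?_, fun x => ?_⟩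
  · have := hexp.comp_affine hκ0.ne' hb 0
    simp only [sub_zero, mul_sub, hκ] at this
    exact this
  · have h1 := (abs_le.1 (h.abs_perturb_sub_le hN hα σ (b • x))).2
    have h2 := h.base_le_one (b • x)
    nlinarith

theorem volume_cell_le (z : Fin d → Fin N) (hN : 0 < N) (hb : 0 < b) :
    volume.real {x : EuclideanSpace ℝ (Fin d) | ‖(N : ℝ) • b • x - latticePoint z‖ ≤ 3 / 8} ≤
        (((N : ℝ) * b) ^ d)⁻¹ * volume.real (Metric.ball (0 : EuclideanSpace ℝ (Fin d)) 1) ∧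
      volume {x : EuclideanSpace ℝ (Fin d) | ‖(N : ℝ) • b • x - latticePoint z‖ ≤ 3 / 8} ≠ ∞ := by
  have hNb : 0 < (N : ℝ) * b := by positivity
  have hle : volume {x : EuclideanSpace ℝ (Fin d) |
      ‖(N : ℝ) • b • x - latticePoint z‖ ≤ 3 / 8} ≤
      ENNReal.ofReal (((N * b) ^ d)⁻¹) * volume (Metric.ball (0 : EuclideanSpace ℝ (Fin d)) 1) := by
    rw [← addHaar_preimage_affine hNb (latticePoint z)]
    refine measure_mono fun x hx => ?_
    rw [Set.mem_preimage, mem_ball_zero_iff, ← smul_smul]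
    exact lt_of_le_of_lt hx (by norm_num)
  have hfin : ENNReal.ofReal (((N * b) ^ d)⁻¹) *
      volume (Metric.ball (0 : EuclideanSpace ℝ (Fin d)) 1) ≠ ∞ :=
    ENNReal.mul_ne_top ENNReal.ofReal_ne_top measure_ball_lt_top.ne
  refine ⟨?_, ne_top_of_le_ne_top hfin hle⟩
  refine (ENNReal.toReal_mono hfin hle).trans_eq ?_
  rw [ENNReal.toReal_mul, ENNReal.toReal_ofReal (by positivity), measureReal_def]

theorem le_affinity (h : IsProfile β L B φ) (hN : 0 < N) (hα : 0 ≤ α) (hα1 : α ≤ 1 / 4)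
    (hκ : 0 < κ) (hb : 0 < b) (hbM : b ^ d = κ * ∫ x, B x) {n : ℕ} (hn : 0 < n)
    (hsmall : 8 / 3 * n * α ^ 2 * volume.real (Metric.ball (0 : EuclideanSpace ℝ (Fin d)) 1) ≤
      (∫ x, B x) * (N : ℝ) ^ d) (σ : (Fin d → Fin N) → Bool) (z : Fin d → Fin N) (s : Bool) :
    (8 : ℝ≥0∞)⁻¹ ≤ ∫⁻ ω, min (∏ i, ENNReal.ofReal (κ * perturb B φ α σ (b • ω i)))
      (∏ i, ENNReal.ofReal (κ * perturb B φ α (Function.update σ z s) (b • ω i)))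
      ∂(Measure.pi fun _ : Fin n => (volume : Measure (EuclideanSpace ℝ (Fin d)))) := by
  have hM := h.integral_base_pos
  have hα' : |α| ≤ 1 := by rw [abs_of_nonneg hα]; linarith
  have hm : ∀ σ : (Fin d → Fin N) → Bool, Measurable fun x => κ * perturb B φ α σ (b • x) :=
    fun σ => (continuous_const.mul ((h.continuous_perturb hN σ).comp
      (continuous_const_smul b))).measurable
  have h0 : ∀ (σ : (Fin d → Fin N) → Bool) x, 0 ≤ κ * perturb B φ α σ (b • x) :=
    fun σ x => mul_nonneg hκ.le (h.perturb_nonneg hN hα' σ _)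
  have h1 := h.lintegral_scaled hN hα' hκ hb hbM
  have hcell : ∀ (σ : (Fin d → Fin N) → Bool) (x : EuclideanSpace ℝ (Fin d)),
      ‖(N : ℝ) • b • x - latticePoint z‖ ≤ 3 / 8 → |perturb B φ α σ (b • x) - 1| ≤ α :=
    fun σ x hx => by
      rw [← h.base_eq_one _ (norm_le_of_mem_cell hN hx)]
      exact h.abs_perturb_sub_le hN hα σ _
  have hlow : ∀ (σ : (Fin d → Fin N) → Bool), ∀ x ∈ {x : EuclideanSpace ℝ (Fin d) |
      ‖(N : ℝ) • b • x - latticePoint z‖ ≤ 3 / 8}, κ * (3 / 4) ≤ κ * perturb B φ α σ (b • x) :=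
    fun σ x hx => mul_le_mul_of_nonneg_left (by linarith [(abs_le.1 (hcell σ x hx)).1]) hκ.le
  have hA : MeasurableSet {x : EuclideanSpace ℝ (Fin d) |
      ‖(N : ℝ) • b • x - latticePoint z‖ ≤ 3 / 8} :=
    measurableSet_le (by fun_prop) measurable_const
  obtain ⟨hvol, hfin⟩ := volume_cell_le z hN hb
  refine le_lintegral_min_prod (hm σ) (hm _) (h0 σ) (h0 _) (h1 σ) (h1 _) ?_
  refine le_trans (ENNReal.ofReal_le_ofReal ?_) (le_lintegral_sqrt_mul (D := κ * (2 * α))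
    (hm σ) (hm (Function.update σ z s)) (h0 σ) (h1 σ) (h0 _) (h1 _) hA hfin (fun x hx => ?_)
    (show 0 < κ * (3 / 4) by positivity) (hlow σ) (hlow _) fun x hx => ?_)
  · refine sub_le_sub_left ?_ 1
    have hn' : (0 : ℝ) < n := by exact_mod_cast hn
    have hN' : (0 : ℝ) < N := by exact_mod_cast hN
    rw [mul_pow (N : ℝ), hbM] at hvol
    set V := volume.real (Metric.ball (0 : EuclideanSpace ℝ (Fin d)) 1)
    set M := ∫ x, B x
    rw [div_le_div_iff₀ (by positivity) (by positivity)]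
    calc (κ * (2 * α)) ^ 2 * _ * (2 * n)
        ≤ (κ * (2 * α)) ^ 2 * (((N : ℝ) ^ d * (κ * M))⁻¹ * V) * (2 * n) := by gcongr
      _ = 3 * κ * (8 / 3 * n * α ^ 2 * V) / ((N : ℝ) ^ d * M) := by field_simp; ring
      _ ≤ 3 * κ * (M * (N : ℝ) ^ d) / ((N : ℝ) ^ d * M) := by gcongr
      _ = 1 * (4 * (κ * (3 / 4))) := by field_simp
  · simp only [Set.mem_ofPred_eq, not_le] at hx
    rw [h.perturb_update σ z s hx]
  · rw [← mul_sub, abs_mul, abs_of_pos hκ]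
    refine mul_le_mul_of_nonneg_left ?_ hκ.le
    have h2 := abs_le.1 (hcell σ x hx)
    have h3 := abs_le.1 (hcell (Function.update σ z s) x hx)
    rw [abs_le]
    constructor <;> linarith

theorem exists_le_risk (h : IsProfile β L B φ) (hN : 0 < N) (hα : 0 < α) (hα1 : α ≤ 1 / 4)
    {lam t c s : ℝ} {v : EuclideanSpace ℝ (Fin d)} (hκ0 : 0 < κ) (hκ : κ * (1 + t) = lam)
    (hb : 0 < b) (hbM : b ^ d = κ * ∫ x, B x) (hc : 0 < c) (hs1 : s ≤ 1 / 8)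
    (hv : ‖v‖ = 1 / 4) (hφ : ∀ x, ‖x - v‖ < s → c ≤ φ x) (ht : |t| ≤ α * c / 2) {n : ℕ}
    (hn : 0 < n)
    (hsmall : 8 / 3 * n * α ^ 2 * volume.real (Metric.ball (0 : EuclideanSpace ℝ (Fin d)) 1) ≤
      (∫ x, B x) * (N : ℝ) ^ d)
    {Ghat : (Fin n → EuclideanSpace ℝ (Fin d)) → Set (EuclideanSpace ℝ (Fin d))}
    (hG : MeasurableSet {q : EuclideanSpace ℝ (Fin d) ×
          (Fin n → EuclideanSpace ℝ (Fin d)) | q.1 ∈ Ghat q.2}) :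
    ∃ σ : (Fin d → Fin N) → Bool,
      ENNReal.ofReal (α * c * volume.real (Metric.ball v s) / (32 * ∫ x, B x)) ≤
        ∫⁻ ω, (∫⁻ x in symmDiff {x | lam < κ * perturb B φ α σ (b • x)} (Ghat ω),
          ENNReal.ofReal |κ * perturb B φ α σ (b • x) - lam|)
          ∂(prodMeasure d n fun x => κ * perturb B φ α σ (b • x)) := by
  have hM := h.integral_base_pos
  have ht' := abs_le.1 ht
  have hNb : 0 < (N : ℝ) * b := by positivity
  let D : (Fin d → Fin N) → Set (EuclideanSpace ℝ (Fin d)) := fun z =>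
    (fun x => ((N : ℝ) * b) • x - latticePoint z) ⁻¹' Metric.ball v s
  have hD : ∀ z, ∀ x ∈ D z, ‖(N : ℝ) • b • x - latticePoint z‖ ≤ 3 / 8 ∧
      c ≤ φ ((N : ℝ) • b • x - latticePoint z) := by
    intro z x hx
    simp only [D, Set.mem_preimage, mem_ball_iff_norm, ← smul_smul] at hx
    refine ⟨?_, hφ _ hx⟩
    have := norm_le_norm_add_norm_sub' ((N : ℝ) • b • x - latticePoint z) v
    linarith
  obtain ⟨σ, hσ⟩ := _root_.exists_le_risk (lam := lam) (b := κ * (α * c / 2)) (by positivity)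
    (V := ENNReal.ofReal (((N * b) ^ d)⁻¹) * volume (Metric.ball v s))
    (p := fun (σ : (Fin d → Fin N) → Bool) x => κ * perturb B φ α σ (b • x))
    (fun σ => (continuous_const.mul ((h.continuous_perturb hN σ).comp
      (continuous_const_smul b))).measurable)
    (fun σ z => h.le_affinity hN hα.le hα1 hκ0 hb hbM hn hsmall σ z _) (D := D)
    (fun z => (by fun_prop : Measurable fun x : EuclideanSpace ℝ (Fin d) =>
      ((N : ℝ) * b) • x - latticePoint z) measurableSet_ball)
    (fun z z' hne => Set.disjoint_left.2 fun x hx hx' =>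
      hne (eq_of_mem_cell (hD z x hx).1 (hD z' x hx').1))
    (fun z => (addHaar_preimage_affine hNb _ _).ge)
    (fun σ z x hx hz => by
      obtain ⟨h1, h2⟩ := hD z x hx
      rw [h.perturb_of_mem_cell hN σ h1, hz, ← hκ, ← mul_add]
      refine mul_le_mul_of_nonneg_left ?_ hκ0.le
      have := mul_le_mul_of_nonneg_left h2 hα.le
      simp only [boolSign, if_true, one_mul]
      linarith)
    (fun σ z x hx hz => by
      obtain ⟨h1, h2⟩ := hD z x hx
      rw [h.perturb_of_mem_cell hN σ h1, hz, ← hκ, ← mul_sub]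
      refine mul_le_mul_of_nonneg_left ?_ hκ0.le
      have := mul_le_mul_of_nonneg_left h2 hα.le
      simp only [boolSign, Bool.false_eq_true, if_false, neg_one_mul, mul_neg]
      linarith) hG
  refine ⟨σ, ?_⟩
  refine (ENNReal.mul_le_mul_iff_right two_ne_zero ENNReal.ofNat_ne_top).1
    (le_trans (le_of_eq ?_) hσ)
  have hN' : (0 : ℝ) < N := by exact_mod_cast hN
  rw [Fintype.card_fun, Fintype.card_fin, Fintype.card_fin,
    ← ofReal_measureReal (measure_ball_lt_top (μ := volume) (x := v) (r := s)).ne]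
  have hW : 0 ≤ volume.real (Metric.ball v s) := measureReal_nonneg
  generalize volume.real (Metric.ball v s) = W at hW
  generalize ∫ x, B x = M at hM hbM
  rw [← ENNReal.ofReal_ofNat 2, ← ENNReal.ofReal_ofNat 8, ← ENNReal.ofReal_natCast,
    ← ENNReal.ofReal_inv_of_pos (by norm_num), ← ENNReal.ofReal_mul (by positivity),
    ← ENNReal.ofReal_mul (by positivity), ← ENNReal.ofReal_mul (by positivity),
    ← ENNReal.ofReal_mul (by positivity), ← ENNReal.ofReal_mul (by positivity), mul_pow, hbM]
  congr 1
  push_cast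
  field_simp
  ring

end IsProfile

end LowerBound

/-- **Theorem 5.1, (5.1): minimax lower bound for `d_H`.**  Fix `λ > 0` and `β, γ > 0`
with `γβ ≤ 1`.  There exist parameters `L, r, β', L*, η > 0` and a constant `C > 0` such
that, with `P_Σ = P_Σ(β,L,r,λ,γ,β',L*,η)`, for every `n ≥ 1` and every (jointly
measurable) estimator `Ĝ_n` of `Γ_p(λ)` built from an i.i.d. sample of size `n`, one has
`sup_{p ∈ P_Σ} 𝔼_p[d_H(Γ_p(λ), Ĝ_n)] ≥ C n^{-(1+γ)β/(2β+d)}`. -/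
theorem minimax_lower_bound_dH (d : ℕ) (hd : 0 < d) (lam β γ : ℝ)
    (hlam : 0 < lam) (hβ : 0 < β) (hγ : 0 < γ) (hγβ : γ * β ≤ 1) :
    ∃ L r β' Lstar η C : ℝ, 0 < L ∧ 0 < r ∧ 0 < β' ∧ 0 < Lstar ∧ 0 < η ∧ 0 < C ∧
      ∀ n : ℕ, 1 ≤ n →
      ∀ Ghat : (Fin n → EuclideanSpace ℝ (Fin d)) → Set (EuclideanSpace ℝ (Fin d)),
        MeasurableSet {q : EuclideanSpace ℝ (Fin d) ×
          (Fin n → EuclideanSpace ℝ (Fin d)) | q.1 ∈ Ghat q.2} →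
        ∃ p : EuclideanSpace ℝ (Fin d) → ℝ, MemPSigma β L r lam γ β' Lstar η p ∧
          ENNReal.ofReal (C * (n : ℝ) ^ (-((1 + γ) * β / (2 * β + d)))) ≤
            ∫⁻ ω, (∫⁻ x in symmDiff {x | lam < p x} (Ghat ω),
              ENNReal.ofReal |p x - lam|) ∂(prodMeasure d n p) := by
  obtain ⟨B, φ, L, c, s, v, h, hc, hs, hs1, hv, hφ, hlevel⟩ := existsProfile hd hβ hγ hγβ
  have hM := h.integral_base_pos
  have hL := h.const_pos
  have hW : 0 < volume.real (Metric.ball v s) :=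
    ENNReal.toReal_pos (Metric.measure_ball_pos _ _ hs).ne' measure_ball_lt_top.ne
  have hV : 0 < volume.real (Metric.ball (0 : EuclideanSpace ℝ (Fin d)) 1) :=
    ENNReal.toReal_pos (Metric.measure_ball_pos _ _ one_pos).ne' measure_ball_lt_top.ne
  set M := ∫ x, B x with hMdef
  set W := volume.real (Metric.ball v s) with hWdef
  set V := volume.real (Metric.ball (0 : EuclideanSpace ℝ (Fin d)) 1) with hVdef
  set a := min (1 / 4) (M / V) with ha
  have ha0 : 0 < a := by positivity
  have ha1 : a ≤ 1 / 4 := min_le_left _ _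
  have ha2 : a * V ≤ M := (le_div_iff₀ hV).1 (min_le_right _ _)
  refine ⟨2 * lam * ((L + 2 * a * L) * ((2 * lam * M) ^ (d : ℝ)⁻¹) ^ β), 1, β, 4 * lam, 1,
    a * 2 ^ (-β) * c * W / (32 * M), by positivity, one_pos, hβ, by positivity, one_pos,
    by positivity, fun n hn Ghat hG => ?_⟩
  have hn1 : (1 : ℝ) ≤ n := by exact_mod_cast hn
  have hn0 : (0 : ℝ) < n := by linarith
  set m := (n : ℝ) ^ (2 * β + d)⁻¹ with hm
  have hm1 : 1 ≤ m := Real.one_le_rpow hn1 (by positivity)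
  set N := ⌈m⌉₊ with hNdef
  have hN : 0 < N := Nat.ceil_pos.2 (by linarith)
  have hN0 : (0 : ℝ) < N := by exact_mod_cast hN
  have hmN : m ≤ N := Nat.le_ceil m
  have hN2 : (N : ℝ) ≤ 2 * m := by linarith [Nat.ceil_lt_add_one (show 0 ≤ m by linarith)]
  set α := a * (N : ℝ) ^ (-β) with hα
  have hα0 : 0 < α := by positivity
  have hα1 : α ≤ 1 / 4 := by
    refine (mul_le_of_le_one_right ha0.le ?_).trans ha1
    exact Real.rpow_le_one_of_one_le_of_nonpos (hm1.trans hmN) (by linarith)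
  obtain ⟨t, ht, hexp⟩ := hlevel N α (min (1 / 2) (α * c / 2)) hN hα0 (by positivity)
  have ht1 : |t| ≤ 1 / 2 := ht.trans (min_le_left _ _)
  have ht2 : |t| ≤ α * c / 2 := ht.trans (min_le_right _ _)
  have ht3 := abs_le.1 ht1
  have ht0 : 0 < 1 + t := by linarith
  set κ := lam / (1 + t) with hκdef
  have hκ : κ * (1 + t) = lam := div_mul_cancel₀ _ ht0.ne'
  have hκ0 : 0 < κ := by positivity
  have hκ2 : κ ≤ 2 * lam := by
    rw [hκdef, div_le_iff₀ ht0]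
    nlinarith
  set b := (κ * M) ^ (d : ℝ)⁻¹ with hbdef
  have hb : 0 < b := by positivity
  have hbM : b ^ d = κ * M := Real.rpow_inv_natCast_pow (by positivity) hd.ne'
  have hsmall : 8 / 3 * n * α ^ 2 * V ≤ M * (N : ℝ) ^ d := by
    have h1 : (n : ℝ) ≤ (N : ℝ) ^ (2 * β) * (N : ℝ) ^ d := by
      rw [← Real.rpow_natCast (N : ℝ) d, ← Real.rpow_add hN0]
      calc (n : ℝ) = m ^ (2 * β + d) := (Real.rpow_inv_rpow hn0.le (by positivity)).symm
        _ ≤ _ := by gcongr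
    have h2 : (N : ℝ) ^ (2 * β) * ((N : ℝ) ^ (-β)) ^ 2 = 1 := by
      rw [← Real.rpow_natCast ((N : ℝ) ^ (-β)), ← Real.rpow_mul hN0.le, ← Real.rpow_add hN0]
      simp [mul_comm]
    calc 8 / 3 * n * α ^ 2 * V
        ≤ 8 / 3 * ((N : ℝ) ^ (2 * β) * (N : ℝ) ^ d) * α ^ 2 * V := by gcongr
      _ = 8 / 3 * a * (a * V) * (N : ℝ) ^ d * ((N : ℝ) ^ (2 * β) * ((N : ℝ) ^ (-β)) ^ 2) := by
        rw [hα]; ring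
      _ = 8 / 3 * a * (a * V) * (N : ℝ) ^ d := by rw [h2, mul_one]
      _ ≤ 1 * M * (N : ℝ) ^ d := by
        gcongr
        linarith
      _ = _ := by rw [one_mul]
  obtain ⟨σ, hσ⟩ := h.exists_le_risk hN hα0 hα1 hκ0 hκ hb hbM hc hs1 hv hφ ht2 hn hsmall hG
  refine ⟨_, h.memPSigma hN hα0.le hα1 hlam ht1 hκ hb hbM (hexp σ) ?_,
    (ENNReal.ofReal_le_ofReal ?_).trans hσ⟩
  · have h1 : α * (2 * (L * (N : ℝ) ^ β)) = 2 * a * L := by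
      have : (N : ℝ) ^ (-β) * (N : ℝ) ^ β = 1 := by
        rw [← Real.rpow_add hN0, neg_add_cancel, Real.rpow_zero]
      linear_combination (2 * a * L) * this
    rw [h1, hbdef]
    gcongr
  · have h1 : (n : ℝ) ^ (-((1 + γ) * β / (2 * β + d))) ≤ m ^ (-β) := by
      rw [hm, ← Real.rpow_mul hn0.le]
      refine Real.rpow_le_rpow_of_exponent_le hn1 ?_
      rw [div_eq_mul_inv, mul_neg, neg_le_neg_iff, mul_assoc, mul_comm _ β]
      exact le_mul_of_one_le_left (by positivity) (by linarith)
    have h2 : (2 : ℝ) ^ (-β) * m ^ (-β) ≤ (N : ℝ) ^ (-β) := by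
      rw [← Real.mul_rpow zero_le_two (by linarith)]
      exact Real.rpow_le_rpow_of_nonpos hN0 hN2 (by linarith)
    calc a * 2 ^ (-β) * c * W / (32 * M) * (n : ℝ) ^ (-((1 + γ) * β / (2 * β + d)))
        ≤ a * 2 ^ (-β) * c * W / (32 * M) * m ^ (-β) := by gcongr
      _ = a * (2 ^ (-β) * m ^ (-β)) * c * W / (32 * M) := by ring
      _ ≤ a * (N : ℝ) ^ (-β) * c * W / (32 * M) := by gcongr
end

section
/- Fix λ > 0, γ > 0 and L_Q > 0, and let ℒ = {x ∈ 𝒳 : p(x) = λ}. Suppose there exist c > 0 and ε₀ > 0 such that Q{x : 0 < |p(x) − λ| ≤ ε} ≤ c ε^γ for all 0 < ε ≤ ε₀. Then there exist c' > 0 and ε₁ > 0 such that: Q{x : 0 < |p(x) − λ| ≤ ε} ≤ L_Q for all 0 < ε ≤ ε₁, and for every measurable set G ⊆ 𝒳 \ ℒ with Q(G) ≤ L_Q one has Q(G) ≤ c' (∫_G |p(x) − λ| dQ(x))^{γ/(1+γ)}. -/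
open MeasureTheory ENNReal

/-- **Proposition A.1, (i) ⟹ (ii).**  Fix `λ > 0`, `γ > 0`, `L_Q > 0` and let
`ℒ = {p = λ}`.  If there are `c > 0` and `ε₀ > 0` with
`Q{0 < |p - λ| ≤ ε} ≤ c ε^γ` for all `0 < ε ≤ ε₀`, then there exist `c' > 0` and
`ε₁ > 0` such that `Q{0 < |p - λ| ≤ ε} ≤ L_Q` for all `0 < ε ≤ ε₁`, and for every
measurable `G ⊆ 𝒳 \ ℒ` with `Q(G) ≤ L_Q`,
`Q(G) ≤ c' (∫_G |p - λ| dQ)^{γ/(1+γ)}`. -/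
theorem gamma_exponent_imp_measure_bound (d : ℕ)
    (Q : Measure (EuclideanSpace ℝ (Fin d))) [SigmaFinite Q]
    (lam γ L_Q : ℝ) (hlam : 0 < lam) (hγ : 0 < γ) (hLQ : 0 < L_Q)
    (p : EuclideanSpace ℝ (Fin d) → ℝ) (hpmeas : Measurable p) (hpnn : ∀ x, 0 ≤ p x)
    (hpdens : ∫⁻ x, ENNReal.ofReal (p x) ∂Q = 1)
    (c ε₀ : ℝ) (hc : 0 < c) (hε₀ : 0 < ε₀)
    (hexp : ∀ ε : ℝ, 0 < ε → ε ≤ ε₀ →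
      Q {x | 0 < |p x - lam| ∧ |p x - lam| ≤ ε} ≤ ENNReal.ofReal (c * ε ^ γ)) :
    ∃ c' > (0 : ℝ), ∃ ε₁ > (0 : ℝ),
      (∀ ε : ℝ, 0 < ε → ε ≤ ε₁ →
        Q {x | 0 < |p x - lam| ∧ |p x - lam| ≤ ε} ≤ ENNReal.ofReal L_Q) ∧
      ∀ G : Set (EuclideanSpace ℝ (Fin d)), MeasurableSet G →
        G ⊆ {x | p x ≠ lam} → Q G ≤ ENNReal.ofReal L_Q →
        Q G ≤ ENNReal.ofReal c' *
          (∫⁻ x in G, ENNReal.ofReal |p x - lam| ∂Q) ^ (γ / (1 + γ)) := by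
  have hε₀γ : 0 < ε₀ ^ γ := Real.rpow_pos_of_pos hε₀ γ
  set K : ℝ := c + L_Q / ε₀ ^ γ with hK
  have hKpos : 0 < K := by positivity
  have hcK : c ≤ K := le_add_of_nonneg_right (by positivity)
  have hLK : L_Q ≤ K * ε₀ ^ γ := by
    rw [hK, add_mul, div_mul_cancel₀ _ hε₀γ.ne']
    exact le_add_of_nonneg_left (by positivity)
  refine ⟨(2 * (2 * K) ^ γ⁻¹) ^ (γ / (1 + γ)), by positivity,
    min ε₀ ((L_Q / c) ^ γ⁻¹), lt_min hε₀ (by positivity), ?_, ?_⟩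
  · intro ε hε hle
    refine (hexp ε hε (hle.trans (min_le_left _ _))).trans (ENNReal.ofReal_le_ofReal ?_)
    have h : ε ^ γ ≤ L_Q / c := by
      rw [← Real.rpow_inv_rpow (by positivity : 0 ≤ L_Q / c) hγ.ne']
      exact Real.rpow_le_rpow hε.le (hle.trans (min_le_right _ _)) hγ.le
    rwa [le_div_iff₀' hc] at h
  · intro G _ hGsub hGL
    have hGtop : Q G ≠ ∞ := (hGL.trans_lt ENNReal.ofReal_lt_top).ne
    rcases eq_or_ne (Q G) 0 with hG0 | hG0
    · rw [hG0]
      exact zero_le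
    obtain ⟨m, hm⟩ : ∃ m, m = (Q G).toReal := ⟨_, rfl⟩
    have hmpos : 0 < m := hm ▸ ENNReal.toReal_pos hG0 hGtop
    have hQm : Q G = ENNReal.ofReal m := by rw [hm, ENNReal.ofReal_toReal hGtop]
    have hmL : m ≤ L_Q := hm ▸ ENNReal.toReal_le_of_le_ofReal hLQ.le hGL
    set ε : ℝ := (m / (2 * K)) ^ γ⁻¹ with hεdef
    have hε : 0 < ε := by positivity
    have hεγ : ε ^ γ = m / (2 * K) := Real.rpow_inv_rpow (by positivity) hγ.ne'
    have hεε₀ : ε ≤ ε₀ := by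
      rw [← Real.rpow_le_rpow_iff hε.le hε₀.le hγ, hεγ, div_le_iff₀ (by positivity)]
      nlinarith
    have hsmall : Q {x | 0 < |p x - lam| ∧ |p x - lam| ≤ ε} ≤ ENNReal.ofReal (m / 2) := by
      refine (hexp ε hε hεε₀).trans (ENNReal.ofReal_le_ofReal ?_)
      calc c * ε ^ γ ≤ K * ε ^ γ := by gcongr
        _ = m / 2 := by rw [hεγ]; field_simp
    have hbig : ENNReal.ofReal (m / 2) ≤
        Q ({x | ENNReal.ofReal ε ≤ ENNReal.ofReal |p x - lam|} ∩ G) := by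
      refine ENNReal.le_of_add_le_add_left (a := ENNReal.ofReal (m / 2)) ENNReal.ofReal_ne_top ?_
      rw [← ENNReal.ofReal_add (by positivity) (by positivity), add_halves, ← hQm]
      refine le_trans ?_ (add_le_add_left hsmall _)
      refine (measure_mono fun x hx => ?_).trans (measure_union_le _ _)
      rcases le_total |p x - lam| ε with h | h
      · exact Or.inl ⟨abs_pos.mpr (sub_ne_zero.mpr (hGsub hx)), h⟩
      · exact Or.inr ⟨ENNReal.ofReal_le_ofReal h, hx⟩
    have hfmeas : Measurable fun x => ENNReal.ofReal |p x - lam| := by fun_prop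
    have hint : ENNReal.ofReal (ε * (m / 2)) ≤ ∫⁻ x in G, ENNReal.ofReal |p x - lam| ∂Q := by
      rw [ENNReal.ofReal_mul hε.le]
      refine le_trans ?_ (mul_meas_ge_le_lintegral hfmeas (ENNReal.ofReal ε))
      rw [Measure.restrict_apply (measurableSet_le measurable_const hfmeas)]
      gcongr
    have hreal : (2 * (2 * K) ^ γ⁻¹) ^ (γ / (1 + γ)) * (ε * (m / 2)) ^ (γ / (1 + γ)) = m := by
      have hεK : (2 * K) ^ γ⁻¹ * ε = m ^ γ⁻¹ := by
        rw [hεdef, ← Real.mul_rpow (by positivity) (by positivity),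
          mul_div_cancel₀ _ (by positivity)]
      rw [← Real.mul_rpow (by positivity) (by positivity)]
      have hprod : 2 * (2 * K) ^ γ⁻¹ * (ε * (m / 2)) = m ^ (γ⁻¹ + 1) := by
        rw [Real.rpow_add_one hmpos.ne', ← hεK]
        ring
      rw [hprod, ← Real.rpow_mul hmpos.le]
      have hexponent : (γ⁻¹ + 1) * (γ / (1 + γ)) = 1 := by
        field_simp
      rw [hexponent, Real.rpow_one]
    calc Q G = ENNReal.ofReal ((2 * (2 * K) ^ γ⁻¹) ^ (γ / (1 + γ))) *
          ENNReal.ofReal (ε * (m / 2)) ^ (γ / (1 + γ)) := by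
          rw [ENNReal.ofReal_rpow_of_nonneg (by positivity) (by positivity),
            ← ENNReal.ofReal_mul (by positivity), hreal, hQm]
      _ ≤ _ := by gcongr
end

section
/- Fix λ > 0, γ > 0 and L_Q > 0, and let ℒ = {x ∈ 𝒳 : p(x) = λ}. Suppose there exist c' > 0 and ε₁ > 0 such that Q{x : 0 < |p(x) − λ| ≤ ε} ≤ L_Q for all 0 < ε ≤ ε₁, and such that for every measurable set G ⊆ 𝒳 \ ℒ with Q(G) ≤ L_Q one has Q(G) ≤ c' (∫_G |p(x) − λ| dQ(x))^{γ/(1+γ)}. Then p has γ-exponent at level λ with respect to Q; more precisely, Q{x : 0 < |p(x) − λ| ≤ ε} ≤ (c')^{1+γ} ε^γ for all 0 < ε ≤ ε₁. -/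
open MeasureTheory ENNReal

/-- A self-bounding inequality `m ≤ c (ε m)^{γ/(1+γ)}` resolves to `m ≤ c^{1+γ} ε^γ`. -/
theorem le_rpow_mul_rpow_of_le_mul_rpow_div {c ε m γ : ℝ} (hc : 0 ≤ c) (hε : 0 ≤ ε) (hm : 0 ≤ m)
    (hγ : 0 < γ) (h : m ≤ c * (ε * m) ^ (γ / (1 + γ))) : m ≤ c ^ (1 + γ) * ε ^ γ := by
  rcases hm.eq_or_lt with rfl | hm
  · positivity
  have h_pow := Real.rpow_le_rpow hm.le h (by positivity : 0 ≤ 1 + γ)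
  rw [Real.mul_rpow hc (by positivity), ← Real.rpow_mul (by positivity),
    div_mul_cancel₀ _ (by positivity : 1 + γ ≠ 0), Real.mul_rpow hε hm.le, ← mul_assoc,
    Real.rpow_add hm, Real.rpow_one] at h_pow
  exact le_of_mul_le_mul_right h_pow (Real.rpow_pos_of_pos hm γ)

/-- **Proposition A.1, (ii) ⟹ (i).**  Fix `λ > 0`, `γ > 0`, `L_Q > 0` and let
`ℒ = {p = λ}`.  Suppose there are `c' > 0` and `ε₁ > 0` such that
`Q{0 < |p - λ| ≤ ε} ≤ L_Q` for all `0 < ε ≤ ε₁`, and such that for every measurable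
`G ⊆ 𝒳 \ ℒ` with `Q(G) ≤ L_Q` one has `Q(G) ≤ c' (∫_G |p - λ| dQ)^{γ/(1+γ)}`.
Then `p` has `γ`-exponent at level `λ` w.r.t. `Q`; more precisely,
`Q{0 < |p - λ| ≤ ε} ≤ (c')^{1+γ} ε^γ` for all `0 < ε ≤ ε₁`. -/
theorem measure_bound_imp_gamma_exponent (d : ℕ)
    (Q : Measure (EuclideanSpace ℝ (Fin d))) [SigmaFinite Q]
    (lam γ L_Q : ℝ) (hlam : 0 < lam) (hγ : 0 < γ) (hLQ : 0 < L_Q)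
    (p : EuclideanSpace ℝ (Fin d) → ℝ) (hpmeas : Measurable p) (hpnn : ∀ x, 0 ≤ p x)
    (hpdens : ∫⁻ x, ENNReal.ofReal (p x) ∂Q = 1)
    (c' ε₁ : ℝ) (hc' : 0 < c') (hε₁ : 0 < ε₁)
    (hsmall : ∀ ε : ℝ, 0 < ε → ε ≤ ε₁ →
      Q {x | 0 < |p x - lam| ∧ |p x - lam| ≤ ε} ≤ ENNReal.ofReal L_Q)
    (hbound : ∀ G : Set (EuclideanSpace ℝ (Fin d)), MeasurableSet G →
      G ⊆ {x | p x ≠ lam} → Q G ≤ ENNReal.ofReal L_Q →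
      Q G ≤ ENNReal.ofReal c' *
        (∫⁻ x in G, ENNReal.ofReal |p x - lam| ∂Q) ^ (γ / (1 + γ))) :
    (∀ ε : ℝ, 0 < ε → ε ≤ ε₁ →
      Q {x | 0 < |p x - lam| ∧ |p x - lam| ≤ ε} ≤
        ENNReal.ofReal (c' ^ (1 + γ) * ε ^ γ)) ∧
    (∃ c₀ > (0 : ℝ), ∃ ε₀ > (0 : ℝ), ∀ ε : ℝ, 0 < ε → ε ≤ ε₀ →
      Q {x | 0 < |p x - lam| ∧ |p x - lam| ≤ ε} ≤ ENNReal.ofReal (c₀ * ε ^ γ)) := by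
  have key : ∀ ε : ℝ, 0 < ε → ε ≤ ε₁ →
      Q {x | 0 < |p x - lam| ∧ |p x - lam| ≤ ε} ≤ ENNReal.ofReal (c' ^ (1 + γ) * ε ^ γ) := by
    intro ε hε hε_le
    set G := {x | 0 < |p x - lam| ∧ |p x - lam| ≤ ε}
    have hdist : Measurable fun x => |p x - lam| := (hpmeas.sub_const lam).abs
    have hG_meas : MeasurableSet G :=
      (measurableSet_lt measurable_const hdist).inter (measurableSet_le hdist measurable_const)
    have hG_small : Q G ≤ ENNReal.ofReal L_Q := hsmall ε hε hε_le
    have hG_fin : Q G ≠ ∞ := ne_top_of_le_ne_top ofReal_ne_top hG_small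
    have hG_int : ∫⁻ x in G, ENNReal.ofReal |p x - lam| ∂Q ≤ ENNReal.ofReal ε * Q G := by
      rw [← setLIntegral_const]
      exact setLIntegral_mono measurable_const fun x hx => ofReal_le_ofReal hx.2
    have hG_bound : Q G ≤ ENNReal.ofReal c' * (ENNReal.ofReal ε * Q G) ^ (γ / (1 + γ)) :=
      (hbound G hG_meas (fun x hx => sub_ne_zero.mp (abs_pos.mp hx.1)) hG_small).trans
        (by gcongr)
    rw [← ofReal_toReal hG_fin] at hG_bound ⊢
    rw [← ofReal_mul hε.le, ofReal_rpow_of_nonneg (by positivity) (by positivity),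
      ← ofReal_mul hc'.le, ofReal_le_ofReal_iff (by positivity)] at hG_bound
    exact ofReal_le_ofReal
      (le_rpow_mul_rpow_of_le_mul_rpow_div hc'.le hε.le toReal_nonneg hγ hG_bound)
  exact ⟨key, c' ^ (1 + γ), by positivity, ε₁, hε₁, key⟩
end

section
/- There exists a numerical constant C > 0 such that for all integers N and ℓ with N ≥ 6ℓ ≥ 6, there exists a subset Ω of Ω_{2ℓ} = {ω ∈ {0,1}^N : Σ_{j=1}^N ω_j = 2ℓ} such that ρ(ω, ω') ≥ ℓ + 1 for all distinct ω, ω' ∈ Ω, and the cardinality s of Ω satisfies log(s) ≥ C ℓ log(N/ℓ). -/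
open Finset in
/-- A Hamming ball of radius `r` has at most `2 ^ |ι| * |α| ^ r` elements. -/
theorem card_hammingBall_le {ι α : Type*} [Fintype ι] [DecidableEq ι] [Fintype α]
    [DecidableEq α] [Nonempty α] (f : ι → α) (r : ℕ) :
    #{g : ι → α | hammingDist f g ≤ r} ≤ 2 ^ Fintype.card ι * Fintype.card α ^ r := by
  let S : Finset (Finset ι) := {T | #T ≤ r}
  let P : Finset ι → Finset (ι → α) := fun T =>
    Fintype.piFinset fun i => if i ∈ T then univ else {f i}
  have hsub : ({g : ι → α | hammingDist f g ≤ r} : Finset (ι → α)) ⊆ S.biUnion P := by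
    intro g hg
    rw [mem_filter_univ] at hg
    refine mem_biUnion.2 ⟨({i | f i ≠ g i} : Finset ι), by simpa [S, hammingDist] using hg, ?_⟩
    refine Fintype.mem_piFinset.2 fun i => ?_
    by_cases h : f i = g i <;> simp [h]
  have hP : ∀ T ∈ S, #(P T) ≤ Fintype.card α ^ r := by
    intro T hT
    have hcard : #(P T) = Fintype.card α ^ #T := by
      simp [P, Fintype.card_piFinset, apply_ite Finset.card]
    rw [hcard]
    exact Nat.pow_le_pow_right Fintype.card_pos (by simpa [S] using hT)
  calc _ ≤ #(S.biUnion P) := card_le_card hsub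
    _ ≤ #S * Fintype.card α ^ r := card_biUnion_le_card_mul _ _ _ hP
    _ ≤ _ := by
      gcongr
      exact (card_le_univ S).trans_eq (by simp)

open Finset in
/-- The Gilbert–Varshamov bound, with a crude estimate of the size of a Hamming ball. -/
theorem exists_code_card_ge (ι α : Type*) [Fintype ι] [DecidableEq ι] [Fintype α]
    [DecidableEq α] [Nonempty α] (r : ℕ) :
    ∃ K : Finset (ι → α), (∀ f ∈ K, ∀ g ∈ K, f ≠ g → r < hammingDist f g) ∧
      Fintype.card α ^ Fintype.card ι ≤ #K * (2 ^ Fintype.card ι * Fintype.card α ^ r) := by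
  let F : Finset (Finset (ι → α)) := {K | ∀ f ∈ K, ∀ g ∈ K, f ≠ g → r < hammingDist f g}
  obtain ⟨K, hKF, hmax⟩ := F.exists_max_image card ⟨∅, by simp [F]⟩
  have hK : ∀ f ∈ K, ∀ g ∈ K, f ≠ g → r < hammingDist f g := by simpa [F] using hKF
  refine ⟨K, hK, ?_⟩
  have hcover : (univ : Finset (ι → α)) ⊆ K.biUnion fun f => {g | hammingDist f g ≤ r} := by
    intro g _
    by_contra hg
    have hfar : ∀ f ∈ K, r < hammingDist f g := by simpa using hg
    have hgK : g ∉ K := fun h => by simpa using hfar g h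
    have hins : insert g K ∈ F := by
      simp only [F, mem_filter_univ, mem_insert]
      rintro a (rfl | ha) b (rfl | hb) hab
      · exact absurd rfl hab
      · rw [hammingDist_comm]; exact hfar b hb
      · exact hfar a ha
      · exact hK a ha b hb hab
    have := hmax _ hins
    rw [card_insert_of_notMem hgK] at this
    omega
  calc Fintype.card α ^ Fintype.card ι = #(univ : Finset (ι → α)) := by simp
    _ ≤ _ := card_le_card hcover
    _ ≤ _ := card_biUnion_le_card_mul _ _ _ fun f _ => card_hammingBall_le f r

open Finset in
/-- The graph of a function, transported along an embedding of the product. -/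
def graphFinset {ι α β : Type*} [Fintype ι] (e : ι × α ↪ β) (f : ι → α) : Finset β :=
  univ.map ⟨fun i => e (i, f i), fun _ _ h => congrArg Prod.fst (e.injective h)⟩

open Finset in
theorem card_graphFinset {ι α β : Type*} [Fintype ι] (e : ι × α ↪ β) (f : ι → α) :
    #(graphFinset e f) = Fintype.card ι := by
  simp [graphFinset]

open Finset in
theorem apply_mem_graphFinset {ι α β : Type*} [Fintype ι] (e : ι × α ↪ β) (f : ι → α)
    (i : ι) (a : α) : e (i, a) ∈ graphFinset e f ↔ f i = a := by
  refine mem_map.trans ⟨fun ⟨j, _, hj⟩ => ?_, fun h => ⟨i, mem_univ i, by rw [← h]; rfl⟩⟩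
  obtain ⟨rfl, h⟩ := Prod.mk.inj (e.injective hj)
  exact h

open Finset in
theorem hammingDist_le_card_graphFinset_sdiff {ι α β : Type*} [Fintype ι] [DecidableEq α]
    [DecidableEq β] (e : ι × α ↪ β) (f g : ι → α) :
    hammingDist f g ≤ #(graphFinset e f \ graphFinset e g) := by
  refine card_le_card_of_injOn (fun i => e (i, f i)) (fun i hi => ?_)
    fun i _ j _ h => congrArg Prod.fst (e.injective h)
  have hne : f i ≠ g i := by simpa using hi
  simp [apply_mem_graphFinset, hne.symm]

open Finset in
theorem two_mul_hammingDist_le_card_symmDiff {ι α β : Type*} [Fintype ι] [DecidableEq α]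
    [DecidableEq β] (e : ι × α ↪ β) (f g : ι → α) :
    2 * hammingDist f g ≤ #(symmDiff (graphFinset e f) (graphFinset e g)) := by
  have hfg := hammingDist_le_card_graphFinset_sdiff e f g
  have hgf := hammingDist_le_card_graphFinset_sdiff e g f
  rw [hammingDist_comm] at hgf
  rw [symmDiff_def, sup_eq_union, card_union_of_disjoint disjoint_sdiff_sdiff]
  omega

theorem graphFinset_injective {ι α β : Type*} [Fintype ι] (e : ι × α ↪ β) :
    Function.Injective (graphFinset e) := by
  intro f g h
  ext i
  have hi : e (i, g i) ∈ graphFinset e f := by rw [h, apply_mem_graphFinset]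
  exact (apply_mem_graphFinset e f i (g i)).1 hi

/-- The numerical estimate turning the Gilbert–Varshamov bound into a bound on `log s`. -/
theorem mul_log_div_le_log_of_pow_le {N ℓ m s : ℕ} (hℓ : 1 ≤ ℓ) (hm : 3 ≤ m)
    (hN : N ≤ ℓ * m ^ 2) (hN0 : 0 < N)
    (hs : m ^ (2 * ℓ) ≤ s * (2 ^ (2 * ℓ) * m ^ (ℓ / 2))) :
    (1 / 12 : ℝ) * ℓ * Real.log ((N : ℝ) / ℓ) ≤ Real.log s := by
  have hℓ' : (0 : ℝ) < ℓ := by exact_mod_cast hℓ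
  have hm' : (0 : ℝ) < m := by positivity
  have hs0 : s ≠ 0 := by
    rintro rfl
    have : 0 < m ^ (2 * ℓ) := by positivity
    omega
  have hs' : (0 : ℝ) < s := by positivity
  have hlogN : Real.log ((N : ℝ) / ℓ) ≤ 2 * Real.log m := by
    have hle : (N : ℝ) / ℓ ≤ (m : ℝ) ^ 2 := by
      rw [div_le_iff₀ hℓ', mul_comm]
      exact_mod_cast hN
    simpa using Real.log_le_log (by positivity) hle
  have hlogs : 2 * ℓ * Real.log m ≤
      Real.log s + (2 * ℓ * Real.log 2 + (ℓ / 2 : ℕ) * Real.log m) := by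
    have hsR : (m : ℝ) ^ (2 * ℓ) ≤ s * (2 ^ (2 * ℓ) * (m : ℝ) ^ (ℓ / 2)) := by
      exact_mod_cast hs
    have h := Real.log_le_log (by positivity) hsR
    rw [Real.log_mul hs'.ne' (by positivity), Real.log_mul (by positivity) (by positivity)] at h
    simpa only [Real.log_pow, Nat.cast_mul, Nat.cast_ofNat] using h
  have hlogm : 6 * Real.log 2 ≤ 4 * Real.log m := by
    have hle : (2 : ℝ) ^ 6 ≤ (m : ℝ) ^ 4 := by
      exact_mod_cast (by norm_num : 2 ^ 6 ≤ 3 ^ 4).trans (Nat.pow_le_pow_left hm 4)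
    simpa using Real.log_le_log (by positivity) hle
  have hm0 : 0 ≤ Real.log m := Real.log_natCast_nonneg m
  have hhalf : ((ℓ / 2 : ℕ) : ℝ) * Real.log m ≤ ℓ / 2 * Real.log m := by
    gcongr
    exact Nat.cast_div_le
  have h1 := mul_le_mul_of_nonneg_left hlogN hℓ'.le
  have h2 := mul_le_mul_of_nonneg_left hlogm hℓ'.le
  linarith


/-- **Lemma A.1 (Birgé–Massart).**  There exists a numerical constant `C > 0` such that
for all integers `N, ℓ` with `N ≥ 6ℓ ≥ 6`, there is a subset `Ω` of
`Ω_{2ℓ} = {ω ∈ {0,1}^N : Σ_j ω_j = 2ℓ}` such that the Hamming distance between any two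
distinct elements of `Ω` is at least `ℓ + 1`, and its cardinality `s` satisfies
`log s ≥ C ℓ log(N/ℓ)`.  Here vectors `ω ∈ {0,1}^N` with `Σ_j ω_j = 2ℓ` are identified
with subsets of `{1,…,N}` of cardinality `2ℓ`, under which the Hamming distance
`ρ(ω,ω') = Σ_j 1{ω_j ≠ ω'_j}` is the cardinality of the symmetric difference. -/
theorem birge_massart_extraction :
    ∃ C : ℝ, 0 < C ∧ ∀ N ℓ : ℕ, 1 ≤ ℓ → 6 * ℓ ≤ N →
      ∃ Ω : Finset (Finset (Fin N)),
        (∀ A ∈ Ω, A.card = 2 * ℓ) ∧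
        (∀ A ∈ Ω, ∀ B ∈ Ω, A ≠ B → ℓ + 1 ≤ (symmDiff A B).card) ∧
        C * ℓ * Real.log ((N : ℝ) / ℓ) ≤ Real.log Ω.card := by
  refine ⟨1 / 12, by norm_num, fun N ℓ hℓ hN => ?_⟩
  set m := N / (2 * ℓ) with hmdef
  have hm : 3 ≤ m := (Nat.le_div_iff_mul_le (by omega)).2 (by omega)
  have hmN : 2 * ℓ * m ≤ N := Nat.mul_div_le N (2 * ℓ)
  have hNm : N ≤ ℓ * m ^ 2 := by
    have hlt : N < 2 * ℓ * (m + 1) := Nat.lt_mul_div_succ N (by omega)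
    nlinarith [Nat.mul_le_mul_left ℓ (by nlinarith : 2 * (m + 1) ≤ m ^ 2)]
  have : Nonempty (Fin m) := ⟨⟨0, by omega⟩⟩
  obtain ⟨K, hK, hcard⟩ := exists_code_card_ge (Fin (2 * ℓ)) (Fin m) (ℓ / 2)
  let e : Fin (2 * ℓ) × Fin m ↪ Fin N :=
    finProdFinEquiv.toEmbedding.trans (Fin.castLEEmb hmN)
  refine ⟨K.map ⟨graphFinset e, graphFinset_injective e⟩, ?_, ?_, ?_⟩
  · intro A hA
    obtain ⟨f, -, rfl⟩ := Finset.mem_map.1 hA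
    simpa using card_graphFinset e f
  · intro A hA B hB hAB
    obtain ⟨f, hf, rfl⟩ := Finset.mem_map.1 hA
    obtain ⟨g, hg, rfl⟩ := Finset.mem_map.1 hB
    have hfar := hK f hf g hg (fun h => hAB (by rw [h]))
    have hdist := two_mul_hammingDist_le_card_symmDiff e f g
    simp only [Function.Embedding.coeFn_mk]
    omega
  · rw [Finset.card_map]
    exact mul_log_div_le_log_of_pow_le hℓ hm hNm (by omega) (by simpa using hcard)
end

section
/- For all real numbers a and b with |a| < 1 and |b| < 1/2, one has (1 + a) · log((1 + a)/(1 + b)) ≤ (a − b) + 2(a − b)². -/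
/-- For all real numbers `a` and `b` with `|a| < 1` and `|b| < 1/2`, one has
`(1 + a) * log((1 + a)/(1 + b)) ≤ (a - b) + 2 * (a - b)^2`. -/
theorem inequality_log_ratio (a b : ℝ) (ha : |a| < 1) (hb : |b| < 1 / 2) :
    (1 + a) * Real.log ((1 + a) / (1 + b)) ≤ (a - b) + 2 * (a - b) ^ 2 := by
  obtain ⟨ha1, ha2⟩ := abs_lt.mp ha
  obtain ⟨hb1, hb2⟩ := abs_lt.mp hb
  have hA : 0 < 1 + a := by linarith
  have hB : 0 < 1 + b := by linarith
  have hinv : 1 / (1 + b) ≤ 2 := by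
    rw [div_le_iff₀ hB]
    linarith
  calc (1 + a) * Real.log ((1 + a) / (1 + b))
      ≤ (1 + a) * ((1 + a) / (1 + b) - 1) :=
        mul_le_mul_of_nonneg_left (Real.log_le_sub_one_of_pos (div_pos hA hB)) hA.le
    _ = (a - b) + 1 / (1 + b) * (a - b) ^ 2 := by
        field_simp
        ring
    _ ≤ (a - b) + 2 * (a - b) ^ 2 := by gcongr
end
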